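/- Fix τ > 0, M > 2ζ(1+τ), ρ > 0 and suppose 0 < r' < r, E ∈ C_{r,ℝ}, A ∈ C^±_{r,ℝ} with ‖A−1‖^±_r ≤ 1/6. Then there exists a unique w ∈ C^±_{r',ℝ}, denoted F(A,E), such that ⟨w⟩ = 0 and A·Δ(Aw) − (Aw)·ΔA = A·E − ⟨A·E⟩. Moreover ∂_θ w ∈ C^±_{r',ℝ} and there is a constant C₂ > 0 depending only on τ such that ‖w‖^±_{r'} ≤ C₂ M⁴ (r−r')^{−2σ} ‖E‖_r and ‖∂_θ w‖^±_{r'} ≤ C₂ M⁴ (r−r')^{−2σ−1} ‖E‖_r, where σ := 4+2τ. -/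

import Mathlib

open Complex Metric Set OnePoint

noncomputable section

/-- Real Riemann zeta value `ζ(s) = Σ_{m≥1} m^{-s}` for real `s`. -/
def zetaR (s : ℝ) : ℝ := ∑' n : ℕ, 1 / (n + 1 : ℝ) ^ s

/-- The set `A_M^ℝ` of real `(2+τ)`-Diophantine numbers with constant `M`. -/
def AMR (τ M : ℝ) : Set ℝ :=
  {ω | ∀ n : ℤ, ∀ m : ℕ, 0 < m → 1 / (M * (m : ℝ) ^ (2 + τ)) ≤ |ω - n / m|}

/-- The complex extension `A_M^ℂ`. -/
def AMC (τ M : ℝ) : Set ℂ :=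
  {ω | ∃ ω₀ ∈ AMR τ M, |ω₀ - ω.re| ≤ |ω.im|}

/-- `E(ω) = e^{2πiω}`. -/
def Efn (ω : ℂ) : ℂ := Complex.exp (2 * Real.pi * Complex.I * ω)

/-- The compact set `K_M = E(A_M^ℂ) ∪ {0,∞}` in the Riemann sphere `Ĉ = ℂ ∪ {∞}`. -/
def KM (τ M : ℝ) : Set (OnePoint ℂ) :=
  (fun ω => ((Efn ω : ℂ) : OnePoint ℂ)) '' AMC τ M ∪ {((0 : ℂ) : OnePoint ℂ), ∞}

/-- The chart `ξ ↦ 1/ξ` of the Riemann sphere at `∞`. -/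
def sphChart (ξ : ℂ) : OnePoint ℂ := if ξ = 0 then ∞ else ((ξ⁻¹ : ℂ) : OnePoint ℂ)

/-- `K ∩ ℂ`, in the coordinate `q`. -/
def finPart (K : Set (OnePoint ℂ)) : Set ℂ := {q : ℂ | (q : OnePoint ℂ) ∈ K}
/-- `K̃ = {ξ : 1/ξ ∈ K}`, the set `K` read in the coordinate `ξ = 1/q`. -/
def infPart (K : Set (OnePoint ℂ)) : Set ℂ := {ξ : ℂ | sphChart ξ ∈ K}

variable {α : Type*} {B : Type*} [NormedAddCommGroup B] [NormedSpace ℂ B]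

/-- Difference quotient error `Ω_{u,g}(q,q') = (u(q')−u(q))/(q'−q) − g(q)`,
for functions with values in a space of functions on `α`. -/
def omegaF (u g : ℂ → α → B) (p : ℂ × ℂ) (a : α) : B :=
  if p.1 = p.2 then 0 else (p.2 - p.1)⁻¹ • (u p.2 a - u p.1 a) - g p.1 a

/-- Continuity on `K` for the sup-norm over `S` of the values. -/
def ContSup (K : Set ℂ) (S : Set α) (u : ℂ → α → B) : Prop :=
  ∀ q ∈ K, ∀ ε > (0 : ℝ), ∃ δ > (0 : ℝ), ∀ q' ∈ K, dist q' q < δ →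
    ∀ a ∈ S, ‖u q' a - u q a‖ ≤ ε

/-- Continuity on `K × K` for the sup-norm over `S` of the values. -/
def ContSup2 (K : Set ℂ) (S : Set α) (F : ℂ × ℂ → α → B) : Prop :=
  ∀ p ∈ K ×ˢ K, ∀ ε > (0 : ℝ), ∃ δ > (0 : ℝ), ∀ p' ∈ K ×ˢ K, dist p' p < δ →
    ∀ a ∈ S, ‖F p' a - F p a‖ ≤ ε

/-- `u` is `C¹`-holomorphic on `K ⊂ ℂ` with derivative `g`, with values in the
space of bounded functions on `S` (sup norm). -/
def FPair (K : Set ℂ) (S : Set α) (u g : ℂ → α → B) : Prop :=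
  ContSup K S u ∧ ContSup K S g ∧ ContSup2 K S (omegaF u g)

def fn0 (K : Set ℂ) (S : Set α) (u : ℂ → α → B) : ℝ :=
  sSup {x : ℝ | ∃ q ∈ K, ∃ a ∈ S, x = ‖u q a‖}
def fdel (K : Set ℂ) (S : Set α) (u : ℂ → α → B) : ℝ :=
  sSup {x : ℝ | ∃ p ∈ K ×ˢ K, ∃ a ∈ S, x = ‖u (Prod.snd p) a - u (Prod.fst p) a‖}
def fn2 (K : Set ℂ) (S : Set α) (u g : ℂ → α → B) : ℝ :=
  sSup {x : ℝ | ∃ p ∈ K ×ˢ K, ∃ a ∈ S, x = ‖omegaF u g p a‖}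

/-- The `C¹_hol` norm `n₀ + max(sup‖φ'‖, sup‖δφ‖) + n₂` (one chart). -/
def fNorm (K : Set ℂ) (S : Set α) (u g : ℂ → α → B) : ℝ :=
  fn0 K S u + max (fn0 K S g) (fdel K S u) + fn2 K S u g

def FBdd (K : Set ℂ) (S : Set α) (u g : ℂ → α → B) : Prop :=
  BddAbove {x : ℝ | ∃ q ∈ K, ∃ a ∈ S, x = ‖u q a‖} ∧
    BddAbove {x : ℝ | ∃ q ∈ K, ∃ a ∈ S, x = ‖g q a‖} ∧
    BddAbove {x : ℝ | ∃ p ∈ K ×ˢ K, ∃ a ∈ S, x = ‖omegaF u g p a‖}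

/-- `C¹`-holomorphy on a subset `K` of the Riemann sphere: `C¹`-holomorphy in
both charts `q` and `ξ = 1/q`, with chartwise derivatives `g` and `h`. -/
def SPair (K : Set (OnePoint ℂ)) (S : Set α) (u : OnePoint ℂ → α → B)
    (g h : ℂ → α → B) : Prop :=
  FPair (finPart K) S (fun q : ℂ => u (q : OnePoint ℂ)) g ∧
    FPair (infPart K) S (fun ξ : ℂ => u (sphChart ξ)) h

def SBdd (K : Set (OnePoint ℂ)) (S : Set α) (u : OnePoint ℂ → α → B)
    (g h : ℂ → α → B) : Prop :=
  FBdd (finPart K) S (fun q : ℂ => u (q : OnePoint ℂ)) g ∧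
    FBdd (infPart K) S (fun ξ : ℂ => u (sphChart ξ)) h

/-- The `C¹_hol(K,·)` norm for `K ⊂ Ĉ`: max of the norms in the two charts. -/
def sNorm (K : Set (OnePoint ℂ)) (S : Set α) (u : OnePoint ℂ → α → B)
    (g h : ℂ → α → B) : ℝ :=
  max (fNorm (finPart K) S (fun q : ℂ => u (q : OnePoint ℂ)) g)
    (fNorm (infPart K) S (fun ξ : ℂ => u (sphChart ξ)) h)

/-- The strip `S_r` (identified with `{x ∈ ℂ/ℤ : |Im x| < r}` via 1-periodicity). -/
def Strip (r : ℝ) : Set ℂ := {z : ℂ | |z.im| < r}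

/-- `S_r × D_ρ`, the domain of the elements of `B_{r,ρ} = H^∞(S_r × D_ρ)`. -/
def SD (r ρ : ℝ) : Set (ℂ × ℂ) := Strip r ×ˢ Metric.ball (0 : ℂ) ρ

/-- Membership of a value in `B_{r,ρ} = H^∞(S_r × D_ρ) = H^∞(S_r, B_ρ)`:
1-periodicity in `θ` and holomorphy on `S_r × D_ρ` (boundedness being part of
the `C¹_hol` data). -/
def ValHol (r ρ : ℝ) (v : ℂ × ℂ → ℂ) : Prop :=
  (∀ θ ε : ℂ, v (θ + 1, ε) = v (θ, ε)) ∧ DifferentiableOn ℂ v (SD r ρ)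

/-- `u ∈ C_r = C¹_hol(K_M, H^∞(S_r, B_ρ))`, with chartwise derivative data `g, h`. -/
def MemC (τ M r ρ : ℝ) (u : OnePoint ℂ → ℂ × ℂ → ℂ) (g h : ℂ → ℂ × ℂ → ℂ) : Prop :=
  SPair (KM τ M) (SD r ρ) u g h ∧ SBdd (KM τ M) (SD r ρ) u g h ∧
    ∀ q ∈ KM τ M, ValHol r ρ (u q)

/-- The norm `‖u‖_r` of `u ∈ C_r`, given its derivative data `g, h`. -/
def CNorm (τ M r ρ : ℝ) (u : OnePoint ℂ → ℂ × ℂ → ℂ) (g h : ℂ → ℂ × ℂ → ℂ) : ℝ :=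
  sNorm (KM τ M) (SD r ρ) u g h

/-- The `k`-th Fourier coefficient `φ̂_k(q) ∈ B_ρ` of `u(q) ∈ H^∞(S_r, B_ρ)`. -/
def fhat (u : OnePoint ℂ → ℂ × ℂ → ℂ) (k : ℤ) (q : OnePoint ℂ) (ε : ℂ) : ℂ :=
  ∫ t in (0:ℝ)..1, u q ((t : ℂ), ε) * Complex.exp (-(2 * Real.pi * Complex.I * k * t))

/-- `e_k(θ) = e^{2πikθ}`. -/
def ek (k : ℤ) (θ : ℂ) : ℂ := Complex.exp (2 * Real.pi * Complex.I * k * θ)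

/-- `up = u⁺`, i.e. `up(q,θ) = Σ_k q^k û_k(q) e_k(θ)` on `K_M` (for `q = e^{2πiω}`
this is `u(q, θ+ω)`). -/
def IsPlus (τ M r ρ : ℝ) (u up : OnePoint ℂ → ℂ × ℂ → ℂ) : Prop :=
  ∀ q : ℂ, (q : OnePoint ℂ) ∈ KM τ M → q ≠ 0 → ∀ θ ∈ Strip r,
    ∀ ε ∈ Metric.ball (0 : ℂ) ρ,
      HasSum (fun k : ℤ => q ^ k * fhat u k (q : OnePoint ℂ) ε * ek k θ)
        (up (q : OnePoint ℂ) (θ, ε))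

/-- `um = u⁻`, i.e. `um(q,θ) = Σ_k q^{-k} û_k(q) e_k(θ)`. -/
def IsMinus (τ M r ρ : ℝ) (u um : OnePoint ℂ → ℂ × ℂ → ℂ) : Prop :=
  ∀ q : ℂ, (q : OnePoint ℂ) ∈ KM τ M → q ≠ 0 → ∀ θ ∈ Strip r,
    ∀ ε ∈ Metric.ball (0 : ℂ) ρ,
      HasSum (fun k : ℤ => q ^ (-k) * fhat u k (q : OnePoint ℂ) ε * ek k θ)
        (um (q : OnePoint ℂ) (θ, ε))

/-- The derivative `∂_θ` acting on values. -/
def dth (v : OnePoint ℂ → ℂ × ℂ → ℂ) (q : OnePoint ℂ) (p : ℂ × ℂ) : ℂ :=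
  deriv (fun t => v q (t, p.2)) p.1

/-- Real-symmetry (`u ∈ C_{r,ℝ}`): `conj(û_k(q)) = û_{-k}(1/q̄)` where
`(conj ψ)(ε) = conj(ψ(ε̄))` in `B_ρ`. -/
def RealSym (τ M : ℝ) (u : OnePoint ℂ → ℂ × ℂ → ℂ) : Prop :=
  ∀ k : ℤ, ∀ q : ℂ, (q : OnePoint ℂ) ∈ KM τ M → q ≠ 0 → ∀ ε : ℂ,
    starRingEnd ℂ (fhat u k (q : OnePoint ℂ) (starRingEnd ℂ ε)) =
      fhat u (-k) (((((starRingEnd ℂ) q)⁻¹ : ℂ) : OnePoint ℂ)) ε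

/-- `f ∈ C_r` (existence of `C¹`-holomorphic derivative data). -/
def InC (τ M r ρ : ℝ) (f : OnePoint ℂ → ℂ × ℂ → ℂ) : Prop :=
  ∃ g h : ℂ → ℂ × ℂ → ℂ, MemC τ M r ρ f g h

/-- Zero mean value in `θ`: `⟨w⟩ = 0` as an element of `C¹_hol(K_M, B_ρ)`. -/
def ZeroMean (τ M ρ : ℝ) (w : OnePoint ℂ → ℂ × ℂ → ℂ) : Prop :=
  ∀ q ∈ KM τ M, ∀ ε ∈ Metric.ball (0 : ℂ) ρ, (∫ t in (0:ℝ)..1, w q ((t : ℂ), ε)) = 0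

/-- The linearized equation `A·Δ(Aw) − (Aw)·ΔA = A·E − ⟨A·E⟩` (recall
`Δφ = φ⁺ − 2φ + φ⁻` and `(Aw)^± = A^± w^±`). -/
def SolvesLin (τ M ρ r' : ℝ) (A Ap Am E w wp wm : OnePoint ℂ → ℂ × ℂ → ℂ) : Prop :=
  ∀ q ∈ KM τ M, ∀ pt ∈ SD r' ρ,
    A q pt * (Ap q pt * wp q pt - 2 * (A q pt * w q pt) + Am q pt * wm q pt) -
        A q pt * w q pt * (Ap q pt - 2 * A q pt + Am q pt) =
      A q pt * E q pt - ∫ t in (0:ℝ)..1, A q ((t : ℂ), pt.2) * E q ((t : ℂ), pt.2)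

/-- The `k`-th Fourier coefficient of a function of one complex variable, computed on `[0, 1]`. -/
def fcoef (v : ℂ → ℂ) (k : ℤ) : ℂ :=
  ∫ t in (0:ℝ)..1, v t * Complex.exp (-(2 * Real.pi * Complex.I * k * t))

/-- `v` is `1`-periodic and holomorphic on the strip of half-width `r`. -/
structure PerHol (r : ℝ) (v : ℂ → ℂ) : Prop where
  per : ∀ θ ∈ Strip r, v (θ + 1) = v θ
  hol : DifferentiableOn ℂ v (Strip r)

theorem ek_add (k : ℤ) (x y : ℂ) : ek k (x + y) = ek k x * ek k y := by
  simp only [ek, ← Complex.exp_add]; congr 1; ring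

theorem ek_int (k : ℤ) (n : ℤ) : ek k n = 1 := by
  simp only [ek]
  rw [Complex.exp_eq_one_iff]
  exact ⟨k * n, by push_cast; ring⟩

theorem ek_one (k : ℤ) : ek k 1 = 1 := by simpa using ek_int k 1

theorem ek_zero (k : ℤ) : ek k 0 = 1 := by simp [ek]

theorem ek_zero_left (z : ℂ) : ek 0 z = 1 := by simp [ek]

theorem ek_mul_neg (k : ℤ) (z : ℂ) : ek k z * ek (-k) z = 1 := by
  simp only [ek, ← Complex.exp_add]
  rw [Complex.exp_eq_one_iff]
  exact ⟨0, by push_cast; ring⟩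

theorem ek_mul_ek (k l : ℤ) (z : ℂ) : ek k z * ek l z = ek (k + l) z := by
  simp only [ek, ← Complex.exp_add]; congr 1; push_cast; ring

theorem norm_ek (k : ℤ) (z : ℂ) : ‖ek k z‖ = Real.exp (-(2 * Real.pi * k * z.im)) := by
  rw [ek, Complex.norm_exp]
  congr 1
  simp

theorem norm_ek_le (k : ℤ) {z : ℂ} {s : ℝ} (hz : |z.im| ≤ s) :
    ‖ek k z‖ ≤ Real.exp (2 * Real.pi * |(k : ℝ)| * s) := by
  rw [norm_ek]
  refine Real.exp_le_exp.2 ((le_abs_self _).trans ?_)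
  rw [abs_neg, abs_mul, abs_mul, abs_of_pos Real.two_pi_pos]
  gcongr

theorem differentiable_ek (k : ℤ) : Differentiable ℂ (ek k) := by
  unfold ek; fun_prop

theorem continuous_ek (k : ℤ) : Continuous (ek k) := (differentiable_ek k).continuous

theorem fcoef_eq (v : ℂ → ℂ) (k : ℤ) : fcoef v k = ∫ t in (0:ℝ)..1, v t * ek (-k) t := by
  unfold fcoef ek
  congr 1; ext t; congr 2; push_cast; ring

theorem isOpen_Strip (r : ℝ) : IsOpen (Strip r) := by
  unfold Strip
  exact isOpen_lt (by fun_prop) continuous_const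

theorem ofReal_mem_Strip {r : ℝ} (hr : 0 < r) (t : ℝ) : (t : ℂ) ∈ Strip r := by
  simpa [Strip] using hr

/-- Cauchy's theorem: the mean of a periodic function is the same along the two boundary lines. -/
theorem integral_add_mul_I (G : ℂ → ℂ) (y : ℝ) (hc : ContinuousOn G {z | z.im ∈ uIcc 0 y})
    (hd : DifferentiableOn ℂ G {z | z.im ∈ Ioo (min 0 y) (max 0 y)})
    (hp : ∀ z : ℂ, z.im ∈ uIcc 0 y → G (z + 1) = G z) :
    ∫ t in (0:ℝ)..1, G (t + y * I) = ∫ t in (0:ℝ)..1, G t := by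
  have key := integral_boundary_rect_eq_zero_of_continuousOn_of_differentiableOn G 0 (1 + y * I)
    (hc.mono fun z hz => by simpa using hz.2) (hd.mono fun z hz => by simpa using hz.2)
  have hI : (∫ s : ℝ in (0:ℝ)..y, G (1 + s * I)) = ∫ s : ℝ in (0:ℝ)..y, G (s * I) := by
    refine intervalIntegral.integral_congr fun s hs => ?_
    have := hp (s * I) (by simpa using hs)
    simpa [add_comm] using this
  simp only [zero_re, zero_im, add_re, one_re, mul_re, ofReal_re, I_re, mul_zero, ofReal_im, I_im,
    mul_one, sub_self, add_zero, add_im, one_im, mul_im, zero_add, ofReal_zero, zero_mul,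
    ofReal_one] at key
  rw [hI, add_sub_cancel_right, sub_eq_zero] at key
  exact key.symm

/-- The mean of a periodic function is invariant under a complex translation. -/
theorem integral_add_complex (G : ℂ → ℂ) (ω : ℂ) (hc : ContinuousOn G {z | z.im ∈ uIcc 0 ω.im})
    (hd : DifferentiableOn ℂ G {z | z.im ∈ Ioo (min 0 ω.im) (max 0 ω.im)})
    (hp : ∀ z : ℂ, z.im ∈ uIcc 0 ω.im → G (z + 1) = G z) :
    ∫ t in (0:ℝ)..1, G (t + ω) = ∫ t in (0:ℝ)..1, G t := by
  rw [← integral_add_mul_I G ω.im hc hd hp]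
  have hper : Function.Periodic (fun t : ℝ => G (t + ω.im * I)) 1 := by
    intro t
    have := hp (t + ω.im * I) (by simp)
    simp only [ofReal_add, ofReal_one]
    rw [← this]; ring_nf
  have h1 : ∀ t : ℝ, G (t + ω) = (fun t : ℝ => G (t + ω.im * I)) (t + ω.re) := by
    intro t
    simp only [ofReal_add]
    rw [add_assoc, re_add_im]
  simp_rw [h1]
  rw [intervalIntegral.integral_comp_add_right (fun t : ℝ => G (t + ω.im * I))]
  have := hper.intervalIntegral_add_eq ω.re 0
  simpa [add_comm] using this

theorem PerHol.mul_ek {r : ℝ} {v : ℂ → ℂ} (h : PerHol r v) (k : ℤ) :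
    PerHol r (fun θ => v θ * ek k θ) where
  per θ hθ := by rw [h.per θ hθ, ek_add, ek_one, mul_one]
  hol := h.hol.mul (differentiable_ek k).differentiableOn

theorem mem_Strip_of_mem_uIcc {r : ℝ} {ω : ℂ} (hω : |ω.im| < r) {z : ℂ}
    (hz : z.im ∈ uIcc 0 ω.im) : z ∈ Strip r := by
  have := abs_sub_left_of_mem_uIcc hz
  simp only [sub_zero] at this
  exact this.trans_lt hω

theorem PerHol.integral_add {r : ℝ} {v : ℂ → ℂ} (h : PerHol r v) {ω : ℂ} (hω : |ω.im| < r) :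
    ∫ t in (0:ℝ)..1, v (t + ω) = ∫ t in (0:ℝ)..1, v t :=
  integral_add_complex v ω (h.hol.continuousOn.mono fun _ hz => mem_Strip_of_mem_uIcc hω hz)
    (h.hol.mono fun _ hz => mem_Strip_of_mem_uIcc hω (Ioo_subset_Icc_self hz))
    fun z hz => h.per z (mem_Strip_of_mem_uIcc hω hz)

theorem PerHol.fcoef_add {r : ℝ} {v : ℂ → ℂ} (h : PerHol r v) {ω : ℂ} (hω : |ω.im| < r) (k : ℤ) :
    fcoef (fun θ => v (θ + ω)) k = ek k ω * fcoef v k := by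
  have := (h.mul_ek (-k)).integral_add hω
  rw [fcoef_eq, fcoef_eq, ← this, ← intervalIntegral.integral_const_mul]
  congr 1; ext t
  rw [ek_add]
  have := ek_mul_neg k ω
  linear_combination (-(v (t + ω) * ek (-k) t)) * this

theorem norm_fcoef_le {v : ℂ → ℂ} {N : ℝ} (h : ∀ t : ℝ, ‖v t‖ ≤ N) (k : ℤ) : ‖fcoef v k‖ ≤ N := by
  rw [fcoef_eq]
  have := intervalIntegral.norm_integral_le_of_norm_le_const (a := 0) (b := 1) (C := N)
    (f := fun t : ℝ => v t * ek (-k) t) (fun t _ => by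
      rw [norm_mul, norm_ek]; simpa using h t)
  simpa using this

theorem PerHol.norm_fcoef_le_of_lt {r : ℝ} {v : ℂ → ℂ} (h : PerHol r v) {N : ℝ}
    (hN : ∀ θ ∈ Strip r, ‖v θ‖ ≤ N) (k : ℤ) {s : ℝ} (hs : |s| < r) :
    ‖fcoef v k‖ ≤ N * Real.exp (2 * Real.pi * k * s) := by
  have h1 := h.fcoef_add (ω := s * I) (by simpa using hs) k
  have h2 : ‖fcoef (fun θ => v (θ + s * I)) k‖ ≤ N :=
    norm_fcoef_le (v := fun θ => v (θ + s * I)) (fun t => hN _ (by simpa [Strip] using hs)) k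
  rw [h1, norm_mul, norm_ek] at h2
  simp only [mul_im, ofReal_re, I_im, mul_one, ofReal_im, I_re, mul_zero, add_zero,
    Real.exp_neg] at h2
  rwa [inv_mul_le_iff₀ (Real.exp_pos _), mul_comm] at h2

theorem PerHol.norm_fcoef_le {r : ℝ} (hr : 0 < r) {v : ℂ → ℂ} (h : PerHol r v) {N : ℝ}
    (hN : ∀ θ ∈ Strip r, ‖v θ‖ ≤ N) (k : ℤ) :
    ‖fcoef v k‖ ≤ N * Real.exp (-(2 * Real.pi * |(k : ℝ)| * r)) := by
  have key : ∀ s ∈ Ico 0 r, ‖fcoef v k‖ ≤ N * Real.exp (-(2 * Real.pi * |(k : ℝ)| * s)) := by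
    intro s hs
    rcases le_total 0 (k : ℝ) with hk | hk
    · have := h.norm_fcoef_le_of_lt hN k (s := -s) (by rw [abs_neg, abs_of_nonneg hs.1]; exact hs.2)
      rw [abs_of_nonneg hk]
      convert this using 3; ring
    · have := h.norm_fcoef_le_of_lt hN k (s := s) (by rw [abs_of_nonneg hs.1]; exact hs.2)
      rw [abs_of_nonpos hk]
      convert this using 3; ring
  have hcont : Continuous fun s : ℝ => N * Real.exp (-(2 * Real.pi * |(k : ℝ)| * s)) := by fun_prop
  have : (nhdsWithin r (Ico 0 r)).NeBot := by
    rw [← mem_closure_iff_nhdsWithin_neBot, closure_Ico hr.ne]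
    exact ⟨hr.le, le_rfl⟩
  exact ge_of_tendsto (hcont.continuousWithinAt (s := Ico 0 r) (x := r)).tendsto
    (Filter.eventually_of_mem self_mem_nhdsWithin key)

theorem fourierCoeff_lift (f : C(AddCircle (1:ℝ), ℂ)) (v : ℂ → ℂ)
    (h : ∀ t : ℝ, f t = v t) (k : ℤ) :
    fourierCoeff f k = fcoef v k := by
  rw [fourierCoeff_eq_intervalIntegral f k 0, fcoef]
  simp only [div_one, one_smul, zero_add]
  congr 1; ext t
  rw [fourier_coe_apply, h, smul_eq_mul, mul_comm]
  congr 2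
  push_cast
  ring

theorem hasSum_fcoef_zero {v : ℂ → ℂ} (hc : Continuous fun t : ℝ => v t)
    (hp : ∀ t : ℝ, v (t + 1) = v t) (hs : Summable fun k => ‖fcoef v k‖) :
    HasSum (fcoef v) (v 0) := by
  have hper : Function.Periodic (fun t : ℝ => v t) 1 := by
    intro t; simpa using hp t
  let f : C(AddCircle (1:ℝ), ℂ) := ⟨hper.lift, by
    refine continuous_coinduced_dom.2 ?_
    exact hc⟩
  have hf : ∀ t : ℝ, f t = v t := fun t => hper.lift_coe t
  have e : fourierCoeff f = fcoef v := funext fun k => fourierCoeff_lift f v hf k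
  have := has_pointwise_sum_fourier_series_of_summable (f := f) (by rw [e]; exact hs.of_norm)
    ((0:ℝ) : AddCircle (1:ℝ))
  rw [e, hf] at this
  simpa using this

theorem summable_exp_neg_abs {c : ℝ} (hc : 0 < c) :
    Summable fun k : ℤ => Real.exp (-(c * |(k : ℝ)|)) := by
  have h : Summable fun n : ℕ => Real.exp (-(c * n)) := by
    have := Real.summable_exp_nat_mul_iff.2 (show -c < 0 by linarith)
    refine this.congr fun n => by congr 1; ring
  refine Summable.of_nat_of_neg ?_ ?_ <;> simpa using h

theorem PerHol.summable_norm {r : ℝ} {v : ℂ → ℂ} (h : PerHol r v) {N : ℝ}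
    (hN : ∀ θ ∈ Strip r, ‖v θ‖ ≤ N) {θ : ℂ} (hθ : θ ∈ Strip r) :
    Summable fun k => ‖fcoef v k * ek k θ‖ := by
  have hr : 0 < r := (abs_nonneg _).trans_lt hθ
  have hθ' : |θ.im| < r := hθ
  have hN0 : 0 ≤ N := (norm_nonneg _).trans (hN θ hθ)
  refine Summable.of_nonneg_of_le (fun _ => norm_nonneg _) (fun k => ?_)
    ((summable_exp_neg_abs (c := 2 * Real.pi * (r - |θ.im|))
      (mul_pos Real.two_pi_pos (by linarith))).mul_left N)
  rw [norm_mul]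
  refine (mul_le_mul (h.norm_fcoef_le hr hN k) (norm_ek_le k le_rfl) (norm_nonneg _)
    (by positivity)).trans (le_of_eq ?_)
  rw [mul_assoc, ← Real.exp_add]
  congr 2; ring

theorem PerHol.hasSum {r : ℝ} {v : ℂ → ℂ} (h : PerHol r v) {N : ℝ}
    (hN : ∀ θ ∈ Strip r, ‖v θ‖ ≤ N) {θ : ℂ} (hθ : θ ∈ Strip r) :
    HasSum (fun k => fcoef v k * ek k θ) (v θ) := by
  have e : fcoef (fun z => v (z + θ)) = fun k => fcoef v k * ek k θ :=
    funext fun k => by rw [h.fcoef_add hθ, mul_comm]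
  have hm : ∀ t : ℝ, (t : ℂ) + θ ∈ Strip r := fun t => by simpa [Strip] using hθ
  have := hasSum_fcoef_zero (v := fun z => v (z + θ))
    (h.hol.continuousOn.comp_continuous (by fun_prop) hm)
    (fun t => by rw [← h.per _ (hm t)]; congr 1; ring)
    (by rw [e]; exact h.summable_norm hN hθ)
  rw [e] at this
  simpa using this

theorem fcoef_of_hasSum {v : ℂ → ℂ} {c : ℤ → ℂ} (hc : Summable fun k => ‖c k‖)
    (hv : ∀ t : ℝ, HasSum (fun k => c k * ek k t) (v t)) (k : ℤ) : fcoef v k = c k := by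
  have hterm : ∀ j : ℤ, ∫ t in (0:ℝ)..1, c j * ek j t * ek (-k) t = if j = k then c k else 0 := by
    intro j
    have e : ∀ t : ℝ, c j * ek j t * ek (-k) t = c j * ek (j - k) t := fun t => by
      rw [mul_assoc, ek_mul_ek]; rfl
    simp_rw [e]
    rw [intervalIntegral.integral_const_mul]
    split_ifs with hj
    · subst hj; simp [ek_zero_left]
    · have hne : (2 * Real.pi * I * ((j - k : ℤ) : ℂ)) ≠ 0 := by
        have : ((j - k : ℤ) : ℂ) ≠ 0 := by exact_mod_cast sub_ne_zero.2 hj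
        exact mul_ne_zero Complex.two_pi_I_ne_zero this
      have := integral_exp_mul_complex (a := 0) (b := 1) hne
      unfold ek
      have h1 := ek_one (j - k)
      unfold ek at h1
      rw [this, ofReal_one, h1]
      simp
  have hs := intervalIntegral.hasSum_intervalIntegral_of_summable_norm (a := 0) (b := 1)
    (f := fun j => (⟨fun t : ℝ => c j * ek j t * ek (-k) t, by
      have := continuous_ek j; have := continuous_ek (-k); fun_prop⟩ : C(ℝ, ℂ)))
    (by
      refine Summable.of_nonneg_of_le (fun _ => norm_nonneg _) (fun j => ?_) hc
      rw [ContinuousMap.norm_le _ (norm_nonneg _)]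
      intro x
      simp [norm_ek])
  simp only [ContinuousMap.coe_mk, hterm] at hs
  have h2 : (fun t : ℝ => ∑' j, c j * ek j t * ek (-k) t) = fun t : ℝ => v t * ek (-k) t := by
    ext t
    exact ((hv t).mul_right _).tsum_eq
  rw [h2, ← fcoef_eq] at hs
  refine hs.unique ?_
  have := hasSum_ite_eq k (c k)
  simpa using this

theorem PerHol.eq_zero {r : ℝ} {v : ℂ → ℂ} (h : PerHol r v) {N : ℝ}
    (hN : ∀ θ ∈ Strip r, ‖v θ‖ ≤ N) (h0 : ∀ k, fcoef v k = 0) {θ : ℂ} (hθ : θ ∈ Strip r) :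
    v θ = 0 := by
  have := h.hasSum hN hθ
  simp only [h0, zero_mul] at this
  exact this.unique hasSum_zero

theorem Efn_zpow (ω : ℂ) (k : ℤ) : Efn ω ^ k = ek k ω := by
  unfold Efn ek
  rw [← Complex.exp_int_mul]
  congr 1; ring

/-- `vp` is the translate of `v` by the multiplier `q`, in terms of Fourier coefficients. -/
def IsShift (q : ℂ) (v vp : ℂ → ℂ) : Prop := ∀ k, fcoef vp k = q ^ k * fcoef v k

/-- `Φ` is a holomorphic interpolation between `v` on the real line and `vp` on its translate
by `ω`. -/
structure Hull (ω : ℂ) (v vp Φ : ℂ → ℂ) : Prop where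
  cont : ContinuousOn Φ {z | z.im ∈ uIcc 0 ω.im}
  diff : DifferentiableOn ℂ Φ {z | z.im ∈ Ioo (min 0 ω.im) (max 0 ω.im)}
  per : ∀ z : ℂ, z.im ∈ uIcc 0 ω.im → Φ (z + 1) = Φ z
  bdd : ∃ C, ∀ z : ℂ, z.im ∈ uIcc 0 ω.im → ‖Φ z‖ ≤ C
  left : ∀ t : ℝ, Φ t = v t
  right : ∀ t : ℝ, Φ (t + ω) = vp t

theorem norm_ek_le_of_mem_uIcc (k : ℤ) {ω z : ℂ} (hz : z.im ∈ uIcc 0 ω.im) :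
    ‖ek k z‖ ≤ 1 + ‖ek k ω‖ := by
  rw [norm_ek, norm_ek]
  have key : ∀ a b : ℝ, a ≤ 0 ∨ a ≤ b → Real.exp a ≤ 1 + Real.exp b := by
    rintro a b (h | h)
    · have := Real.exp_le_one_iff.2 h
      have := Real.exp_pos b
      linarith
    · have := Real.exp_le_exp.2 h
      linarith
  apply key
  have hpi := Real.two_pi_pos
  rcases mem_uIcc.1 hz with ⟨h1, h2⟩ | ⟨h1, h2⟩ <;> rcases le_total 0 (k : ℝ) with hk | hk
  · left
    have := mul_nonneg (mul_nonneg hpi.le hk) h1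
    linarith
  · right
    have := mul_nonneg (mul_nonneg hpi.le (neg_nonneg.2 hk)) (sub_nonneg.2 h2)
    nlinarith
  · right
    have := mul_nonneg (mul_nonneg hpi.le hk) (sub_nonneg.2 h1)
    nlinarith
  · left
    have := mul_nonneg (mul_nonneg hpi.le (neg_nonneg.2 hk)) (neg_nonneg.2 h2)
    nlinarith

theorem isOpen_im_Ioo (a b : ℝ) : IsOpen {z : ℂ | z.im ∈ Ioo a b} :=
  isOpen_Ioo.preimage continuous_im

theorem exists_hull {r : ℝ} (hr : 0 < r) {v vp : ℂ → ℂ} {N : ℝ} (hv : PerHol r v)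
    (hvp : PerHol r vp) (hN : ∀ θ ∈ Strip r, ‖v θ‖ ≤ N) (hNp : ∀ θ ∈ Strip r, ‖vp θ‖ ≤ N) {ω : ℂ}
    (h : IsShift (Efn ω) v vp) : ∃ Φ, Hull ω v vp Φ := by
  have h0 : (0 : ℂ) ∈ Strip r := by simpa using ofReal_mem_Strip hr 0
  set u : ℤ → ℝ := fun k => ‖fcoef v k‖ * (1 + ‖ek k ω‖) with hu
  have hsum : Summable u := by
    have h1 := hv.summable_norm hN h0
    have h2 := hvp.summable_norm hNp h0
    refine (h1.add h2).congr fun k => ?_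
    rw [h k, Efn_zpow]
    simp [hu, ek_zero]; ring
  have hle : ∀ k, ∀ z : ℂ, z.im ∈ uIcc 0 ω.im → ‖fcoef v k * ek k z‖ ≤ u k := fun k z hz => by
    rw [norm_mul]; exact mul_le_mul_of_nonneg_left (norm_ek_le_of_mem_uIcc k hz) (norm_nonneg _)
  refine ⟨fun z => ∑' k, fcoef v k * ek k z, ⟨?_, ?_, ?_, ⟨∑' k, u k, ?_⟩, ?_, ?_⟩⟩
  · exact continuousOn_tsum (fun k => (continuous_const.mul (continuous_ek k)).continuousOn)
      hsum fun k z hz => hle k z hz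
  · exact differentiableOn_tsum_of_summable_norm hsum
      (fun k => ((differentiable_const _).mul (differentiable_ek k)).differentiableOn)
      (isOpen_im_Ioo _ _) fun k z hz => hle k z (Ioo_subset_Icc_self hz)
  · intro z _
    simp only [ek_add, ek_one, mul_one]
  · intro z hz
    exact tsum_of_norm_bounded hsum.hasSum fun k => hle k z hz
  · intro t
    exact (hv.hasSum hN (ofReal_mem_Strip hr t)).tsum_eq
  · intro t
    have := (hvp.hasSum hNp (ofReal_mem_Strip hr t)).tsum_eq
    rw [← this]
    congr 1; ext k
    rw [h k, Efn_zpow, ek_add]; ring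

theorem Hull.isShift {ω : ℂ} {v vp Φ : ℂ → ℂ} (h : Hull ω v vp Φ) : IsShift (Efn ω) v vp := by
  intro k
  have := integral_add_complex (fun z => Φ z * ek (-k) z) ω
    (h.cont.mul (continuous_ek _).continuousOn)
    (h.diff.mul (differentiable_ek _).differentiableOn)
    (fun z hz => by rw [h.per z hz, ek_add, ek_one, mul_one])
  simp only [h.left, h.right, ek_add] at this
  rw [fcoef_eq, fcoef_eq, ← this, Efn_zpow, ← intervalIntegral.integral_const_mul]
  congr 1; ext t
  have := ek_mul_neg k ω
  linear_combination (-(vp t * ek (-k) t)) * this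

theorem Hull.mul {ω : ℂ} {v vp Φ u up Ψ : ℂ → ℂ} (h : Hull ω v vp Φ) (h' : Hull ω u up Ψ) :
    Hull ω (fun z => v z * u z) (fun z => vp z * up z) (fun z => Φ z * Ψ z) where
  cont := h.cont.mul h'.cont
  diff := h.diff.mul h'.diff
  per z hz := by rw [h.per z hz, h'.per z hz]
  bdd := by
    obtain ⟨C, hC⟩ := h.bdd
    obtain ⟨D, hD⟩ := h'.bdd
    refine ⟨C * D, fun z hz => ?_⟩
    rw [norm_mul]
    exact mul_le_mul (hC z hz) (hD z hz) (norm_nonneg _) ((norm_nonneg _).trans (hC z hz))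
  left t := by rw [h.left, h'.left]
  right t := by rw [h.right, h'.right]

theorem Hull.norm_sub_one_le {ω : ℂ} {v vp Φ : ℂ → ℂ} (h : Hull ω v vp Φ) {δ : ℝ}
    (hv : ∀ t : ℝ, ‖v t - 1‖ ≤ δ) (hvp : ∀ t : ℝ, ‖vp t - 1‖ ≤ δ) {z : ℂ}
    (hz : z.im ∈ uIcc 0 ω.im) : ‖Φ z - 1‖ ≤ δ := by
  have e0 : ∀ z : ℂ, z.im = 0 → ‖Φ z - 1‖ ≤ δ := by
    intro z hz
    have hz' : z = (z.re : ℂ) := by apply Complex.ext <;> simp [hz]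
    rw [hz', h.left]
    exact hv _
  have e1 : ∀ z : ℂ, z.im = ω.im → ‖Φ z - 1‖ ≤ δ := by
    intro z hz
    have : z = ((z - ω).re : ℝ) + ω := by
      apply Complex.ext <;> simp [hz]
    rw [this, h.right]
    exact hvp _
  have key : ∀ a b : ℝ, a = min 0 ω.im → b = max 0 ω.im → ‖Φ z - 1‖ ≤ δ := by
    intro a b ha hb
    have hab : uIcc 0 ω.im = Icc a b := by rw [ha, hb, uIcc]
    have hea : ∀ z : ℂ, z.im = a → ‖Φ z - 1‖ ≤ δ := fun z hz => by
      rcases min_choice 0 ω.im with h | h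
      · exact e0 z (by rw [hz, ha, h])
      · exact e1 z (by rw [hz, ha, h])
    have heb : ∀ z : ℂ, z.im = b → ‖Φ z - 1‖ ≤ δ := fun z hz => by
      rcases max_choice 0 ω.im with h | h
      · exact e0 z (by rw [hz, hb, h])
      · exact e1 z (by rw [hz, hb, h])
    have hle : a ≤ b := by rw [ha, hb]; exact min_le_max
    rw [hab] at hz
    rcases hle.eq_or_lt with heq | hlt
    · exact hea z (le_antisymm (by rw [heq]; exact hz.2) hz.1)
    obtain ⟨C, hC⟩ := h.bdd
    have hsub : closure (im ⁻¹' Ioo a b) ⊆ {z : ℂ | z.im ∈ uIcc 0 ω.im} := by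
      rw [hab]
      exact closure_minimal (preimage_mono Ioo_subset_Icc_self) (isClosed_Icc.preimage continuous_im)
    refine PhragmenLindelof.horizontal_strip (f := fun z => Φ z - 1) (a := a) (b := b)
      ⟨?_, ?_⟩ ⟨0, div_pos Real.pi_pos (sub_pos.2 hlt), 0, ?_⟩ hea heb hz.1 hz.2
    · have := h.diff
      rw [← ha, ← hb] at this
      exact this.sub (differentiable_const _).differentiableOn
    · exact (h.cont.mono hsub).sub continuousOn_const
    · refine Asymptotics.IsBigO.of_bound (C + 1) ?_
      refine Filter.eventually_inf_principal.2 (Filter.Eventually.of_forall fun z hz => ?_)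
      have h1 := hC z (hsub (subset_closure hz))
      have h2 := norm_sub_le (Φ z) 1
      simp only [norm_one] at h2
      simp only [zero_mul, Real.exp_zero, norm_one, mul_one]
      linarith
  exact key _ _ rfl rfl

theorem Hull.inv {ω : ℂ} {v vp Φ : ℂ → ℂ} (h : Hull ω v vp Φ)
    (hv : ∀ t : ℝ, ‖v t - 1‖ ≤ 1 / 6) (hvp : ∀ t : ℝ, ‖vp t - 1‖ ≤ 1 / 6) :
    Hull ω (fun z => (v z)⁻¹) (fun z => (vp z)⁻¹) (fun z => (Φ z)⁻¹) := by
  have hlow : ∀ z : ℂ, z.im ∈ uIcc 0 ω.im → 5 / 6 ≤ ‖Φ z‖ := by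
    intro z hz
    have h1 := h.norm_sub_one_le hv hvp hz
    have h2 := norm_sub_norm_le 1 (Φ z)
    rw [norm_sub_rev] at h1
    simp only [norm_one] at h2
    linarith
  have hne : ∀ z : ℂ, z.im ∈ uIcc 0 ω.im → Φ z ≠ 0 := fun z hz h0 => by
    have := hlow z hz
    rw [h0, norm_zero] at this
    norm_num at this
  refine ⟨h.cont.inv₀ hne, h.diff.inv fun z hz => hne z (Ioo_subset_Icc_self hz), ?_, ⟨6 / 5, ?_⟩,
    ?_, ?_⟩
  · intro z hz
    rw [h.per z hz]
  · intro z hz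
    rw [norm_inv]
    refine inv_le_of_inv_le₀ (by norm_num) ?_
    have := hlow z hz
    norm_num at this ⊢
    linarith
  · intro t; rw [h.left]
  · intro t; rw [h.right]

theorem summable_zetaR {s : ℝ} (hs : 1 < s) : Summable fun n : ℕ => 1 / (n + 1 : ℝ) ^ s := by
  have := (summable_nat_add_iff 1).2 (Real.summable_one_div_nat_rpow.2 hs)
  simpa using this

theorem one_le_zetaR {s : ℝ} (hs : 1 < s) : 1 ≤ zetaR s := by
  have := (summable_zetaR hs).le_tsum 0 (fun n _ => by positivity)
  simpa [zetaR] using this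

theorem AMR_nonempty {τ M : ℝ} (hτ : 0 < τ) (hM : 2 * zetaR (1 + τ) < M) : (AMR τ M).Nonempty := by
  have hz := one_le_zetaR (s := 1 + τ) (by linarith)
  have hM0 : 0 < M := by linarith
  by_contra hne
  rw [not_nonempty_iff_eq_empty] at hne
  set δ : ℕ → ℝ := fun j => 1 / (M * ((j + 1 : ℕ) : ℝ) ^ (2 + τ)) with hδ
  let U : ℕ → Set ℝ := fun j =>
    (Ico 0 (δ j) ∪ Ioc (1 - δ j) 1) ∪ ⋃ n ∈ Finset.Icc 1 j, ball ((n : ℝ) / (j + 1 : ℕ)) (δ j)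
  have hcover : Icc (0:ℝ) 1 ⊆ ⋃ j, U j := by
    intro ω hω
    have : ω ∉ AMR τ M := by rw [hne]; exact notMem_empty _
    simp only [AMR, mem_ofPred_eq, not_forall, not_le] at this
    obtain ⟨n, m, hm, h⟩ := this
    obtain ⟨j, rfl⟩ := Nat.exists_eq_succ_of_ne_zero hm.ne'
    refine mem_iUnion.2 ⟨j, ?_⟩
    have hj : (0:ℝ) < (j.succ : ℕ) := by positivity
    change |ω - n / (j.succ : ℕ)| < δ j at h
    rcases le_or_gt n 0 with hn | hn
    · refine Or.inl (Or.inl ⟨hω.1, ?_⟩)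
      have : (n : ℝ) / (j.succ : ℕ) ≤ 0 :=
        div_nonpos_of_nonpos_of_nonneg (by exact_mod_cast hn) hj.le
      linarith [le_abs_self (ω - n / (j.succ : ℕ))]
    · rcases le_or_gt (j.succ : ℤ) n with hn' | hn'
      · refine Or.inl (Or.inr ⟨?_, hω.2⟩)
        have : 1 ≤ (n : ℝ) / (j.succ : ℕ) := by
          rw [one_le_div hj]; exact_mod_cast hn'
        linarith [neg_abs_le (ω - n / (j.succ : ℕ))]
      · refine Or.inr ?_
        lift n to ℕ using hn.le
        refine mem_biUnion (x := n) ?_ ?_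
        · rw [Finset.mem_coe, Finset.mem_Icc]; omega
        · rw [mem_ball, Real.dist_eq]; rwa [Int.cast_natCast] at h
  have hδ0 : ∀ j, 0 < δ j := fun j => by simp only [hδ]; positivity
  have hvol : ∀ j, MeasureTheory.volume (U j) ≤
      ENNReal.ofReal (2 / M * (1 / (j + 1 : ℝ) ^ (1 + τ))) := by
    intro j
    have h1 : MeasureTheory.volume (U j) ≤ (ENNReal.ofReal (δ j) + ENNReal.ofReal (δ j)) +
        ∑ n ∈ Finset.Icc 1 j, ENNReal.ofReal (2 * δ j) := by
      refine (MeasureTheory.measure_union_le _ _).trans (add_le_add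
        ((MeasureTheory.measure_union_le _ _).trans (add_le_add ?_ ?_))
        ((MeasureTheory.measure_biUnion_finset_le _ _).trans (Finset.sum_le_sum fun n _ => ?_)))
      · rw [Real.volume_Ico, sub_zero]
      · rw [Real.volume_Ioc]; exact le_of_eq (by congr 1; ring)
      · rw [Real.volume_ball]
    refine h1.trans (le_of_eq ?_)
    rw [← ENNReal.ofReal_add (hδ0 j).le (hδ0 j).le, Finset.sum_const, Nat.card_Icc, nsmul_eq_mul,
      ← ENNReal.ofReal_natCast, ← ENNReal.ofReal_mul (Nat.cast_nonneg _),
      ← ENNReal.ofReal_add (by linarith [hδ0 j]) (mul_nonneg (Nat.cast_nonneg _)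
        (by linarith [hδ0 j]))]
    congr 1
    have hj : (0:ℝ) < (j + 1 : ℝ) := by positivity
    have hp : (j + 1 : ℝ) ^ (2 + τ) = (j + 1 : ℝ) * (j + 1 : ℝ) ^ (1 + τ) := by
      rw [show 2 + τ = 1 + (1 + τ) by ring, Real.rpow_add hj, Real.rpow_one]
    have hp0 := Real.rpow_pos_of_pos hj (1 + τ)
    simp only [hδ, Nat.add_sub_cancel, Nat.cast_add, Nat.cast_one, hp]
    field_simp
    ring
  have hsum : HasSum (fun j : ℕ => 2 / M * (1 / (j + 1 : ℝ) ^ (1 + τ))) (2 / M * zetaR (1 + τ)) :=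
    (summable_zetaR (by linarith)).hasSum.mul_left _
  have h2 : MeasureTheory.volume (Icc (0:ℝ) 1) ≤ ENNReal.ofReal (2 / M * zetaR (1 + τ)) := by
    refine (MeasureTheory.measure_mono hcover).trans ((MeasureTheory.measure_iUnion_le _).trans ?_)
    refine (ENNReal.tsum_le_tsum hvol).trans (le_of_eq ?_)
    rw [← hsum.tsum_eq, ENNReal.ofReal_tsum_of_nonneg (fun n => by positivity) hsum.summable]
  rw [Real.volume_Icc, sub_zero, ENNReal.ofReal_le_ofReal_iff (by positivity)] at h2
  rw [div_mul_eq_mul_div, le_div_iff₀ hM0] at h2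
  linarith

/-- The finite part of `K_M`. -/
def KF (τ M : ℝ) : Set ℂ := finPart (KM τ M)

theorem mem_KF {τ M : ℝ} {x : ℂ} : x ∈ KF τ M ↔ x = 0 ∨ ∃ ω ∈ AMC τ M, Efn ω = x := by
  simp only [KF, finPart, KM, mem_ofPred_eq, mem_union, mem_image, mem_insert_iff,
    mem_singleton_iff, OnePoint.coe_eq_coe, OnePoint.coe_ne_infty, or_false]
  exact or_comm

theorem zero_mem_KF (τ M : ℝ) : (0 : ℂ) ∈ KF τ M := mem_KF.2 (Or.inl rfl)

theorem neg_mem_AMR {τ M ω : ℝ} (h : ω ∈ AMR τ M) : -ω ∈ AMR τ M := by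
  intro n m hm
  have := h (-n) m hm
  rw [← abs_neg]
  convert this using 2
  push_cast; ring

theorem neg_mem_AMC {τ M : ℝ} {ω : ℂ} (h : ω ∈ AMC τ M) : -ω ∈ AMC τ M := by
  obtain ⟨ω₀, h0, h1⟩ := h
  refine ⟨-ω₀, neg_mem_AMR h0, ?_⟩
  rw [neg_re, neg_im, abs_neg, ← abs_neg]
  convert h1 using 2; ring

theorem conj_mem_AMC {τ M : ℝ} {ω : ℂ} (h : ω ∈ AMC τ M) : starRingEnd ℂ ω ∈ AMC τ M := by
  obtain ⟨ω₀, h0, h1⟩ := h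
  exact ⟨ω₀, h0, by simpa using h1⟩

theorem Efn_ne_zero (ω : ℂ) : Efn ω ≠ 0 := Complex.exp_ne_zero _

theorem Efn_neg (ω : ℂ) : Efn (-ω) = (Efn ω)⁻¹ := by
  simp only [Efn, ← Complex.exp_neg]; congr 1; ring

theorem inv_mem_KF {τ M : ℝ} {x : ℂ} (h : x ∈ KF τ M) : x⁻¹ ∈ KF τ M := by
  rcases mem_KF.1 h with rfl | ⟨ω, hω, rfl⟩
  · simpa using h
  · exact mem_KF.2 (Or.inr ⟨-ω, neg_mem_AMC hω, Efn_neg ω⟩)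

theorem conj_inv_mem_KF {τ M : ℝ} {x : ℂ} (h : x ∈ KF τ M) :
    (starRingEnd ℂ x)⁻¹ ∈ KF τ M := by
  rcases mem_KF.1 h with rfl | ⟨ω, hω, rfl⟩
  · simpa using h
  · refine mem_KF.2 (Or.inr ⟨starRingEnd ℂ ω, conj_mem_AMC hω, ?_⟩)
    rw [← map_inv₀, ← Efn_neg]
    simp only [Efn, ← Complex.exp_conj]
    congr 1
    simp [Complex.conj_ofNat]

/-- The two charts of the Riemann sphere. -/
def chart : Bool → ℂ → OnePoint ℂ
  | true => fun q => (q : OnePoint ℂ)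
  | false => sphChart

theorem infPart_KM (τ M : ℝ) : infPart (KM τ M) = KF τ M := by
  ext ξ
  by_cases h : ξ = 0
  · subst h
    simp only [zero_mem_KF, iff_true]
    simp [infPart, sphChart, KM]
  · have e : sphChart ξ = ((ξ⁻¹ : ℂ) : OnePoint ℂ) := by simp [sphChart, h]
    simp only [infPart, mem_ofPred_eq, e]
    change ξ⁻¹ ∈ KF τ M ↔ _
    exact ⟨fun h => by simpa using inv_mem_KF h, inv_mem_KF⟩

theorem chart_mem {τ M : ℝ} (b : Bool) {x : ℂ} : chart b x ∈ KM τ M ↔ x ∈ KF τ M := by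
  cases b
  · rw [← infPart_KM]; rfl
  · rfl

theorem exists_chart {τ M : ℝ} {q : OnePoint ℂ} (hq : q ∈ KM τ M) :
    ∃ b, ∃ x ∈ KF τ M, chart b x = q := by
  induction q using OnePoint.rec with
  | infty => exact ⟨false, 0, zero_mem_KF τ M, by simp [chart, sphChart]⟩
  | coe x => exact ⟨true, x, hq, rfl⟩

/-- For `x ≠ 0`, both charts give finite nonzero points. -/
theorem chart_eq_coe {τ M : ℝ} (b : Bool) {x : ℂ} (hx : x ∈ KF τ M) (h0 : x ≠ 0) :
    ∃ q ∈ KF τ M, q ≠ 0 ∧ chart b x = (q : OnePoint ℂ) := by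
  cases b
  · exact ⟨x⁻¹, inv_mem_KF hx, inv_ne_zero h0, by simp [chart, sphChart, h0]⟩
  · exact ⟨x, hx, h0, rfl⟩

theorem norm_Efn (ω : ℂ) : ‖Efn ω‖ = Real.exp (-(2 * Real.pi * ω.im)) := by
  rw [Efn, Complex.norm_exp]
  congr 1
  simp

theorem KF_neBot {τ M : ℝ} (hne : (AMR τ M).Nonempty) {x : ℂ} (hx : x ∈ KF τ M) :
    (nhdsWithin x (KF τ M \ {x})).NeBot := by
  rcases mem_KF.1 hx with rfl | ⟨ω, ⟨ω₀, h0, h1⟩, rfl⟩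
  · obtain ⟨ω₀, h0⟩ := hne
    have : Filter.Tendsto (fun t : ℝ => Efn (ω₀ + t * I)) Filter.atTop
        (nhdsWithin 0 (KF τ M \ {0})) := by
      refine tendsto_nhdsWithin_iff.2 ⟨?_, Filter.Eventually.of_forall fun t => ⟨mem_KF.2
        (Or.inr ⟨_, ⟨ω₀, h0, by simp⟩, rfl⟩), Efn_ne_zero _⟩⟩
      rw [tendsto_zero_iff_norm_tendsto_zero]
      simp only [norm_Efn, add_im, ofReal_im, mul_im, ofReal_re, I_im, mul_one, I_re, mul_zero,
        add_zero, zero_add]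
      refine Real.tendsto_exp_neg_atTop_nhds_zero.comp ?_
      exact Filter.tendsto_id.const_mul_atTop Real.two_pi_pos
    exact this.neBot
  · have hs : ∃ s : ℝ, s ≠ 0 ∧ ∀ t : ℝ, 0 < t → |ω.im| ≤ |ω.im + s * t| := by
      rcases le_total 0 ω.im with h | h
      · refine ⟨1, one_ne_zero, fun t ht => ?_⟩
        rw [abs_of_nonneg h, abs_of_nonneg (by linarith)]; linarith
      · refine ⟨-1, by norm_num, fun t ht => ?_⟩
        rw [abs_of_nonpos h, abs_of_nonpos (by linarith)]; linarith
    obtain ⟨s, hs0, hs⟩ := hs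
    have : Filter.Tendsto (fun t : ℝ => Efn (ω + (s * t : ℝ) * I)) (nhdsWithin 0 (Ioi 0))
        (nhdsWithin (Efn ω) (KF τ M \ {Efn ω})) := by
      refine tendsto_nhdsWithin_iff.2 ⟨?_, Filter.eventually_of_mem self_mem_nhdsWithin
        fun t ht => ⟨mem_KF.2 (Or.inr ⟨_, ⟨ω₀, h0, ?_⟩, rfl⟩), ?_⟩⟩
      · have hc : Continuous fun t : ℝ => Efn (ω + (s * t : ℝ) * I) := by unfold Efn; fun_prop
        have := hc.tendsto 0
        simp only [mul_zero, ofReal_zero, zero_mul, add_zero] at this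
        exact this.mono_left nhdsWithin_le_nhds
      · have := hs t ht
        simp only [add_re, mul_re, ofReal_re, I_re, mul_zero, ofReal_im, I_im, mul_one, sub_self,
          add_zero, add_im, mul_im]
        exact h1.trans (by simpa using this)
      · intro heq
        have := congrArg norm (mem_singleton_iff.1 heq)
        rw [norm_Efn, norm_Efn, Real.exp_eq_exp, neg_inj] at this
        have h3 := mul_left_cancel₀ Real.two_pi_pos.ne' this
        simp only [add_im, mul_im, ofReal_re, I_im, mul_one, ofReal_im, I_re, mul_zero,
          add_zero] at h3
        have h4 : s * t = 0 := by linarith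
        rcases mul_eq_zero.1 h4 with h | h
        · exact hs0 h
        · exact (ne_of_gt ht) h
    exact this.neBot

theorem one_le_norm_pow_sub_one {τ M : ℝ} (hτ : 0 < τ) (hM : 1 ≤ M) {x : ℂ} (hx : x ∈ KF τ M)
    {m : ℕ} (hm : 0 < m) : 1 ≤ 2 * M * (m : ℝ) ^ (1 + τ) * ‖x ^ m - 1‖ := by
  have hm1 : (1:ℝ) ≤ m := by exact_mod_cast hm
  have hmp : 1 ≤ (m : ℝ) ^ (1 + τ) := Real.one_le_rpow hm1 (by linarith)
  have hMm : 1 ≤ M * (m : ℝ) ^ (1 + τ) := by nlinarith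
  rcases le_or_gt (1/2) ‖x ^ m - 1‖ with h | h
  · nlinarith
  rcases mem_KF.1 hx with rfl | ⟨ω, ⟨ω₀, h0, h1⟩, rfl⟩
  · rw [zero_pow hm.ne', zero_sub, norm_neg, norm_one] at h
    norm_num at h
  · have hlog := Complex.norm_log_one_add_half_le_self h.le
    rw [add_sub_cancel] at hlog
    have hne : Efn ω ^ m ≠ 0 := pow_ne_zero _ (Efn_ne_zero _)
    have hexp := Complex.exp_log hne
    have hE : Efn ω ^ m = Complex.exp (m * (2 * Real.pi * I * ω)) := by
      rw [Efn, ← Complex.exp_nat_mul]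
    rw [hE, Complex.exp_eq_exp_iff_exists_int] at hexp
    obtain ⟨n, hn⟩ := hexp
    rw [← hE] at hn
    have hmc : (m : ℂ) ≠ 0 := by exact_mod_cast hm.ne'
    have e : Complex.log (Efn ω ^ m) = (2 * Real.pi * I) * (m * (ω - ((-n : ℤ) : ℂ) / m)) := by
      rw [hn]; field_simp; push_cast; ring
    rw [e, norm_mul, norm_mul (m : ℂ)] at hlog
    have hpi : ‖(2 * Real.pi * I : ℂ)‖ = 2 * Real.pi := by
      simp [abs_of_pos Real.pi_pos]
    rw [hpi, Complex.norm_natCast] at hlog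
    have hd := h0 (-n) m hm
    set d := ‖ω - ((-n : ℤ) : ℂ) / m‖ with hdd
    have hre : |ω.re - ((-n : ℤ) : ℝ) / m| ≤ d := by
      have := Complex.abs_re_le_norm (ω - ((-n : ℤ) : ℂ) / m)
      have e2 : (ω - ((-n : ℤ) : ℂ) / m).re = ω.re - ((-n : ℤ) : ℝ) / m := by
        rw [sub_re, show ((-n : ℤ) : ℂ) / (m : ℂ) = (((-n : ℤ) : ℝ) / (m : ℝ) : ℝ) by push_cast; rfl,
          ofReal_re]
      rwa [e2] at this
    have him : |ω.im| ≤ d := by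
      have := Complex.abs_im_le_norm (ω - ((-n : ℤ) : ℂ) / m)
      have e2 : (ω - ((-n : ℤ) : ℂ) / m).im = ω.im := by
        rw [sub_im, show ((-n : ℤ) : ℂ) / (m : ℂ) = (((-n : ℤ) : ℝ) / (m : ℝ) : ℝ) by push_cast; rfl,
          ofReal_im, sub_zero]
      rwa [e2] at this
    have htri := abs_sub_le ω₀ ω.re (((-n : ℤ) : ℝ) / m)
    have hd2 : 1 / (M * (m : ℝ) ^ (2 + τ)) ≤ 2 * d := by linarith
    have hp : (m : ℝ) ^ (2 + τ) = m * (m : ℝ) ^ (1 + τ) := by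
      rw [show 2 + τ = 1 + (1 + τ) by ring, Real.rpow_add (by linarith), Real.rpow_one]
    rw [div_le_iff₀ (by positivity), hp] at hd2
    have hpi3 := Real.pi_gt_three
    have hd0 : 0 ≤ d := norm_nonneg _
    have hmd : m * d ≤ ‖Efn ω ^ m - 1‖ := by
      have : 0 ≤ m * d := by positivity
      nlinarith
    calc (1:ℝ) ≤ 2 * d * (M * (m * (m : ℝ) ^ (1 + τ))) := hd2
      _ = 2 * M * (m : ℝ) ^ (1 + τ) * (m * d) := by ring
      _ ≤ _ := by gcongr

theorem differentiableOn_of_tendstoUniformlyOn {E : Type*} [NormedAddCommGroup E]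
    [NormedSpace ℂ E] {ι : Type*} {l : Filter ι} [l.NeBot] {U : Set E} (hU : IsOpen U)
    {f : ι → E → ℂ} {g : E → ℂ} (hf : ∀ n, DifferentiableOn ℂ (f n) U)
    (h : TendstoUniformlyOn f g l U) : DifferentiableOn ℂ g U := by
  intro x hx
  obtain ⟨R, hR, hball⟩ := Metric.isOpen_iff.1 hU x hx
  have hR2 : 0 < R / 2 := by linarith
  have hsub : ∀ y ∈ ball x (R / 2), ball y (R / 2) ⊆ U := fun y hy =>
    (ball_subset_ball' (by rw [mem_ball] at hy; linarith)).trans hball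
  have hsub' : ball x (R / 2) ⊆ U := (ball_subset_ball (by linarith)).trans hball
  have hdiff : ∀ n, ∀ y ∈ U, DifferentiableAt ℂ (f n) y := fun n y hy =>
    (hf n y hy).differentiableAt (hU.mem_nhds hy)
  have hC : UniformCauchySeqOn (fun n => fderiv ℂ (f n)) l (ball x (R / 2)) := by
    intro s hs
    obtain ⟨ε, hε, hs⟩ := Metric.mem_uniformity_dist.1 hs
    have h1 := h.uniformCauchySeqOn _ (Metric.dist_mem_uniformity
      (show 0 < ε * R / 16 by positivity))
    filter_upwards [h1] with m hm y hy
    apply hs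
    have hyU := hsub y hy
    have hy' := hsub' hy
    have h2 : ∀ z ∈ U, ‖f m.1 z - f m.2 z‖ ≤ ε * R / 16 := fun z hz => by
      rw [← dist_eq_norm]; exact (hm z hz).le
    have h3 := Complex.norm_fderiv_le_div_of_mapsTo_ball (f := f m.1 - f m.2) (c := y)
      (R₁ := R / 2) (R₂ := ε * R / 8) (((hf _).sub (hf _)).mono hyU) (fun z hz => by
        rw [mem_closedBall, dist_eq_norm]
        refine (norm_sub_le _ _).trans ?_
        have a1 := h2 z (hyU hz)
        have a2 := h2 y hy'
        simp only [Pi.sub_apply]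
        linarith) hR2
    rw [fderiv_sub (hdiff _ y hy') (hdiff _ y hy')] at h3
    rw [dist_eq_norm]
    refine h3.trans_lt ?_
    rw [div_lt_iff₀ hR2]
    nlinarith [mul_pos hε hR]
  have hlim : ∀ y ∈ ball x (R / 2), ∃ L, Filter.Tendsto (fun n => fderiv ℂ (f n) y) l (nhds L) :=
    fun y hy => cauchy_map_iff_exists_tendsto.1 (hC.cauchy_map hy)
  choose! G hG using hlim
  have h4 := hC.tendstoUniformlyOn_of_tendsto hG
  exact (hasFDerivAt_of_tendstoUniformlyOn isOpen_ball h4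
    (fun n y hy => (hdiff n y (hsub' hy)).hasFDerivAt)
    (fun y hy => h.tendsto_at (hsub' hy)) (mem_ball_self hR2)).differentiableAt.differentiableWithinAt

theorem differentiableOn_tsum_of_norm_le {E : Type*} [NormedAddCommGroup E]
    [NormedSpace ℂ E] {ι : Type*} {U : Set E} (hU : IsOpen U) {f : ι → E → ℂ} {b : ι → ℝ}
    (hb : Summable b) (hf : ∀ n, DifferentiableOn ℂ (f n) U) (hle : ∀ n, ∀ x ∈ U, ‖f n x‖ ≤ b n) :
    DifferentiableOn ℂ (fun x => ∑' n, f n x) U :=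
  differentiableOn_of_tendstoUniformlyOn hU
    (fun s => by
      have := DifferentiableOn.sum (u := s) (A := f) (fun n _ => hf n)
      refine this.congr fun x _ => by simp)
    (tendstoUniformlyOn_tsum hb hle)

/-- Uniform (over `S`) continuity on `K` of a family of functions. -/
def UC {ι β : Type*} [TopologicalSpace ι] (K : Set ι) (S : Set β) (F : ι → β → ℂ) : Prop :=
  ∀ p ∈ K, ∀ ε > (0 : ℝ), ∀ᶠ p' in nhdsWithin p K, ∀ a ∈ S, ‖F p' a - F p a‖ ≤ ε

section UC
variable {ι β : Type*} [TopologicalSpace ι] {K : Set ι} {S : Set β} {F G : ι → β → ℂ}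

theorem uc_iff {ι β : Type*} [PseudoMetricSpace ι] {K : Set ι} {S : Set β} {F : ι → β → ℂ} :
    UC K S F ↔ ∀ p ∈ K, ∀ ε > (0 : ℝ), ∃ δ > (0 : ℝ), ∀ p' ∈ K, dist p' p < δ →
      ∀ a ∈ S, ‖F p' a - F p a‖ ≤ ε := by
  unfold UC
  refine forall₂_congr fun p hp => forall₂_congr fun ε hε => ?_
  rw [Filter.Eventually, Metric.mem_nhdsWithin_iff]
  refine exists_congr fun δ => and_congr_right fun _ => ?_
  constructor
  · intro h p' hp' hd
    exact h ⟨hd, hp'⟩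
  · rintro h p' ⟨hd, hp'⟩
    exact h p' hp' hd

theorem UC.mono {S' : Set β} (h : UC K S F) (hS : S' ⊆ S) : UC K S' F := fun p hp ε hε =>
  (h p hp ε hε).mono fun _ h a ha => h a (hS ha)

theorem UC.congr (h : UC K S F) (hFG : ∀ p ∈ K, ∀ a ∈ S, G p a = F p a) : UC K S G := by
  intro p hp ε hε
  filter_upwards [h p hp ε hε, self_mem_nhdsWithin] with p' h' hp' a ha
  rw [hFG p hp a ha, hFG p' hp' a ha]
  exact h' a ha

theorem UC.const (c : β → ℂ) : UC K S (fun _ => c) := fun p _ ε hε =>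
  Filter.Eventually.of_forall fun p' a _ => by simpa using hε.le

theorem UC.add (hF : UC K S F) (hG : UC K S G) : UC K S (fun p a => F p a + G p a) := by
  intro p hp ε hε
  filter_upwards [hF p hp (ε / 2) (by positivity), hG p hp (ε / 2) (by positivity)]
    with p' h1 h2 a ha
  rw [add_sub_add_comm]
  exact (norm_add_le _ _).trans (by linarith [h1 a ha, h2 a ha])

theorem UC.mul (hF : UC K S F) (hG : UC K S G) {M N : ℝ} (hM : ∀ p ∈ K, ∀ a ∈ S, ‖F p a‖ ≤ M)
    (hN : ∀ p ∈ K, ∀ a ∈ S, ‖G p a‖ ≤ N) : UC K S (fun p a => F p a * G p a) := by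
  intro p hp ε hε
  have hM1 : 0 < |M| + |N| + 1 := by positivity
  filter_upwards [hF p hp (ε / (|M| + |N| + 1)) (by positivity),
    hG p hp (ε / (|M| + |N| + 1)) (by positivity), self_mem_nhdsWithin]
    with p' h1 h2 hp' a ha
  rw [show F p' a * G p' a - F p a * G p a = F p' a * (G p' a - G p a) + (F p' a - F p a) * G p a
    by ring]
  refine (norm_add_le _ _).trans ?_
  rw [norm_mul, norm_mul]
  have e1 := mul_le_mul ((hM p' hp' a ha).trans (le_abs_self M)) (h2 a ha) (norm_nonneg _)
    (abs_nonneg _)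
  have e2 := mul_le_mul (h1 a ha) ((hN p hp a ha).trans (le_abs_self N)) (norm_nonneg _)
    (by positivity)
  have e3 : ε / (|M| + |N| + 1) * (|M| + |N| + 1) = ε := div_mul_cancel₀ _ hM1.ne'
  have : 0 < ε / (|M| + |N| + 1) := by positivity
  nlinarith

theorem UC.const_mul (hF : UC K S F) (c : ℂ) : UC K S (fun p a => c * F p a) := by
  intro p hp ε hε
  filter_upwards [hF p hp (ε / (‖c‖ + 1)) (by positivity)] with p' h1 a ha
  rw [← mul_sub, norm_mul]
  have e3 : ε / (‖c‖ + 1) * (‖c‖ + 1) = ε := div_mul_cancel₀ _ (by positivity)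
  have : 0 < ε / (‖c‖ + 1) := by positivity
  nlinarith [h1 a ha, norm_nonneg c]

theorem UC.inv {c : ℝ} (hc : 0 < c) (hF : UC K S F) (h : ∀ p ∈ K, ∀ a ∈ S, c ≤ ‖F p a‖) :
    UC K S (fun p a => (F p a)⁻¹) := by
  intro p hp ε hε
  filter_upwards [hF p hp (ε * c * c) (by positivity), self_mem_nhdsWithin] with p' h1 hp' a ha
  have h2 := h p hp a ha
  have h3 := h p' hp' a ha
  have n2 : F p a ≠ 0 := norm_pos_iff.1 (hc.trans_le h2)
  have n3 : F p' a ≠ 0 := norm_pos_iff.1 (hc.trans_le h3)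
  rw [inv_sub_inv n3 n2, norm_div, norm_mul, div_le_iff₀ (by positivity), norm_sub_rev]
  refine (h1 a ha).trans ?_
  rw [mul_assoc]
  exact mul_le_mul_of_nonneg_left (mul_le_mul h3 h2 hc.le (norm_nonneg _)) hε.le

theorem UC.comp {κ : Type*} [TopologicalSpace κ] {L : Set κ} {φ : κ → ι} (h : UC K S F)
    (hφ : ContinuousOn φ L) (hm : MapsTo φ L K) : UC L S (fun p => F (φ p)) := fun p hp ε hε =>
  ((hφ p hp).tendsto_nhdsWithin hm).eventually (h (φ p) (hm hp) ε hε)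

theorem uc_of_continuousOn {c : ι → ℂ} (h : ContinuousOn c K) : UC K S (fun p _ => c p) := by
  intro p hp ε hε
  filter_upwards [(h p hp).eventually (Metric.ball_mem_nhds (c p) hε)] with p' h' a _
  rw [← dist_eq_norm]
  exact (mem_ball.1 h').le

theorem UC.sum {κ : Type*} {f : κ → ι → β → ℂ} (s : Finset κ) (h : ∀ k, UC K S (f k)) :
    UC K S (fun p a => ∑ k ∈ s, f k p a) := by
  classical
  induction s using Finset.induction_on with
  | empty => simpa using UC.const (K := K) (S := S) (fun _ => 0)
  | insert k s hk ih =>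
    simp only [Finset.sum_insert hk]
    exact (h k).add ih

theorem UC.tsum {κ : Type*} {f : κ → ι → β → ℂ} {b : κ → ℝ} (hb : Summable b)
    (h : ∀ k, UC K S (f k)) (hle : ∀ k, ∀ p ∈ K, ∀ a ∈ S, ‖f k p a‖ ≤ b k) :
    UC K S (fun p a => ∑' k, f k p a) := by
  intro p hp ε hε
  obtain ⟨s, hs⟩ := ((tendsto_order.1 (tendsto_tsum_compl_atTop_zero b)).2 (ε / 4)
    (by positivity)).exists
  filter_upwards [UC.sum s h p hp (ε / 2) (by positivity), self_mem_nhdsWithin] with p' h1 hp' a ha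
  have hsum : ∀ q ∈ K, Summable fun k => f k q a := fun q hq =>
    Summable.of_norm_bounded hb fun k => hle k q hq a ha
  have htail : ∀ q ∈ K, ‖∑' k : { k // k ∉ s }, f k q a‖ ≤ ε / 4 := fun q hq =>
    (tsum_of_norm_bounded (hb.subtype _).hasSum fun k => hle k q hq a ha).trans hs.le
  rw [← (hsum p' hp').sum_add_tsum_subtype_compl s, ← (hsum p hp).sum_add_tsum_subtype_compl s,
    add_sub_add_comm]
  refine (norm_add_le _ _).trans ?_
  have := norm_sub_le (∑' k : { k // k ∉ s }, f k p' a) (∑' k : { k // k ∉ s }, f k p a)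
  linarith [h1 a ha, htail p hp, htail p' hp']

end UC

theorem differentiableOn_integral_of_bounded {F : ℂ → ℝ → ℂ} {ρ N : ℝ}
    (hc : ∀ x ∈ ball (0 : ℂ) ρ, Continuous (F x))
    (hd : ∀ t, DifferentiableOn ℂ (fun x => F x t) (ball 0 ρ))
    (hN : ∀ x ∈ ball (0 : ℂ) ρ, ∀ t, ‖F x t‖ ≤ N) :
    DifferentiableOn ℂ (fun x => ∫ t in (0:ℝ)..1, F x t) (ball 0 ρ) := by
  intro x hx
  obtain ⟨R, hR, hball⟩ := Metric.isOpen_iff.1 isOpen_ball x hx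
  have hR2 : 0 < R / 2 := by linarith
  have hdiff : ∀ t, ∀ y ∈ ball x (R / 2), HasDerivAt (fun z => F z t) (deriv (fun z => F z t) y) y :=
    fun t y hy => ((hd t).differentiableAt
      (isOpen_ball.mem_nhds (hball (ball_subset_ball (by linarith) hy)))).hasDerivAt
  refine (intervalIntegral.hasDerivAt_integral_of_dominated_loc_of_deriv_le (F := F)
    (F' := fun y t => deriv (fun z => F z t) y) (bound := fun _ => N / (R / 4))
    (s := ball x (R / 2)) (ball_mem_nhds x hR2)
    ?_ ((hc x hx).intervalIntegrable _ _) ?_ (.of_forall ?_) intervalIntegrable_const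
    (.of_forall fun t _ => hdiff t)).2.differentiableAt.differentiableWithinAt
  · filter_upwards [isOpen_ball.mem_nhds hx] with y hy
    exact (hc y hy).aestronglyMeasurable
  · have hlim : Filter.Tendsto (fun n : ℕ => ((R / 2 / (n + 2 : ℝ) : ℝ) : ℂ)) Filter.atTop
        (nhdsWithin 0 {0}ᶜ) := by
      refine tendsto_nhdsWithin_iff.2 ⟨?_, .of_forall fun n => ?_⟩
      · rw [← Complex.ofReal_zero]
        refine (Complex.continuous_ofReal.tendsto 0).comp ?_
        exact Filter.Tendsto.const_div_atTop
          (Filter.tendsto_atTop_add_const_right _ _ tendsto_natCast_atTop_atTop) _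
      · simp only [mem_compl_iff, mem_singleton_iff, Complex.ofReal_eq_zero]
        positivity
    refine aestronglyMeasurable_of_tendsto_ae Filter.atTop (f := fun (n : ℕ) (t : ℝ) =>
      ((R / 2 / (n + 2 : ℝ) : ℝ) : ℂ)⁻¹ • (F (x + ((R / 2 / (n + 2 : ℝ) : ℝ) : ℂ)) t - F x t))
      (fun n => ?_) (.of_forall fun t => ?_)
    · simp only [smul_eq_mul]
      refine (continuous_const.mul ((hc _ (hball ?_)).sub (hc x hx))).aestronglyMeasurable
      rw [mem_ball, dist_eq_norm, add_sub_cancel_left, Complex.norm_real, Real.norm_of_nonneg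
        (by positivity)]
      calc R / 2 / (n + 2 : ℝ) ≤ R / 2 := div_le_self hR2.le (by
            linarith [(Nat.cast_nonneg n : (0:ℝ) ≤ n)])
        _ < R := by linarith
    · exact (hdiff t x (mem_ball_self hR2)).tendsto_slope_zero.comp hlim
  · intro t _ y hy
    have hsub : closedBall y (R / 4) ⊆ ball 0 ρ := by
      refine (closedBall_subset_ball' ?_).trans hball
      rw [mem_ball] at hy; linarith
    exact Complex.norm_deriv_le_of_forall_mem_sphere_norm_le (by positivity)
      (((hd t).mono hsub).diffContOnCl_ball subset_rfl)
      fun z hz => hN z (hsub (sphere_subset_closedBall hz)) t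

/-- Values on `S_r × D_ρ`: periodic in the first variable and holomorphic. -/
structure Val (r ρ : ℝ) (v : ℂ × ℂ → ℂ) : Prop where
  per : ∀ pt ∈ SD r ρ, v (pt.1 + 1, pt.2) = v pt
  hol : DifferentiableOn ℂ v (SD r ρ)

theorem isOpen_SD (r ρ : ℝ) : IsOpen (SD r ρ) := (isOpen_Strip r).prod isOpen_ball

theorem add_one_mem_Strip {r : ℝ} {θ : ℂ} (h : θ ∈ Strip r) : θ + 1 ∈ Strip r := by
  simpa [Strip] using h

theorem SD_mono {r r' ρ : ℝ} (h : r' ≤ r) : SD r' ρ ⊆ SD r ρ :=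
  prod_mono (fun _ hz => lt_of_lt_of_le hz h) subset_rfl

theorem Val.mono {r r' ρ : ℝ} {v : ℂ × ℂ → ℂ} (hv : Val r ρ v) (h : r' ≤ r) : Val r' ρ v where
  per pt hpt := hv.per pt (SD_mono h hpt)
  hol := hv.hol.mono (SD_mono h)

section
variable {r ρ : ℝ} {v w : ℂ × ℂ → ℂ}

theorem Val.perHol (h : Val r ρ v) {ε : ℂ} (hε : ε ∈ ball (0 : ℂ) ρ) :
    PerHol r fun θ => v (θ, ε) where
  per θ hθ := h.per (θ, ε) ⟨hθ, hε⟩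
  hol := h.hol.comp (f := fun θ : ℂ => (θ, ε)) (by fun_prop) fun _ hθ => ⟨hθ, hε⟩

theorem Val.congr (h : Val r ρ v) (hvw : ∀ pt ∈ SD r ρ, w pt = v pt) : Val r ρ w where
  per pt hpt := by
    rw [hvw (pt.1 + 1, pt.2) ⟨add_one_mem_Strip hpt.1, hpt.2⟩, hvw _ hpt, h.per pt hpt]
  hol := h.hol.congr hvw

theorem Val.add (h : Val r ρ v) (h' : Val r ρ w) : Val r ρ fun pt => v pt + w pt where
  per pt hpt := by rw [h.per pt hpt, h'.per pt hpt]
  hol := h.hol.add h'.hol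

theorem Val.mul (h : Val r ρ v) (h' : Val r ρ w) : Val r ρ fun pt => v pt * w pt where
  per pt hpt := by rw [h.per pt hpt, h'.per pt hpt]
  hol := h.hol.mul h'.hol

theorem Val.inv (h : Val r ρ v) (h0 : ∀ pt ∈ SD r ρ, v pt ≠ 0) : Val r ρ fun pt => (v pt)⁻¹ where
  per pt hpt := by rw [h.per pt hpt]
  hol := h.hol.inv h0

theorem Val.const (c : ℂ) : Val r ρ fun _ => c where
  per _ _ := rfl
  hol := differentiableOn_const c

theorem Val.const_mul (h : Val r ρ v) (c : ℂ) : Val r ρ fun pt => c * v pt :=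
  (Val.const c).mul h

theorem Val.expMode (k : ℤ) : Val r ρ fun pt => ek k pt.1 where
  per pt _ := by simp [ek_add, ek_one]
  hol := ((differentiable_ek k).comp differentiable_fst).differentiableOn

theorem Val.coef (hr : 0 < r) (h : Val r ρ v) {N : ℝ} (hN : ∀ pt ∈ SD r ρ, ‖v pt‖ ≤ N) (k : ℤ)
    (r' : ℝ) : Val r' ρ fun pt => fcoef (fun z => v (z, pt.2)) k where
  per _ _ := rfl
  hol := by
    have : DifferentiableOn ℂ (fun ε : ℂ => fcoef (fun z => v (z, ε)) k) (ball 0 ρ) := by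
      simp only [fcoef_eq]
      refine differentiableOn_integral_of_bounded (N := N) (fun ε hε => ?_) (fun t => ?_)
        fun ε hε t => ?_
      · have h1 := ((h.perHol hε).mul_ek (-k)).hol.continuousOn
        exact h1.comp_continuous Complex.continuous_ofReal (ofReal_mem_Strip hr)
      · refine DifferentiableOn.mul ?_ (differentiableOn_const _)
        exact h.hol.comp (f := fun ε : ℂ => ((t : ℂ), ε)) (by fun_prop)
          fun _ hε => ⟨ofReal_mem_Strip hr t, hε⟩
      · rw [norm_mul, norm_ek]
        simpa using hN _ ⟨ofReal_mem_Strip hr t, hε⟩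
    exact this.comp differentiableOn_snd fun pt hpt => hpt.2

theorem Val.tsum {κ : Type*} {f : κ → ℂ × ℂ → ℂ} {b : κ → ℝ} (hb : Summable b)
    (h : ∀ k, Val r ρ (f k)) (hle : ∀ k, ∀ pt ∈ SD r ρ, ‖f k pt‖ ≤ b k) :
    Val r ρ fun pt => ∑' k, f k pt where
  per pt hpt := by simp only [fun k => (h k).per pt hpt]
  hol := differentiableOn_tsum_of_norm_le (isOpen_SD r ρ) hb (fun k => (h k).hol) hle

theorem Val.of_tendstoUniformlyOn {ι : Type*} {l : Filter ι} [l.NeBot] {f : ι → ℂ × ℂ → ℂ}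
    (hf : ∀ n, Val r ρ (f n)) (h : TendstoUniformlyOn f v l (SD r ρ)) : Val r ρ v where
  per pt hpt := by
    have h1 := h.tendsto_at hpt
    have h2 := h.tendsto_at (show (pt.1 + 1, pt.2) ∈ SD r ρ from ⟨add_one_mem_Strip hpt.1, hpt.2⟩)
    simp only [fun n => (hf n).per pt hpt] at h2
    exact tendsto_nhds_unique h2 h1
  hol := differentiableOn_of_tendstoUniformlyOn (isOpen_SD r ρ) (fun n => (hf n).hol) h

end

/-- `u` is `C¹`-holomorphic on `K`, witnessed by a difference quotient `Q` which extends
continuously to the diagonal, with `N` bounding both `u` and `Q`. -/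
structure CH (K : Set ℂ) (r ρ : ℝ) (u : ℂ → ℂ × ℂ → ℂ) (Q : ℂ × ℂ → ℂ × ℂ → ℂ) (N : ℝ) :
    Prop where
  valu : ∀ q ∈ K, Val r ρ (u q)
  valQ : ∀ p ∈ K ×ˢ K, Val r ρ (Q p)
  contQ : UC (K ×ˢ K) (SD r ρ) Q
  eq : ∀ p ∈ K ×ˢ K, ∀ a ∈ SD r ρ, u p.2 a - u p.1 a = (p.2 - p.1) * Q p a
  bu : ∀ q ∈ K, ∀ a ∈ SD r ρ, ‖u q a‖ ≤ N
  bQ : ∀ p ∈ K ×ˢ K, ∀ a ∈ SD r ρ, ‖Q p a‖ ≤ N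

section
variable {K : Set ℂ} {r r' ρ N N' : ℝ} {u v : ℂ → ℂ × ℂ → ℂ} {Q R : ℂ × ℂ → ℂ × ℂ → ℂ}

theorem CH.mono (h : CH K r ρ u Q N) (hr : r' ≤ r) (hN : N ≤ N') : CH K r' ρ u Q N' where
  valu q hq := (h.valu q hq).mono hr
  valQ p hp := (h.valQ p hp).mono hr
  contQ := h.contQ.mono (SD_mono hr)
  eq p hp a ha := h.eq p hp a (SD_mono hr ha)
  bu q hq a ha := (h.bu q hq a (SD_mono hr ha)).trans hN
  bQ p hp a ha := (h.bQ p hp a (SD_mono hr ha)).trans hN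

theorem CH.congr (h : CH K r ρ u Q N) (huv : ∀ q ∈ K, ∀ a ∈ SD r ρ, v q a = u q a) :
    CH K r ρ v Q N where
  valu q hq := (h.valu q hq).congr (huv q hq)
  valQ := h.valQ
  contQ := h.contQ
  eq p hp a ha := by rw [huv _ hp.2 a ha, huv _ hp.1 a ha, h.eq p hp a ha]
  bu q hq a ha := by rw [huv q hq a ha]; exact h.bu q hq a ha
  bQ := h.bQ

theorem CH.uc (h : CH K r ρ u Q N) : UC K (SD r ρ) u := by
  refine uc_iff.2 fun p hp ε hε => ⟨ε / (|N| + 1), by positivity, fun p' hp' hd a ha => ?_⟩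
  rw [h.eq (p, p') ⟨hp, hp'⟩ a ha, norm_mul, ← dist_eq_norm]
  have h1 := (h.bQ (p, p') ⟨hp, hp'⟩ a ha).trans (le_abs_self N)
  rw [lt_div_iff₀ (by positivity)] at hd
  have : 0 ≤ dist p' p := dist_nonneg
  nlinarith

theorem CH.uc_fst (h : CH K r ρ u Q N) : UC (K ×ˢ K) (SD r ρ) fun p => u p.1 :=
  h.uc.comp continuous_fst.continuousOn fun _ hp => hp.1

theorem CH.uc_snd (h : CH K r ρ u Q N) : UC (K ×ˢ K) (SD r ρ) fun p => u p.2 :=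
  h.uc.comp continuous_snd.continuousOn fun _ hp => hp.2

theorem CH.add (h : CH K r ρ u Q N) (h' : CH K r ρ v R N') :
    CH K r ρ (fun q a => u q a + v q a) (fun p a => Q p a + R p a) (N + N') where
  valu q hq := (h.valu q hq).add (h'.valu q hq)
  valQ p hp := (h.valQ p hp).add (h'.valQ p hp)
  contQ := h.contQ.add h'.contQ
  eq p hp a ha := by
    rw [add_sub_add_comm, h.eq p hp a ha, h'.eq p hp a ha]; ring
  bu q hq a ha := (norm_add_le _ _).trans (add_le_add (h.bu q hq a ha) (h'.bu q hq a ha))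
  bQ p hp a ha := (norm_add_le _ _).trans (add_le_add (h.bQ p hp a ha) (h'.bQ p hp a ha))

theorem CH.mul (h : CH K r ρ u Q N) (h' : CH K r ρ v R N') :
    CH K r ρ (fun q a => u q a * v q a) (fun p a => Q p a * v p.2 a + u p.1 a * R p a)
      (2 * N * N') where
  valu q hq := (h.valu q hq).mul (h'.valu q hq)
  valQ p hp := ((h.valQ p hp).mul (h'.valu _ hp.2)).add ((h.valu _ hp.1).mul (h'.valQ p hp))
  contQ := (h.contQ.mul h'.uc_snd h.bQ fun p hp => h'.bu _ hp.2).add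
    (h.uc_fst.mul h'.contQ (fun p hp => h.bu _ hp.1) h'.bQ)
  eq p hp a ha := by
    linear_combination v p.2 a * h.eq p hp a ha + u p.1 a * h'.eq p hp a ha
  bu q hq a ha := by
    rw [norm_mul]
    have h1 := h.bu q hq a ha
    have h2 := h'.bu q hq a ha
    have h3 := mul_le_mul h1 h2 (norm_nonneg _) ((norm_nonneg _).trans h1)
    have h4 := mul_nonneg ((norm_nonneg _).trans h1) ((norm_nonneg _).trans h2)
    linarith
  bQ p hp a ha := by
    have h1 := h.bQ p hp a ha
    have h2 := h'.bu _ hp.2 a ha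
    have h3 := mul_le_mul h1 h2 (norm_nonneg _) ((norm_nonneg _).trans h1)
    have h1' := h.bu _ hp.1 a ha
    have h2' := h'.bQ p hp a ha
    have h3' := mul_le_mul h1' h2' (norm_nonneg _) ((norm_nonneg _).trans h1')
    refine (norm_add_le _ _).trans ?_
    rw [norm_mul, norm_mul]
    linarith

theorem CH.scalar {m : ℂ → ℂ} {q : ℂ × ℂ → ℂ} (hq : ContinuousOn q (K ×ˢ K))
    (heq : ∀ p ∈ K ×ˢ K, m p.2 - m p.1 = (p.2 - p.1) * q p) (hm : ∀ x ∈ K, ‖m x‖ ≤ N)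
    (hqN : ∀ p ∈ K ×ˢ K, ‖q p‖ ≤ N) : CH K r ρ (fun x _ => m x) (fun p _ => q p) N where
  valu _ _ := Val.const _
  valQ _ _ := Val.const _
  contQ := uc_of_continuousOn hq
  eq p hp _ _ := heq p hp
  bu q hq _ _ := hm q hq
  bQ p hp _ _ := hqN p hp

theorem CH.const (c : ℂ) : CH K r ρ (fun _ _ => c) (fun _ _ => 0) ‖c‖ :=
  CH.scalar continuousOn_const (by simp) (by simp) (by simp)

theorem CH.neg (h : CH K r ρ u Q N) : CH K r ρ (fun q a => -u q a) (fun p a => -Q p a) N where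
  valu q hq := by simpa using (h.valu q hq).const_mul (-1)
  valQ p hp := by simpa using (h.valQ p hp).const_mul (-1)
  contQ := by simpa using h.contQ.const_mul (-1)
  eq p hp a ha := by linear_combination -h.eq p hp a ha
  bu q hq a ha := by rw [norm_neg]; exact h.bu q hq a ha
  bQ p hp a ha := by rw [norm_neg]; exact h.bQ p hp a ha

theorem CH.inv (h : CH K r ρ u Q N) (h4 : ∀ q ∈ K, ∀ a ∈ SD r ρ, 1 / 4 ≤ ‖u q a‖) :
    CH K r ρ (fun q a => (u q a)⁻¹) (fun p a => -1 * Q p a * ((u p.1 a)⁻¹ * (u p.2 a)⁻¹))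
      (16 * N + 4) := by
  have hpos : ∀ q ∈ K, ∀ a ∈ SD r ρ, 0 < ‖u q a‖ := fun q hq a ha =>
    lt_of_lt_of_le (by norm_num) (h4 q hq a ha)
  have hne : ∀ q ∈ K, ∀ a ∈ SD r ρ, u q a ≠ 0 := fun q hq a ha => norm_pos_iff.1 (hpos q hq a ha)
  have hi : ∀ q ∈ K, ∀ a ∈ SD r ρ, ‖(u q a)⁻¹‖ ≤ 4 := fun q hq a ha => by
    rw [norm_inv]
    exact inv_le_of_inv_le₀ (by norm_num) (by linarith [h4 q hq a ha])
  have hii : ∀ p ∈ K ×ˢ K, ∀ a ∈ SD r ρ, ‖(u p.1 a)⁻¹ * (u p.2 a)⁻¹‖ ≤ 16 := fun p hp a ha => by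
    rw [norm_mul]
    have := mul_le_mul (hi _ hp.1 a ha) (hi _ hp.2 a ha) (norm_nonneg _) (by norm_num)
    linarith
  refine ⟨fun q hq => (h.valu q hq).inv (hne q hq), fun p hp => ?_, ?_, fun p hp a ha => ?_,
    fun q hq a ha => ?_, fun p hp a ha => ?_⟩
  · exact ((h.valQ p hp).const_mul (-1)).mul
      (((h.valu _ hp.1).inv (hne _ hp.1)).mul ((h.valu _ hp.2).inv (hne _ hp.2)))
  · refine (h.contQ.const_mul (-1)).mul (M := N) (N := 16) ?_ (fun p hp a ha => ?_) hii
    · exact (h.uc_fst.inv (c := 1 / 4) (by norm_num) fun p hp => h4 _ hp.1).mul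
        (h.uc_snd.inv (c := 1 / 4) (by norm_num) fun p hp => h4 _ hp.2)
        (fun p hp => hi _ hp.1) (fun p hp => hi _ hp.2)
    · simpa using h.bQ p hp a ha
  · have h1 := hne _ hp.1 a ha
    have h2 := hne _ hp.2 a ha
    rw [inv_sub_inv h2 h1, div_eq_mul_inv, mul_inv]
    linear_combination -((u p.2 a)⁻¹ * (u p.1 a)⁻¹) * h.eq p hp a ha
  · have := (norm_nonneg _).trans (h.bu q hq a ha)
    linarith [hi q hq a ha]
  · have h1 := h.bQ p hp a ha
    have h2 := hii p hp a ha
    rw [norm_mul, neg_one_mul, norm_neg]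
    have := mul_le_mul h1 h2 (norm_nonneg _) ((norm_nonneg _).trans h1)
    linarith

theorem fcoef_sub {v w : ℂ → ℂ} (hr : 0 < r) (hv : PerHol r v) (hw : PerHol r w) (k : ℤ) :
    fcoef (fun z => v z - w z) k = fcoef v k - fcoef w k := by
  have hi : ∀ {v : ℂ → ℂ}, PerHol r v →
      IntervalIntegrable (fun t : ℝ => v t * ek (-k) t) MeasureTheory.volume 0 1 := fun hv =>
    ((hv.mul_ek (-k)).hol.continuousOn.comp_continuous Complex.continuous_ofReal
      (ofReal_mem_Strip hr)).intervalIntegrable _ _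
  simp only [fcoef_eq]
  rw [← intervalIntegral.integral_sub (hi hv) (hi hw)]
  simp only [sub_mul]

theorem fcoef_const_mul (c : ℂ) (v : ℂ → ℂ) (k : ℤ) :
    fcoef (fun z => c * v z) k = c * fcoef v k := by
  simp only [fcoef_eq, mul_assoc, intervalIntegral.integral_const_mul]

theorem fcoef_congr {v w : ℂ → ℂ} (h : ∀ t : ℝ, v t = w t) (k : ℤ) : fcoef v k = fcoef w k := by
  simp only [fcoef_eq, h]

theorem CH.coef (hr : 0 < r) (h : CH K r ρ u Q N) (k : ℤ) (r' : ℝ) :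
    CH K r' ρ (fun q a => fcoef (fun z => u q (z, a.2)) k)
      (fun p a => fcoef (fun z => Q p (z, a.2)) k)
      (N * Real.exp (-(2 * Real.pi * |(k : ℝ)| * r))) where
  valu q hq := (h.valu q hq).coef hr (h.bu q hq) k r'
  valQ p hp := (h.valQ p hp).coef hr (h.bQ p hp) k r'
  contQ p hp ε hε := by
    filter_upwards [h.contQ p hp ε hε, self_mem_nhdsWithin] with p' h' hp' a ha
    rw [← fcoef_sub hr ((h.valQ p' hp').perHol ha.2) ((h.valQ p hp).perHol ha.2)]
    exact norm_fcoef_le (fun t => h' (t, a.2) ⟨ofReal_mem_Strip hr t, ha.2⟩) k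
  eq p hp a ha := by
    rw [← fcoef_sub hr ((h.valu _ hp.2).perHol ha.2) ((h.valu _ hp.1).perHol ha.2),
      ← fcoef_const_mul]
    exact fcoef_congr (fun t => h.eq p hp (t, a.2) ⟨ofReal_mem_Strip hr t, ha.2⟩) k
  bu q hq a ha := ((h.valu q hq).perHol ha.2).norm_fcoef_le hr
    (fun θ hθ => h.bu q hq _ ⟨hθ, ha.2⟩) k
  bQ p hp a ha := ((h.valQ p hp).perHol ha.2).norm_fcoef_le hr
    (fun θ hθ => h.bQ p hp _ ⟨hθ, ha.2⟩) k

theorem CH.expMode (k : ℤ) : CH K r ρ (fun _ a => ek k a.1) (fun _ _ => 0)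
    (Real.exp (2 * Real.pi * |(k : ℝ)| * r)) where
  valu _ _ := Val.expMode k
  valQ _ _ := Val.const 0
  contQ := UC.const _
  eq _ _ _ _ := by simp
  bu _ _ a ha := norm_ek_le k (le_of_lt ha.1)
  bQ _ _ _ _ := by rw [norm_zero]; positivity

theorem CH.tsum {κ : Type*} {u : κ → ℂ → ℂ × ℂ → ℂ} {Q : κ → ℂ × ℂ → ℂ × ℂ → ℂ} {b : κ → ℝ}
    (hb : Summable b) (h : ∀ k, CH K r ρ (u k) (Q k) (b k)) :
    CH K r ρ (fun q a => ∑' k, u k q a) (fun p a => ∑' k, Q k p a) (∑' k, b k) where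
  valu q hq := Val.tsum hb (fun k => (h k).valu q hq) fun k => (h k).bu q hq
  valQ p hp := Val.tsum hb (fun k => (h k).valQ p hp) fun k => (h k).bQ p hp
  contQ := UC.tsum hb (fun k => (h k).contQ) fun k => (h k).bQ
  eq p hp a ha := by
    have hs : ∀ q ∈ K, Summable fun k => u k q a := fun q hq =>
      Summable.of_norm_bounded hb fun k => (h k).bu q hq a ha
    rw [← (hs _ hp.2).tsum_sub (hs _ hp.1), ← tsum_mul_left]
    exact tsum_congr fun k => (h k).eq p hp a ha
  bu q hq a ha := tsum_of_norm_bounded hb.hasSum fun k => (h k).bu q hq a ha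
  bQ p hp a ha := tsum_of_norm_bounded hb.hasSum fun k => (h k).bQ p hp a ha

/-- Fourier multipliers on `C¹`-holomorphic functions. -/
theorem CH.multiplier (hr : 0 < r) (h : CH K r ρ u Q N) {m : ℤ → ℂ → ℂ} {q : ℤ → ℂ × ℂ → ℂ}
    {D : ℤ → ℝ} (hq : ∀ k, ContinuousOn (q k) (K ×ˢ K))
    (heq : ∀ k, ∀ p ∈ K ×ˢ K, m k p.2 - m k p.1 = (p.2 - p.1) * q k p)
    (hm : ∀ k, ∀ x ∈ K, ‖m k x‖ ≤ D k) (hqN : ∀ k, ∀ p ∈ K ×ˢ K, ‖q k p‖ ≤ D k)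
    (hD : Summable fun k : ℤ => D k * Real.exp (-(2 * Real.pi * |(k : ℝ)| * (r - r')))) :
    ∃ R, CH K r' ρ (fun x a => ∑' k, m k x * fcoef (fun z => u x (z, a.2)) k * ek k a.1) R
      (4 * N * ∑' k : ℤ, D k * Real.exp (-(2 * Real.pi * |(k : ℝ)| * (r - r')))) := by
  have hs := hD.mul_left (4 * N)
  rw [← tsum_mul_left]
  have hterm := fun k : ℤ => ((CH.scalar (r := r') (ρ := ρ) (hq k) (heq k) (hm k) (hqN k)).mul
    (h.coef hr k r')).mul (CH.expMode k)
  refine ⟨_, CH.tsum hs fun k => (hterm k).mono le_rfl (le_of_eq ?_)⟩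
  rw [show -(2 * Real.pi * |(k : ℝ)| * (r - r')) = -(2 * Real.pi * |(k : ℝ)| * r) +
    2 * Real.pi * |(k : ℝ)| * r' by ring, Real.exp_add]
  ring

theorem CH.fPair (h : CH K r ρ u Q N) : FPair K (SD r ρ) u fun q => Q (q, q) := by
  have hdiag : UC K (SD r ρ) fun q => Q (q, q) :=
    h.contQ.comp (φ := fun q => (q, q)) (by fun_prop) fun q hq => ⟨hq, hq⟩
  refine ⟨uc_iff.1 h.uc, uc_iff.1 hdiag, uc_iff.1 ?_⟩
  refine (h.contQ.add (G := fun p a => -1 * Q (p.1, p.1) a) ?_).congr fun p hp a ha => ?_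
  · exact (hdiag.comp continuous_fst.continuousOn fun _ hp => hp.1).const_mul (-1)
  · obtain ⟨x, y⟩ := p
    unfold omegaF
    split_ifs with hxy
    · simp only at hxy; subst hxy; simp
    · rw [h.eq _ hp a ha, smul_eq_mul, inv_mul_cancel_left₀ (sub_ne_zero.2 (Ne.symm hxy))]
      ring

theorem CH.norm_omegaF_le (h : CH K r ρ u Q N) {p : ℂ × ℂ} (hp : p ∈ K ×ˢ K) {a : ℂ × ℂ}
    (ha : a ∈ SD r ρ) : ‖omegaF u (fun q => Q (q, q)) p a‖ ≤ 2 * N := by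
  obtain ⟨x, y⟩ := p
  have h1 := h.bQ _ hp a ha
  have h2 := h.bQ (x, x) ⟨hp.1, hp.1⟩ a ha
  unfold omegaF
  split_ifs with hxy
  · rw [norm_zero]; linarith [norm_nonneg (Q (x, x) a)]
  · rw [h.eq _ hp a ha, smul_eq_mul, inv_mul_cancel_left₀ (sub_ne_zero.2 (Ne.symm hxy))]
    exact (norm_sub_le _ _).trans (by linarith)

theorem CH.fBdd (h : CH K r ρ u Q N) : FBdd K (SD r ρ) u fun q => Q (q, q) := by
  refine ⟨⟨N, ?_⟩, ⟨N, ?_⟩, ⟨2 * N, ?_⟩⟩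
  · rintro _ ⟨q, hq, a, ha, rfl⟩; exact h.bu q hq a ha
  · rintro _ ⟨q, hq, a, ha, rfl⟩; exact h.bQ _ ⟨hq, hq⟩ a ha
  · rintro _ ⟨q, hq, a, ha, rfl⟩; exact h.norm_omegaF_le hq ha

theorem CH.fNorm_le (h : CH K r ρ u Q N) (hN : 0 ≤ N) :
    fNorm K (SD r ρ) u (fun q => Q (q, q)) ≤ 5 * N := by
  have h1 : fn0 K (SD r ρ) u ≤ N := Real.sSup_le (by
    rintro _ ⟨q, hq, a, ha, rfl⟩; exact h.bu q hq a ha) hN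
  have h2 : fn0 K (SD r ρ) (fun q => Q (q, q)) ≤ N := Real.sSup_le (by
    rintro _ ⟨q, hq, a, ha, rfl⟩; exact h.bQ _ ⟨hq, hq⟩ a ha) hN
  have h3 : fdel K (SD r ρ) u ≤ 2 * N := Real.sSup_le (by
    rintro _ ⟨q, hq, a, ha, rfl⟩
    exact (norm_sub_le _ _).trans (by linarith [h.bu _ hq.1 a ha, h.bu _ hq.2 a ha])) (by linarith)
  have h4 : fn2 K (SD r ρ) u (fun q => Q (q, q)) ≤ 2 * N := Real.sSup_le (by
    rintro _ ⟨q, hq, a, ha, rfl⟩; exact h.norm_omegaF_le hq ha) (by linarith)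
  have := max_le (h2.trans (by linarith)) h3
  unfold fNorm
  linarith

theorem fNorm_nonneg {α B : Type*} [NormedAddCommGroup B] [NormedSpace ℂ B] (K : Set ℂ)
    (S : Set α) (u g : ℂ → α → B) :
    0 ≤ fn0 K S u ∧ 0 ≤ fn0 K S g ∧ 0 ≤ fdel K S u ∧ 0 ≤ fn2 K S u g := by
  refine ⟨?_, ?_, ?_, ?_⟩ <;> exact Real.sSup_nonneg (by rintro _ ⟨q, hq, a, ha, rfl⟩; positivity)

theorem exists_CH (hK : ∀ x ∈ K, (nhdsWithin x (K \ {x})).NeBot) {g : ℂ → ℂ × ℂ → ℂ}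
    (hp : FPair K (SD r ρ) u g) (hb : FBdd K (SD r ρ) u g) (hv : ∀ q ∈ K, Val r ρ (u q)) :
    ∃ Q, CH K r ρ u Q (fNorm K (SD r ρ) u g) := by
  obtain ⟨n1, n2, n3, n4⟩ := fNorm_nonneg K (SD r ρ) u g
  have hmax : fn0 K (SD r ρ) g ≤ max (fn0 K (SD r ρ) g) (fdel K (SD r ρ) u) := le_max_left _ _
  set Q : ℂ × ℂ → ℂ × ℂ → ℂ := fun p a => omegaF u g p a + g p.1 a with hQ
  have hoff : ∀ p : ℂ × ℂ, p.1 ≠ p.2 → Q p = fun a => (p.2 - p.1)⁻¹ * (u p.2 a + -1 * u p.1 a) := by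
    intro p hpne
    funext a
    simp only [hQ, omegaF, if_neg hpne, smul_eq_mul]; ring
  have hcont : UC (K ×ˢ K) (SD r ρ) Q := UC.add (uc_iff.2 hp.2.2)
    (UC.comp (uc_iff.2 hp.2.1) continuous_fst.continuousOn fun p hp => hp.1)
  have hvoff : ∀ p ∈ K ×ˢ K, p.1 ≠ p.2 → Val r ρ (Q p) := fun p hp hne => by
    rw [hoff p hne]
    exact ((hv _ hp.2).add ((hv _ hp.1).const_mul (-1))).const_mul _
  refine ⟨Q, hv, fun p hp => ?_, hcont, fun p hp a ha => ?_, fun q hq a ha => ?_,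
    fun p hp a ha => ?_⟩
  · by_cases hne : p.1 ≠ p.2
    · exact hvoff p hp hne
    obtain ⟨x, y⟩ := p
    obtain rfl : x = y := by simpa using hne
    have hx : x ∈ K := hp.1
    have hnb := hK x hx
    obtain ⟨s, hs⟩ := Filter.exists_seq_tendsto (nhdsWithin x (K \ {x}))
    obtain ⟨hs1, hs2⟩ := tendsto_nhdsWithin_iff.1 hs
    obtain ⟨n₀, hn₀⟩ := Filter.eventually_atTop.1 hs2
    refine Val.of_tendstoUniformlyOn (l := Filter.atTop) (f := fun n => Q (x, s (n + n₀)))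
      (fun n => hvoff _ ⟨hx, (hn₀ _ (by omega)).1⟩ fun h => (hn₀ _ (by omega)).2 h.symm) ?_
    rw [Metric.tendstoUniformlyOn_iff]
    intro ε hε
    have hlim : Filter.Tendsto (fun n => (x, s (n + n₀))) Filter.atTop
        (nhdsWithin (x, x) (K ×ˢ K)) := by
      refine tendsto_nhdsWithin_iff.2 ⟨?_, .of_forall fun n => ⟨hx, (hn₀ _ (by omega)).1⟩⟩
      exact tendsto_const_nhds.prodMk_nhds (hs1.comp (Filter.tendsto_add_atTop_nat n₀))
    filter_upwards [hlim.eventually (hcont (x, x) hp (ε / 2) (by positivity))] with n hn a ha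
    rw [dist_comm, dist_eq_norm]
    linarith [hn a ha]
  · by_cases hne : p.1 = p.2
    · rw [hne]; simp
    · rw [hoff p hne, mul_inv_cancel_left₀ (sub_ne_zero.2 (Ne.symm hne))]; ring
  · have : ‖u q a‖ ≤ fn0 K (SD r ρ) u := le_csSup hb.1 ⟨q, hq, a, ha, rfl⟩
    unfold fNorm; linarith
  · have h1 : ‖g p.1 a‖ ≤ fn0 K (SD r ρ) g := le_csSup hb.2.1 ⟨_, hp.1, a, ha, rfl⟩
    have h2 : ‖omegaF u g p a‖ ≤ fn2 K (SD r ρ) u g := le_csSup hb.2.2 ⟨p, hp, a, ha, rfl⟩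
    refine (norm_add_le _ _).trans ?_
    unfold fNorm; linarith

end

/-- A scalar function on the sphere which is `C¹`-holomorphic on `K_M` in both charts, with bound
`D`. -/
def MultBd (τ M : ℝ) (m : OnePoint ℂ → ℂ) (D : ℝ) : Prop :=
  ∀ b, ∃ q : ℂ × ℂ → ℂ, ContinuousOn q (KF τ M ×ˢ KF τ M) ∧
    (∀ p ∈ KF τ M ×ˢ KF τ M, m (chart b p.2) - m (chart b p.1) = (p.2 - p.1) * q p) ∧
    (∀ x ∈ KF τ M, ‖m (chart b x)‖ ≤ D) ∧ ∀ p ∈ KF τ M ×ˢ KF τ M, ‖q p‖ ≤ D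

theorem MultBd.const_mul {τ M D : ℝ} {m : OnePoint ℂ → ℂ} (h : MultBd τ M m D) (c : ℂ) :
    MultBd τ M (fun q => c * m q) (‖c‖ * D) := fun b => by
  obtain ⟨q, h1, h2, h3, h4⟩ := h b
  refine ⟨fun p => c * q p, h1.const_smul c, fun p hp => ?_, fun x hx => ?_, fun p hp => ?_⟩
  · linear_combination c * h2 p hp
  · rw [norm_mul]; exact mul_le_mul_of_nonneg_left (h3 x hx) (norm_nonneg _)
  · rw [norm_mul]; exact mul_le_mul_of_nonneg_left (h4 p hp) (norm_nonneg _)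

/-- The multiplier `1 / (q ^ m - 1)` on the sphere. -/
def lamPos (m : ℕ) (q : OnePoint ℂ) : ℂ := q.elim 0 fun x => (x ^ m - 1)⁻¹

/-- The Fourier multiplier inverting `φ ↦ φ⁺ - φ` on functions of mean zero. -/
def lam (k : ℤ) (q : OnePoint ℂ) : ℂ :=
  if k = 0 then 0 else if 0 < k then lamPos k.natAbs q else -1 - lamPos k.natAbs q

/-- The Fourier multiplier of the translate of the inverse of `φ ↦ φ⁺ - φ`. -/
def lamPlus (k : ℤ) (q : OnePoint ℂ) : ℂ := if k = 0 then 0 else lam k q + 1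

theorem lamPos_coe (m : ℕ) (x : ℂ) : lamPos m (x : OnePoint ℂ) = (x ^ m - 1)⁻¹ := rfl

section
variable {τ M : ℝ}

theorem pow_sub_one_ne_zero (hτ : 0 < τ) (hM : 1 ≤ M) {x : ℂ} (hx : x ∈ KF τ M) {m : ℕ}
    (hm : 0 < m) : x ^ m - 1 ≠ 0 := by
  intro h
  have := one_le_norm_pow_sub_one hτ hM hx hm
  rw [h, norm_zero, mul_zero] at this
  linarith

theorem lamPos_chart (hτ : 0 < τ) (hM : 1 ≤ M) {x : ℂ} (hx : x ∈ KF τ M) {m : ℕ}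
    (hm : 0 < m) (b : Bool) :
    lamPos m (chart b x) = if b then (x ^ m - 1)⁻¹ else -1 - (x ^ m - 1)⁻¹ := by
  cases b
  · simp only [chart, sphChart, Bool.false_eq_true, if_false]
    have h1 := pow_sub_one_ne_zero hτ hM hx hm
    by_cases h0 : x = 0
    · subst h0
      simp [lamPos, zero_pow hm.ne']
    · rw [if_neg h0, lamPos_coe]
      have h2 : (1 : ℂ) - x ^ m ≠ 0 := by rw [← neg_sub]; exact neg_ne_zero.2 h1
      have h3 : x ^ m ≠ 0 := pow_ne_zero _ h0
      have h4 : (x⁻¹) ^ m - 1 = (1 - x ^ m) / x ^ m := by rw [inv_pow]; field_simp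
      rw [h4, inv_div, div_eq_iff h2]
      field_simp
      ring
  · simp [chart, lamPos_coe]

theorem lam_coe (hτ : 0 < τ) (hM : 1 ≤ M) {x : ℂ} (hx : x ∈ KF τ M) (h0 : x ≠ 0) {k : ℤ}
    (hk : k ≠ 0) : x ^ k - 1 ≠ 0 ∧ lam k (x : OnePoint ℂ) = (x ^ k - 1)⁻¹ := by
  have hm : 0 < k.natAbs := Int.natAbs_pos.2 hk
  have h1 := pow_sub_one_ne_zero hτ hM hx hm
  rw [lam, if_neg hk]
  rcases lt_or_gt_of_ne hk with h | h
  · rw [if_neg (by omega), lamPos_coe]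
    have e : x ^ k = (x ^ k.natAbs)⁻¹ := by
      rw [← zpow_natCast, ← zpow_neg]; congr 1; omega
    have h3 : x ^ k.natAbs ≠ 0 := pow_ne_zero _ h0
    have h2 : (1 : ℂ) - x ^ k.natAbs ≠ 0 := by rw [← neg_sub]; exact neg_ne_zero.2 h1
    have h4 : x ^ k - 1 = (1 - x ^ k.natAbs) / x ^ k.natAbs := by rw [e]; field_simp
    refine ⟨by rw [h4]; exact div_ne_zero h2 h3, ?_⟩
    rw [h4, inv_div, eq_div_iff h2]
    field_simp
    ring
  · rw [if_pos h, lamPos_coe]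
    have e : x ^ k = x ^ k.natAbs := by
      rw [← zpow_natCast]; congr 1; omega
    rw [e]; exact ⟨h1, rfl⟩

theorem lamPlus_coe (hτ : 0 < τ) (hM : 1 ≤ M) {x : ℂ} (hx : x ∈ KF τ M) (h0 : x ≠ 0) (k : ℤ) :
    lamPlus k (x : OnePoint ℂ) = x ^ k * lam k (x : OnePoint ℂ) := by
  by_cases hk : k = 0
  · simp [lamPlus, lam, hk]
  · obtain ⟨h1, h2⟩ := lam_coe hτ hM hx h0 hk
    rw [lamPlus, if_neg hk, h2]
    field_simp
    ring

theorem lam_mul_pow_sub_one (hτ : 0 < τ) (hM : 1 ≤ M) {x : ℂ} (hx : x ∈ KF τ M) (h0 : x ≠ 0)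
    {k : ℤ} (hk : k ≠ 0) : lam k (x : OnePoint ℂ) * (x ^ k - 1) = 1 := by
  obtain ⟨h1, h2⟩ := lam_coe hτ hM hx h0 hk
  rw [h2, inv_mul_cancel₀ h1]

theorem lam_conj (hτ : 0 < τ) (hM : 1 ≤ M) {x : ℂ} (hx : x ∈ KF τ M) (h0 : x ≠ 0) (k : ℤ) :
    starRingEnd ℂ (lam k (x : OnePoint ℂ)) =
      lam (-k) ((((starRingEnd ℂ x)⁻¹ : ℂ) : OnePoint ℂ)) := by
  by_cases hk : k = 0
  · simp [lam, hk]
  · obtain ⟨h1, h2⟩ := lam_coe hτ hM hx h0 hk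
    have h0' : (starRingEnd ℂ x)⁻¹ ≠ 0 := inv_ne_zero ((map_ne_zero _).2 h0)
    obtain ⟨h3, h4⟩ := lam_coe hτ hM (conj_inv_mem_KF hx) h0' (neg_ne_zero.2 hk)
    rw [h2, h4]
    simp only [map_inv₀, map_sub, map_zpow₀, map_one, inv_zpow', neg_neg]

theorem multBd_aux (hτ : 0 < τ) (hM : 1 ≤ M) {n : ℕ} (hn : 0 < n) (s e : ℂ) (hs : ‖s‖ = 1)
    (he : e = 0 ∨ e = 1) : ∃ q : ℂ × ℂ → ℂ, ContinuousOn q (KF τ M ×ˢ KF τ M) ∧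
    (∀ p ∈ KF τ M ×ˢ KF τ M, s * ((p.2 ^ n - 1)⁻¹ + e) - s * ((p.1 ^ n - 1)⁻¹ + e) =
      (p.2 - p.1) * q p) ∧
    (∀ x ∈ KF τ M, ‖s * ((x ^ n - 1)⁻¹ + e)‖ ≤ 9 * M ^ 2 * (n : ℝ) ^ (3 + 2 * τ)) ∧
    ∀ p ∈ KF τ M ×ˢ KF τ M, ‖q p‖ ≤ 9 * M ^ 2 * (n : ℝ) ^ (3 + 2 * τ) := by
  have hn1 : (1:ℝ) ≤ n := by exact_mod_cast hn
  set P := (n : ℝ) ^ (1 + τ) with hP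
  have hP1 : 1 ≤ P := Real.one_le_rpow hn1 (by linarith)
  have hMP : 1 ≤ M * P := by nlinarith
  have hpow : (n : ℝ) ^ (3 + 2 * τ) = n * P ^ 2 := by
    rw [hP, ← Real.rpow_natCast, ← Real.rpow_mul (by linarith)]
    nth_rewrite 2 [← Real.rpow_one (n : ℝ)]
    rw [← Real.rpow_add (by linarith)]
    congr 1; push_cast; ring
  have hD : 9 * M ^ 2 * (n : ℝ) ^ (3 + 2 * τ) = n * (3 * (M * P)) ^ 2 := by rw [hpow]; ring
  have hLD : 3 * (M * P) ≤ 9 * M ^ 2 * (n : ℝ) ^ (3 + 2 * τ) := by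
    rw [hD]; nlinarith
  have hl : ∀ x ∈ KF τ M, ‖(x ^ n - 1)⁻¹‖ ≤ 2 * (M * P) := fun x hx => by
    have h1 := one_le_norm_pow_sub_one hτ hM hx hn
    have h2 : 0 < ‖x ^ n - 1‖ := norm_pos_iff.2 (pow_sub_one_ne_zero hτ hM hx hn)
    rw [norm_inv, inv_le_iff_one_le_mul₀ h2]
    linarith
  have hl' : ∀ x ∈ KF τ M, ‖x‖ ^ n * ‖(x ^ n - 1)⁻¹‖ ≤ 3 * (M * P) := fun x hx => by
    have h2 := pow_sub_one_ne_zero hτ hM hx hn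
    rw [← norm_pow, ← norm_mul, show x ^ n * (x ^ n - 1)⁻¹ = 1 + (x ^ n - 1)⁻¹ by field_simp; ring]
    refine (norm_add_le _ _).trans ?_
    rw [norm_one]; linarith [hl x hx]
  have hl'' : ∀ x ∈ KF τ M, ∀ j ≤ n, ‖x‖ ^ j * ‖(x ^ n - 1)⁻¹‖ ≤ 3 * (M * P) := fun x hx j hj => by
    rcases le_total ‖x‖ 1 with h | h
    · have := mul_le_mul (pow_le_one₀ (n := j) (norm_nonneg x) h) (hl x hx) (norm_nonneg _)
        zero_le_one
      linarith
    · exact (mul_le_mul_of_nonneg_right (pow_le_pow_right₀ h hj) (norm_nonneg _)).trans (hl' x hx)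
  refine ⟨fun p => -s * ((∑ j ∈ Finset.range n, p.2 ^ j * p.1 ^ (n - 1 - j)) *
    ((p.1 ^ n - 1)⁻¹ * (p.2 ^ n - 1)⁻¹)), ?_, fun p hp => ?_, fun x hx => ?_, fun p hp => ?_⟩
  · refine continuousOn_const.mul (ContinuousOn.mul (by fun_prop) (ContinuousOn.mul ?_ ?_))
    · exact ContinuousOn.inv₀ (by fun_prop) fun p hp => pow_sub_one_ne_zero hτ hM hp.1 hn
    · exact ContinuousOn.inv₀ (by fun_prop) fun p hp => pow_sub_one_ne_zero hτ hM hp.2 hn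
  · have h1 := pow_sub_one_ne_zero hτ hM hp.1 hn
    have h2 := pow_sub_one_ne_zero hτ hM hp.2 hn
    have h3 := (Commute.all p.2 p.1).geom_sum₂_mul n
    have h4 : (p.2 ^ n - 1)⁻¹ - (p.1 ^ n - 1)⁻¹ =
        -(p.2 ^ n - p.1 ^ n) * ((p.1 ^ n - 1)⁻¹ * (p.2 ^ n - 1)⁻¹) := by
      rw [inv_sub_inv h2 h1, div_eq_mul_inv, mul_inv]; ring
    rw [← h3] at h4
    linear_combination s * h4
  · rw [norm_mul, hs, one_mul]
    refine (norm_add_le _ _).trans (le_trans ?_ hLD)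
    have : ‖e‖ ≤ 1 := by rcases he with rfl | rfl <;> simp
    linarith [hl x hx]
  · rw [norm_mul, norm_neg, hs, one_mul, Finset.sum_mul, hD]
    refine (norm_sum_le _ _).trans ?_
    refine (Finset.sum_le_card_nsmul _ _ ((3 * (M * P)) ^ 2) fun j hj => ?_).trans ?_
    · rw [Finset.mem_range] at hj
      have h1 := hl'' _ hp.2 j hj.le
      have h2 := hl'' _ hp.1 (n - 1 - j) (by omega)
      have h3 := mul_le_mul h1 h2 (by positivity) (by positivity)
      simp only [norm_mul, norm_pow]
      calc _ = ‖p.2‖ ^ j * ‖(p.2 ^ n - 1)⁻¹‖ * (‖p.1‖ ^ (n - 1 - j) * ‖(p.1 ^ n - 1)⁻¹‖) := by ring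
        _ ≤ _ := h3
        _ = _ := by ring
    · simp

/-- The size of the small-divisor multipliers. -/
def divBd (τ M : ℝ) (k : ℤ) : ℝ := 9 * M ^ 2 * |(k : ℝ)| ^ (3 + 2 * τ)

theorem natCast_natAbs_real (k : ℤ) : ((k.natAbs : ℕ) : ℝ) = |(k : ℝ)| := by
  rw [Nat.cast_natAbs]; push_cast; rfl

theorem multBd_zero (hτ : 0 < τ) : MultBd τ M (fun _ => 0) (divBd τ M 0) := fun _ =>
  ⟨fun _ => 0, continuousOn_const, by simp, by simp [divBd, Real.zero_rpow (show 3 + 2 * τ ≠ 0 by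
    linarith)], by simp [divBd, Real.zero_rpow (show 3 + 2 * τ ≠ 0 by linarith)]⟩

theorem multBd_of_chart (hτ : 0 < τ) (hM : 1 ≤ M) {k : ℤ} (hk : k ≠ 0) {m : OnePoint ℂ → ℂ}
    (h : ∀ b, ∃ s e : ℂ, ‖s‖ = 1 ∧ (e = 0 ∨ e = 1) ∧
      ∀ x ∈ KF τ M, m (chart b x) = s * ((x ^ k.natAbs - 1)⁻¹ + e)) :
    MultBd τ M m (divBd τ M k) := fun b => by
  obtain ⟨s, e, hs, he, hx⟩ := h b
  obtain ⟨q, h1, h2, h3, h4⟩ := multBd_aux hτ hM (Int.natAbs_pos.2 hk) s e hs he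
  rw [natCast_natAbs_real] at h3 h4
  refine ⟨q, h1, fun p hp => ?_, fun x hx' => ?_, h4⟩
  · rw [hx _ hp.1, hx _ hp.2, h2 p hp]
  · rw [hx x hx']; exact h3 x hx'

theorem multBd_lam (hτ : 0 < τ) (hM : 1 ≤ M) (k : ℤ) : MultBd τ M (lam k) (divBd τ M k) := by
  by_cases hk : k = 0
  · subst hk
    exact multBd_zero hτ
  have hm : 0 < k.natAbs := Int.natAbs_pos.2 hk
  refine multBd_of_chart hτ hM hk fun b => ?_
  simp only [lam, if_neg hk]
  by_cases h : 0 < k <;> cases b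
  · refine ⟨-1, 1, by simp, by simp, fun x hx => ?_⟩
    rw [if_pos h, lamPos_chart hτ hM hx hm]; simp; ring
  · refine ⟨1, 0, by simp, by simp, fun x hx => ?_⟩
    rw [if_pos h, lamPos_chart hτ hM hx hm]; simp
  · refine ⟨1, 0, by simp, by simp, fun x hx => ?_⟩
    rw [if_neg h, lamPos_chart hτ hM hx hm]; simp
  · refine ⟨-1, 1, by simp, by simp, fun x hx => ?_⟩
    rw [if_neg h, lamPos_chart hτ hM hx hm]; simp; ring

theorem multBd_lamPlus (hτ : 0 < τ) (hM : 1 ≤ M) (k : ℤ) :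
    MultBd τ M (lamPlus k) (divBd τ M k) := by
  by_cases hk : k = 0
  · subst hk
    exact multBd_zero hτ
  have hm : 0 < k.natAbs := Int.natAbs_pos.2 hk
  refine multBd_of_chart hτ hM hk fun b => ?_
  simp only [lamPlus, lam, if_neg hk]
  by_cases h : 0 < k <;> cases b
  · refine ⟨-1, 0, by simp, by simp, fun x hx => ?_⟩
    rw [if_pos h, lamPos_chart hτ hM hx hm]; simp; ring
  · refine ⟨1, 1, by simp, by simp, fun x hx => ?_⟩
    rw [if_pos h, lamPos_chart hτ hM hx hm]; simp
  · refine ⟨1, 1, by simp, by simp, fun x hx => ?_⟩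
    rw [if_neg h, lamPos_chart hτ hM hx hm]; simp
  · refine ⟨-1, 0, by simp, by simp, fun x hx => ?_⟩
    rw [if_neg h, lamPos_chart hτ hM hx hm]; simp; ring

end

theorem sum_abs_rpow_mul_exp {p d : ℝ} (hp : 0 < p) (hd : 0 < d) :
    (Summable fun k : ℤ => |(k : ℝ)| ^ p * Real.exp (-(2 * Real.pi * |(k : ℝ)| * d))) ∧
      ∑' k : ℤ, |(k : ℝ)| ^ p * Real.exp (-(2 * Real.pi * |(k : ℝ)| * d)) ≤
        2 * p ^ p / d ^ (p + 1) := by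
  set c := (p / d) ^ p with hc
  have hc0 : 0 ≤ c := by positivity
  set b : ℤ → ℝ := fun k => if k = 0 then 0 else c * Real.exp (-(|(k : ℝ)| * d)) with hb
  have hx1 : Real.exp (-d) < 1 := by rw [Real.exp_lt_one_iff]; linarith
  have hle : ∀ k : ℤ, |(k : ℝ)| ^ p * Real.exp (-(2 * Real.pi * |(k : ℝ)| * d)) ≤ b k := by
    intro k
    by_cases hk : k = 0
    · simp [hb, hk, Real.zero_rpow hp.ne']
    · simp only [hb, if_neg hk]
      set y := |(k : ℝ)| with hy
      have hy0 : 0 ≤ y := abs_nonneg _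
      have h1 : y * d / p ≤ Real.exp (y * d / p) := by
        linarith [Real.add_one_le_exp (y * d / p)]
      have h2 : y ^ p ≤ c * Real.exp (y * d) := by
        have h3 := Real.rpow_le_rpow (by positivity) h1 hp.le
        rw [← Real.exp_mul, div_mul_cancel₀ _ hp.ne'] at h3
        have h4 : y = p / d * (y * d / p) := by field_simp
        rw [h4, Real.mul_rpow (by positivity) (by positivity), ← h4]
        exact mul_le_mul_of_nonneg_left h3 hc0
      refine (mul_le_mul_of_nonneg_right h2 (Real.exp_pos _).le).trans ?_
      rw [mul_assoc, ← Real.exp_add]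
      refine mul_le_mul_of_nonneg_left (Real.exp_le_exp.2 ?_) hc0
      nlinarith [Real.pi_gt_three, mul_nonneg hy0 hd.le]
  have hgeo : HasSum (fun n : ℕ => c * Real.exp (-(((n : ℝ) + 1) * d)))
      (c * (Real.exp (-d) * (1 - Real.exp (-d))⁻¹)) := by
    refine (((hasSum_geometric_of_lt_one (Real.exp_pos _).le hx1).mul_left (Real.exp (-d))).mul_left
      c).congr_fun ?_
    intro n
    rw [← Real.exp_nat_mul, ← Real.exp_add]
    ring_nf
  have hbsum : HasSum b (c * (Real.exp (-d) * (1 - Real.exp (-d))⁻¹) + b 0 +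
      c * (Real.exp (-d) * (1 - Real.exp (-d))⁻¹)) := by
    refine HasSum.of_add_one_of_neg_add_one ?_ ?_
    · refine hgeo.congr_fun fun n => ?_
      have h1 : (n : ℤ) + 1 ≠ 0 := by omega
      have h2 : |(n : ℝ) + 1| = n + 1 := abs_of_nonneg (by positivity)
      simp only [hb, if_neg h1]
      push_cast; rw [h2]
    · refine hgeo.congr_fun fun n => ?_
      have h1 : -((n : ℤ) + 1) ≠ 0 := by omega
      have h2 : |-((n : ℝ) + 1)| = n + 1 := by rw [abs_neg]; exact abs_of_nonneg (by positivity)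
      simp only [hb, if_neg h1]
      push_cast; rw [h2]
  have hs : Summable fun k : ℤ => |(k : ℝ)| ^ p * Real.exp (-(2 * Real.pi * |(k : ℝ)| * d)) :=
    Summable.of_nonneg_of_le (fun k => by positivity) hle hbsum.summable
  refine ⟨hs, (hs.tsum_le_tsum hle hbsum.summable).trans ?_⟩
  rw [hbsum.tsum_eq]
  have h0 : b 0 = 0 := by simp [hb]
  have h5 : Real.exp (-d) * (1 - Real.exp (-d))⁻¹ ≤ 1 / d := by
    rw [← div_eq_mul_inv, div_le_div_iff₀ (by linarith) hd, one_mul]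
    have h6 := Real.add_one_le_exp d
    have h7 : Real.exp (-d) * Real.exp d = 1 := by rw [← Real.exp_add]; simp
    nlinarith [Real.exp_pos (-d)]
  have h8 : 2 * p ^ p / d ^ (p + 1) = 2 * (c * (1 / d)) := by
    rw [hc, Real.div_rpow hp.le hd.le, Real.rpow_add hd, Real.rpow_one]
    have : 0 < d ^ p := by positivity
    field_simp
  rw [h0, h8]
  nlinarith [mul_le_mul_of_nonneg_left h5 hc0]

/-- `u ∈ C_r` with `u` and its difference quotients in both charts bounded by `N`. -/
def Sph (τ M r ρ : ℝ) (u : OnePoint ℂ → ℂ × ℂ → ℂ) (N : ℝ) : Prop :=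
  ∀ b, ∃ Q, CH (KF τ M) r ρ (fun x => u (chart b x)) Q N

section
variable {τ M r r' ρ N N' : ℝ} {u v : OnePoint ℂ → ℂ × ℂ → ℂ}

theorem Sph.mono (h : Sph τ M r ρ u N) (hr : r' ≤ r) (hN : N ≤ N') : Sph τ M r' ρ u N' :=
  fun b => (h b).imp fun _ hQ => hQ.mono hr hN

theorem Sph.congr (h : Sph τ M r ρ u N)
    (huv : ∀ q ∈ KM τ M, ∀ a ∈ SD r ρ, v q a = u q a) : Sph τ M r ρ v N :=
  fun b => (h b).imp fun _ hQ => hQ.congr fun _ hx => huv _ ((chart_mem b).2 hx)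

theorem Sph.add (h : Sph τ M r ρ u N) (h' : Sph τ M r ρ v N') :
    Sph τ M r ρ (fun q a => u q a + v q a) (N + N') := fun b => by
  obtain ⟨Q, hQ⟩ := h b
  obtain ⟨R, hR⟩ := h' b
  exact ⟨_, hQ.add hR⟩

theorem Sph.mul (h : Sph τ M r ρ u N) (h' : Sph τ M r ρ v N') :
    Sph τ M r ρ (fun q a => u q a * v q a) (2 * N * N') := fun b => by
  obtain ⟨Q, hQ⟩ := h b
  obtain ⟨R, hR⟩ := h' b
  exact ⟨_, hQ.mul hR⟩

theorem Sph.neg (h : Sph τ M r ρ u N) : Sph τ M r ρ (fun q a => -u q a) N := fun b => by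
  obtain ⟨Q, hQ⟩ := h b
  exact ⟨_, hQ.neg⟩

theorem Sph.sub (h : Sph τ M r ρ u N) (h' : Sph τ M r ρ v N') :
    Sph τ M r ρ (fun q a => u q a - v q a) (N + N') := by
  simpa only [sub_eq_add_neg] using h.add h'.neg

theorem Sph.const (c : ℂ) : Sph τ M r ρ (fun _ _ => c) ‖c‖ := fun _ => ⟨_, CH.const c⟩

theorem Sph.inv (h : Sph τ M r ρ u N) (h4 : ∀ q ∈ KM τ M, ∀ a ∈ SD r ρ, 1 / 4 ≤ ‖u q a‖) :
    Sph τ M r ρ (fun q a => (u q a)⁻¹) (16 * N + 4) := fun b => by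
  obtain ⟨Q, hQ⟩ := h b
  exact ⟨_, hQ.inv fun x hx => h4 _ ((chart_mem b).2 hx)⟩

theorem Sph.mean (hr : 0 < r) (h : Sph τ M r ρ u N) (r' : ℝ) :
    Sph τ M r' ρ (fun q a => fcoef (fun z => u q (z, a.2)) 0) N := fun b => by
  obtain ⟨Q, hQ⟩ := h b
  exact ⟨_, (hQ.coef hr 0 r').mono le_rfl (by simp)⟩

theorem Sph.val (h : Sph τ M r ρ u N) {q : OnePoint ℂ} (hq : q ∈ KM τ M) : Val r ρ (u q) := by
  obtain ⟨b, x, hx, rfl⟩ := exists_chart hq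
  obtain ⟨Q, hQ⟩ := h b
  exact hQ.valu x hx

theorem Sph.perHol (h : Sph τ M r ρ u N) {q : OnePoint ℂ} (hq : q ∈ KM τ M) {ε : ℂ}
    (hε : ε ∈ ball (0 : ℂ) ρ) : PerHol r fun θ => u q (θ, ε) := (h.val hq).perHol hε

theorem Sph.norm_le (h : Sph τ M r ρ u N) {q : OnePoint ℂ} (hq : q ∈ KM τ M) {a : ℂ × ℂ}
    (ha : a ∈ SD r ρ) : ‖u q a‖ ≤ N := by
  obtain ⟨b, x, hx, rfl⟩ := exists_chart hq
  obtain ⟨Q, hQ⟩ := h b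
  exact hQ.bu x hx a ha

theorem Sph.hasSum (h : Sph τ M r ρ u N) {q : OnePoint ℂ} (hq : q ∈ KM τ M) {a : ℂ × ℂ}
    (ha : a ∈ SD r ρ) : HasSum (fun k => fcoef (fun z => u q (z, a.2)) k * ek k a.1) (u q a) :=
  (h.perHol hq ha.2).hasSum (fun _ hθ => h.norm_le hq ⟨hθ, ha.2⟩) ha.1

/-- Functions vanishing away from `0` and `∞` vanish on `K_M`. -/
theorem Sph.eq_zero (hne : (AMR τ M).Nonempty) (h : Sph τ M r ρ u N) {a : ℂ × ℂ}
    (ha : a ∈ SD r ρ) (h0 : ∀ q ∈ KF τ M, q ≠ 0 → u (q : OnePoint ℂ) a = 0) {q : OnePoint ℂ}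
    (hq : q ∈ KM τ M) : u q a = 0 := by
  obtain ⟨b, x, hx, rfl⟩ := exists_chart hq
  have hz : ∀ x ∈ KF τ M, x ≠ 0 → u (chart b x) a = 0 := fun x hx hx0 => by
    obtain ⟨y, hy, hy0, he⟩ := chart_eq_coe b hx hx0
    rw [he, h0 y hy hy0]
  by_cases hx0 : x = 0
  · subst hx0
    obtain ⟨Q, hQ⟩ := h b
    have hnb := KF_neBot hne hx
    rw [← norm_le_zero_iff]
    refine le_of_forall_pos_le_add fun ε hε => ?_
    have h1 := (hQ.uc 0 hx ε hε).filter_mono (nhdsWithin_mono 0 (sdiff_subset (t := {(0 : ℂ)})))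
    obtain ⟨y, hy1, hy2⟩ := (h1.and self_mem_nhdsWithin).exists
    have := hy1 a ha
    rw [hz y hy2.1 hy2.2, zero_sub, norm_neg] at this
    linarith
  · exact hz x hx hx0

theorem sph_of_memC (hne : (AMR τ M).Nonempty) {g g' : ℂ → ℂ × ℂ → ℂ}
    (h : MemC τ M r ρ u g g') (c : ℂ) :
    Sph τ M r ρ (fun q a => u q a - c) (CNorm τ M r ρ (fun q a => u q a - c) g g') := by
  obtain ⟨⟨hp, hp'⟩, ⟨hb, hb'⟩, hv⟩ := h
  have hval : ∀ q ∈ KM τ M, Val r ρ (u q) := fun q hq =>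
    ⟨fun pt _ => (hv q hq).1 pt.1 pt.2, (hv q hq).2⟩
  have key : ∀ (f g : ℂ → ℂ × ℂ → ℂ), FPair (KF τ M) (SD r ρ) f g → FBdd (KF τ M) (SD r ρ) f g →
      (∀ q ∈ KF τ M, Val r ρ (f q)) →
      ∃ Q, CH (KF τ M) r ρ (fun q a => f q a - c) Q
        (fNorm (KF τ M) (SD r ρ) (fun q a => f q a - c) g) := by
    rintro f g ⟨p1, p2, p3⟩ ⟨⟨C, hC⟩, b2, b3⟩ hval
    have ho : omegaF (fun q a => f q a - c) g = omegaF f g := by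
      funext p a; simp only [omegaF, sub_sub_sub_cancel_right]
    refine exists_CH (fun x hx => KF_neBot hne hx) ⟨?_, p2, by rwa [ho]⟩
      ⟨⟨C + ‖c‖, ?_⟩, b2, by rwa [ho]⟩ fun q hq => ?_
    · simpa only [ContSup, sub_sub_sub_cancel_right] using p1
    · rintro _ ⟨q, hq, a, ha, rfl⟩
      exact (norm_sub_le _ _).trans (add_le_add (hC ⟨q, hq, a, ha, rfl⟩) le_rfl)
    · simpa only [sub_eq_add_neg] using (hval q hq).add (Val.const (-c))
  rw [infPart_KM] at hp' hb'
  have h1 := key _ _ hp hb fun q hq => hval _ hq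
  have h2 := key _ _ hp' hb' fun q hq => hval _ ((chart_mem false).2 hq)
  rintro (_ | _)
  · obtain ⟨Q, hQ⟩ := h2
    refine ⟨Q, hQ.mono le_rfl ?_⟩
    unfold CNorm sNorm
    rw [infPart_KM]
    exact le_max_right _ _
  · obtain ⟨Q, hQ⟩ := h1
    exact ⟨Q, hQ.mono le_rfl (le_max_left _ _)⟩

theorem Sph.exists_memC (h : Sph τ M r ρ u N) (hN : 0 ≤ N)
    (hper : ∀ q θ ε, u q (θ + 1, ε) = u q (θ, ε)) :
    ∃ g g', MemC τ M r ρ u g g' ∧ CNorm τ M r ρ u g g' ≤ 5 * N := by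
  obtain ⟨Q, hQ⟩ := h true
  obtain ⟨R, hR⟩ := h false
  refine ⟨fun q => Q (q, q), fun q => R (q, q), ⟨⟨hQ.fPair, ?_⟩, ⟨hQ.fBdd, ?_⟩, fun q hq =>
    ⟨hper q, (h.val hq).hol⟩⟩, max_le (hQ.fNorm_le hN) ?_⟩
  · rw [infPart_KM]; exact hR.fPair
  · rw [infPart_KM]; exact hR.fBdd
  · rw [infPart_KM]; exact hR.fNorm_le hN

/-- The operator multiplying the `k`-th Fourier coefficient by `m k`, extended by zero outside of
`|ε| < ρ`. -/
def fmul (ρ : ℝ) (m : ℤ → OnePoint ℂ → ℂ) (u : OnePoint ℂ → ℂ × ℂ → ℂ) (q : OnePoint ℂ)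
    (a : ℂ × ℂ) : ℂ :=
  open Classical in
  if a.2 ∈ ball (0 : ℂ) ρ then ∑' k, m k q * fcoef (fun z => u q (z, a.2)) k * ek k a.1 else 0

theorem fmul_add_one (m : ℤ → OnePoint ℂ → ℂ) (q : OnePoint ℂ) (θ ε : ℂ) :
    fmul ρ m u q (θ + 1, ε) = fmul ρ m u q (θ, ε) := by
  simp only [fmul, ek_add, ek_one, mul_one]

theorem fmul_of_notMem (m : ℤ → OnePoint ℂ → ℂ) (q : OnePoint ℂ) (θ : ℂ) {ε : ℂ}
    (hε : ε ∉ ball (0 : ℂ) ρ) : fmul ρ m u q (θ, ε) = 0 := if_neg hε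

variable {m : ℤ → OnePoint ℂ → ℂ} {D : ℤ → ℝ}

theorem Sph.fmul (hr : 0 < r) (h : Sph τ M r ρ u N) (hm : ∀ k, MultBd τ M (m k) (D k))
    (hD : Summable fun k : ℤ => D k * Real.exp (-(2 * Real.pi * |(k : ℝ)| * (r - r')))) :
    Sph τ M r' ρ (fmul ρ m u)
      (4 * N * ∑' k : ℤ, D k * Real.exp (-(2 * Real.pi * |(k : ℝ)| * (r - r')))) := fun b => by
  obtain ⟨Q, hQ⟩ := h b
  choose q h1 h2 h3 h4 using fun k => hm k b
  obtain ⟨R, hR⟩ := hQ.multiplier hr h1 h2 h3 h4 hD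
  exact ⟨R, hR.congr fun x _ a ha => if_pos ha.2⟩

theorem MultBd.norm_le {m : OnePoint ℂ → ℂ} {D : ℝ} (h : MultBd τ M m D) {q : OnePoint ℂ}
    (hq : q ∈ KM τ M) : ‖m q‖ ≤ D := by
  obtain ⟨b, x, hx, rfl⟩ := exists_chart hq
  obtain ⟨_, _, _, h3, _⟩ := h b
  exact h3 x hx

theorem norm_fmul_term_le (hr : 0 < r) (h : Sph τ M r ρ u N) (hm : ∀ k, MultBd τ M (m k) (D k))
    {q : OnePoint ℂ} (hq : q ∈ KM τ M) {θ ε : ℂ} (hθ : |θ.im| ≤ r') (hε : ε ∈ ball (0 : ℂ) ρ)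
    (k : ℤ) : ‖m k q * fcoef (fun z => u q (z, ε)) k * ek k θ‖ ≤
      N * (D k * Real.exp (-(2 * Real.pi * |(k : ℝ)| * (r - r')))) := by
  have h1 := (hm k).norm_le hq
  have h2 := (h.perHol hq hε).norm_fcoef_le hr (fun _ hθ => h.norm_le hq ⟨hθ, hε⟩) k
  have h3 := norm_ek_le k hθ
  rw [norm_mul, norm_mul]
  have hD0 := (norm_nonneg _).trans h1
  have h4 := mul_le_mul (mul_le_mul h1 h2 (norm_nonneg _) hD0) h3 (norm_nonneg _)
    (mul_nonneg hD0 ((norm_nonneg _).trans h2))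
  refine h4.trans (le_of_eq ?_)
  rw [show -(2 * Real.pi * |(k : ℝ)| * (r - r')) = -(2 * Real.pi * |(k : ℝ)| * r) +
    2 * Real.pi * |(k : ℝ)| * r' by ring, Real.exp_add]
  ring

theorem Sph.fmul_hasSum (hr : 0 < r) (h : Sph τ M r ρ u N) (hm : ∀ k, MultBd τ M (m k) (D k))
    (hD : Summable fun k : ℤ => D k * Real.exp (-(2 * Real.pi * |(k : ℝ)| * (r - r'))))
    {q : OnePoint ℂ} (hq : q ∈ KM τ M) {θ ε : ℂ} (hθ : θ ∈ Strip r') (hε : ε ∈ ball (0 : ℂ) ρ) :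
    HasSum (fun k => m k q * fcoef (fun z => u q (z, ε)) k * ek k θ) (_root_.fmul ρ m u q (θ, ε)) := by
  rw [_root_.fmul, if_pos hε]
  exact (Summable.of_norm_bounded (hD.mul_left N)
    (norm_fmul_term_le hr h hm hq (le_of_lt hθ) hε)).hasSum

theorem Sph.fcoef_fmul (hr : 0 < r) (hr' : 0 < r') (h : Sph τ M r ρ u N)
    (hm : ∀ k, MultBd τ M (m k) (D k))
    (hD : Summable fun k : ℤ => D k * Real.exp (-(2 * Real.pi * |(k : ℝ)| * (r - r'))))
    {q : OnePoint ℂ} (hq : q ∈ KM τ M) {ε : ℂ} (hε : ε ∈ ball (0 : ℂ) ρ) (k : ℤ) :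
    fcoef (fun z => _root_.fmul ρ m u q (z, ε)) k = m k q * fcoef (fun z => u q (z, ε)) k := by
  refine fcoef_of_hasSum (c := fun k => m k q * fcoef (fun z => u q (z, ε)) k) ?_
    (fun t => h.fmul_hasSum hr hm hD hq (ofReal_mem_Strip hr' t) hε) k
  refine Summable.of_nonneg_of_le (fun _ => norm_nonneg _) (fun k => ?_) (hD.mul_left N)
  have := norm_fmul_term_le (r' := r') (θ := 0) hr h hm hq (by simpa using hr'.le) hε k
  simpa only [ek_zero, mul_one] using this

theorem Sph.dth_fmul (hr : 0 < r) (h : Sph τ M r ρ u N) (hm : ∀ k, MultBd τ M (m k) (D k))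
    (hD : Summable fun k : ℤ => D k * Real.exp (-(2 * Real.pi * |(k : ℝ)| * (r - r'))))
    {q : OnePoint ℂ} (hq : q ∈ KM τ M) {a : ℂ × ℂ} (ha : a ∈ SD r' ρ) :
    dth (_root_.fmul ρ m u) q a =
      _root_.fmul ρ (fun k q => 2 * Real.pi * I * k * m k q) u q a := by
  have hε := ha.2
  have h1 := Complex.hasSum_deriv_of_summable_norm (hD.mul_left N)
    (F := fun k θ => m k q * fcoef (fun z => u q (z, a.2)) k * ek k θ) (U := Strip r')
    (fun k => ((differentiable_ek k).const_mul _).differentiableOn) (isOpen_Strip r')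
    (fun k θ hθ => norm_fmul_term_le hr h hm hq (le_of_lt hθ) hε k) ha.1
  simp only [dth, _root_.fmul, if_pos hε]
  rw [← h1.tsum_eq]
  refine tsum_congr fun k => ?_
  rw [deriv_const_mul _ (differentiable_ek k _)]
  have : deriv (ek k) a.1 = 2 * Real.pi * I * k * ek k a.1 := by
    have h2 : HasDerivAt (fun z : ℂ => 2 * Real.pi * I * k * z) (2 * Real.pi * I * k) a.1 := by
      simpa using (hasDerivAt_id a.1).const_mul (2 * Real.pi * I * k : ℂ)
    rw [show 2 * Real.pi * I * k * ek k a.1 =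
      cexp (2 * Real.pi * I * k * a.1) * (2 * Real.pi * I * k) by rw [ek]; ring]
    exact h2.cexp.deriv
  rw [this]
  ring

theorem dth_add_one (hper : ∀ q θ ε, u q (θ + 1, ε) = u q (θ, ε)) (q : OnePoint ℂ) (θ ε : ℂ) :
    dth u q (θ + 1, ε) = dth u q (θ, ε) := by
  have := deriv_comp_add_const (fun t => u q (t, ε)) 1 θ
  simp only [hper] at this
  exact this.symm

theorem dth_fmul_of_notMem (q : OnePoint ℂ) (θ : ℂ) {ε : ℂ} (hε : ε ∉ ball (0 : ℂ) ρ) :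
    dth (_root_.fmul ρ m u) q (θ, ε) = 0 := by
  simp only [dth, fmul_of_notMem m q _ hε, deriv_const]

end

/-- `up` is the translate `u⁺`, in terms of Fourier coefficients. -/
def ShiftOn (τ M ρ : ℝ) (u up : OnePoint ℂ → ℂ × ℂ → ℂ) : Prop :=
  ∀ q ∈ KF τ M, q ≠ 0 → ∀ ε ∈ ball (0 : ℂ) ρ,
    IsShift q (fun z => u (q : OnePoint ℂ) (z, ε)) fun z => up (q : OnePoint ℂ) (z, ε)

theorem isShift_neg_iff {q : ℂ} (h0 : q ≠ 0) {v vm : ℂ → ℂ} :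
    (∀ k, fcoef vm k = q ^ (-k) * fcoef v k) ↔ IsShift q vm v := by
  have h1 : ∀ k : ℤ, q ^ k * q ^ (-k) = 1 := fun k => by
    rw [← zpow_add₀ h0, add_neg_cancel, zpow_zero]
  constructor
  · intro h k
    rw [h k, ← mul_assoc, h1, one_mul]
  · intro h k
    rw [h k, ← mul_assoc, mul_comm (q ^ (-k)), h1, one_mul]

theorem fcoef_of_hasSum_strip {r : ℝ} (hr : 0 < r) {v : ℂ → ℂ} {c : ℤ → ℂ}
    (h : ∀ θ ∈ Strip r, HasSum (fun k => c k * ek k θ) (v θ)) (k : ℤ) : fcoef v k = c k := by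
  refine fcoef_of_hasSum ?_ (fun t => h t (ofReal_mem_Strip hr t)) k
  have h0 : (0 : ℂ) ∈ Strip r := by simpa using ofReal_mem_Strip hr 0
  have := (h 0 h0).summable.norm
  simpa only [ek_zero, mul_one] using this

section
variable {τ M r r' ρ N N' : ℝ} {u v up vp : OnePoint ℂ → ℂ × ℂ → ℂ}

theorem IsPlus.shiftOn (hr : 0 < r) (h : IsPlus τ M r ρ u up) : ShiftOn τ M ρ u up :=
  fun q hq h0 ε hε k => fcoef_of_hasSum_strip hr (fun θ hθ => h q hq h0 θ hθ ε hε) k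

theorem IsMinus.shiftOn (hr : 0 < r) (h : IsMinus τ M r ρ u up) : ShiftOn τ M ρ up u :=
  fun q hq h0 ε hε => (isShift_neg_iff h0).1 fun k =>
    fcoef_of_hasSum_strip hr (fun θ hθ => h q hq h0 θ hθ ε hε) k

theorem ShiftOn.isPlus (h : ShiftOn τ M ρ u up) (hup : Sph τ M r ρ up N) : IsPlus τ M r ρ u up :=
  fun q hq h0 θ hθ ε hε => by
    have := hup.hasSum (a := (θ, ε)) hq ⟨hθ, hε⟩
    exact this.congr_fun fun k => by rw [h q hq h0 ε hε k]; rfl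

theorem ShiftOn.isMinus (h : ShiftOn τ M ρ up u) (hup : Sph τ M r ρ up N) :
    IsMinus τ M r ρ u up := fun q hq h0 θ hθ ε hε => by
    have := hup.hasSum (a := (θ, ε)) hq ⟨hθ, hε⟩
    exact this.congr_fun fun k => by rw [(isShift_neg_iff h0).2 (h q hq h0 ε hε) k]; rfl

/-- A version of `ShiftOn` with explicit interpolations. -/
def HullOn (τ M ρ : ℝ) (u up : OnePoint ℂ → ℂ × ℂ → ℂ) : Prop :=
  ∀ ω ∈ AMC τ M, ∀ ε ∈ ball (0 : ℂ) ρ,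
    ∃ Φ, Hull ω (fun z => u (Efn ω : OnePoint ℂ) (z, ε)) (fun z => up (Efn ω : OnePoint ℂ) (z, ε)) Φ

theorem HullOn.shiftOn (h : HullOn τ M ρ u up) : ShiftOn τ M ρ u up := fun q hq h0 ε hε => by
  obtain h1 | ⟨ω, hω, rfl⟩ := mem_KF.1 hq
  · exact absurd h1 h0
  · obtain ⟨Φ, hΦ⟩ := h ω hω ε hε
    exact hΦ.isShift

theorem ShiftOn.hullOn (hr : 0 < r) (h : ShiftOn τ M ρ u up) (hu : Sph τ M r ρ u N)
    (hup : Sph τ M r ρ up N') : HullOn τ M ρ u up := fun ω hω ε hε => by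
  have hq : Efn ω ∈ KF τ M := mem_KF.2 (Or.inr ⟨ω, hω, rfl⟩)
  exact exists_hull hr (hu.perHol hq hε) (hup.perHol hq hε) (N := max N N')
    (fun θ hθ => (hu.norm_le hq ⟨hθ, hε⟩).trans (le_max_left _ _))
    (fun θ hθ => (hup.norm_le hq ⟨hθ, hε⟩).trans (le_max_right _ _))
    (h _ hq (Efn_ne_zero ω) ε hε)

theorem HullOn.mul (h : HullOn τ M ρ u up) (h' : HullOn τ M ρ v vp) :
    HullOn τ M ρ (fun q a => u q a * v q a) fun q a => up q a * vp q a := fun ω hω ε hε => by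
  obtain ⟨Φ, hΦ⟩ := h ω hω ε hε
  obtain ⟨Ψ, hΨ⟩ := h' ω hω ε hε
  exact ⟨_, hΦ.mul hΨ⟩

theorem HullOn.inv (hr : 0 < r) (h : HullOn τ M ρ u up)
    (hu : ∀ q ∈ KM τ M, ∀ a ∈ SD r ρ, ‖u q a - 1‖ ≤ 1 / 6)
    (hup : ∀ q ∈ KM τ M, ∀ a ∈ SD r ρ, ‖up q a - 1‖ ≤ 1 / 6) :
    HullOn τ M ρ (fun q a => (u q a)⁻¹) fun q a => (up q a)⁻¹ := fun ω hω ε hε => by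
  obtain ⟨Φ, hΦ⟩ := h ω hω ε hε
  have hq : Efn ω ∈ KF τ M := mem_KF.2 (Or.inr ⟨ω, hω, rfl⟩)
  exact ⟨_, hΦ.inv (fun t => hu _ hq _ ⟨ofReal_mem_Strip hr t, hε⟩)
    fun t => hup _ hq _ ⟨ofReal_mem_Strip hr t, hε⟩⟩

/-- Real-symmetry in terms of values on the real line. -/
def RealOn (τ M ρ : ℝ) (u : OnePoint ℂ → ℂ × ℂ → ℂ) : Prop :=
  ∀ q ∈ KF τ M, q ≠ 0 → ∀ ε ∈ ball (0 : ℂ) ρ, ∀ t : ℝ,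
    starRingEnd ℂ (u (q : OnePoint ℂ) (t, starRingEnd ℂ ε)) =
      u (((starRingEnd ℂ q)⁻¹ : ℂ) : OnePoint ℂ) (t, ε)

theorem conj_mem_ball {ε : ℂ} : starRingEnd ℂ ε ∈ ball (0 : ℂ) ρ ↔ ε ∈ ball (0 : ℂ) ρ := by
  simp

theorem conj_ek (k : ℤ) (t : ℝ) : starRingEnd ℂ (ek k t) = ek (-k) t := by
  rw [ek, ek, ← Complex.exp_conj]
  simp [map_ofNat]

theorem conj_fcoef (v : ℂ → ℂ) (k : ℤ) :
    starRingEnd ℂ (fcoef v k) = fcoef (fun z => starRingEnd ℂ (v z)) (-k) := by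
  rw [fcoef_eq, fcoef_eq, ← intervalIntegral.intervalIntegral_conj]
  simp only [map_mul, conj_ek]

theorem RealOn.conj_fcoef (h : RealOn τ M ρ u) {q : ℂ} (hq : q ∈ KF τ M) (h0 : q ≠ 0) {ε : ℂ}
    (hε : ε ∈ ball (0 : ℂ) ρ) (k : ℤ) :
    starRingEnd ℂ (fcoef (fun z => u (q : OnePoint ℂ) (z, starRingEnd ℂ ε)) k) =
      fcoef (fun z => u (((starRingEnd ℂ q)⁻¹ : ℂ) : OnePoint ℂ) (z, ε)) (-k) := by
  rw [_root_.conj_fcoef]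
  exact fcoef_congr (fun t => h q hq h0 ε hε t) _

theorem realOn_of_fcoef (hr : 0 < r) (h : Sph τ M r ρ u N)
    (hc : ∀ q ∈ KF τ M, q ≠ 0 → ∀ ε ∈ ball (0 : ℂ) ρ, ∀ k,
      starRingEnd ℂ (fcoef (fun z => u (q : OnePoint ℂ) (z, starRingEnd ℂ ε)) k) =
      fcoef (fun z => u (((starRingEnd ℂ q)⁻¹ : ℂ) : OnePoint ℂ) (z, ε)) (-k)) :
    RealOn τ M ρ u := fun q hq h0 ε hε t => by
  have h1 := (Complex.hasSum_conj'.2 (h.hasSum hq (a := ((t : ℂ), starRingEnd ℂ ε))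
    ⟨ofReal_mem_Strip hr t, conj_mem_ball.2 hε⟩))
  have h2 := h.hasSum (q := (((starRingEnd ℂ q)⁻¹ : ℂ) : OnePoint ℂ)) (conj_inv_mem_KF hq)
    (a := ((t : ℂ), ε)) ⟨ofReal_mem_Strip hr t, hε⟩
  rw [← (Equiv.neg ℤ).hasSum_iff] at h2
  refine h1.unique (h2.congr_fun fun k => ?_)
  simp only [map_mul, hc q hq h0 ε hε, conj_ek, Function.comp, Equiv.neg_apply]

theorem RealSym.realOn (hr : 0 < r) (hu : Sph τ M r ρ u N) (h : RealSym τ M u) :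
    RealOn τ M ρ u := realOn_of_fcoef hr hu fun q hq h0 ε _ k => h k q hq h0 ε

theorem RealOn.realSym (h : RealOn τ M ρ u)
    (h0 : ∀ q θ ε, ε ∉ ball (0 : ℂ) ρ → u q (θ, ε) = 0) : RealSym τ M u := fun k q hq hq0 ε => by
  by_cases hε : ε ∈ ball (0 : ℂ) ρ
  · exact h.conj_fcoef hq hq0 hε k
  · simp only [fhat, h0 _ _ _ hε, h0 _ _ _ (mt conj_mem_ball.1 hε), zero_mul,
      intervalIntegral.integral_zero, map_zero]

theorem RealOn.mul (h : RealOn τ M ρ u) (h' : RealOn τ M ρ v) :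
    RealOn τ M ρ fun q a => u q a * v q a := fun q hq h0 ε hε t => by
  rw [map_mul, h q hq h0 ε hε, h' q hq h0 ε hε]

theorem RealOn.add (h : RealOn τ M ρ u) (h' : RealOn τ M ρ v) :
    RealOn τ M ρ fun q a => u q a + v q a := fun q hq h0 ε hε t => by
  rw [map_add, h q hq h0 ε hε, h' q hq h0 ε hε]

theorem RealOn.neg (h : RealOn τ M ρ u) : RealOn τ M ρ fun q a => -u q a :=
  fun q hq h0 ε hε t => by rw [map_neg, h q hq h0 ε hε]

theorem RealOn.inv (h : RealOn τ M ρ u) : RealOn τ M ρ fun q a => (u q a)⁻¹ :=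
  fun q hq h0 ε hε t => by rw [map_inv₀, h q hq h0 ε hε]

theorem RealOn.mean (h : RealOn τ M ρ u) :
    RealOn τ M ρ fun q a => fcoef (fun z => u q (z, a.2)) 0 :=
  fun q hq h0 ε hε t => by simpa using h.conj_fcoef hq h0 hε 0

theorem ShiftOn.realOn (hr : 0 < r) (h : ShiftOn τ M ρ u up) (hup : Sph τ M r ρ up N)
    (hu : RealOn τ M ρ u) : RealOn τ M ρ up := realOn_of_fcoef hr hup fun q hq h0 ε hε k => by
  rw [h q hq h0 _ (conj_mem_ball.2 hε), map_mul, hu.conj_fcoef hq h0 hε,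
    h _ (conj_inv_mem_KF hq) (inv_ne_zero ((map_ne_zero _).2 h0)) ε hε, map_zpow₀, inv_zpow',
    neg_neg]

/-- Multipliers preserving real-symmetry. -/
def RealMult (τ M : ℝ) (m : ℤ → OnePoint ℂ → ℂ) : Prop :=
  ∀ q ∈ KF τ M, q ≠ 0 → ∀ k,
    starRingEnd ℂ (m k (q : OnePoint ℂ)) = m (-k) (((starRingEnd ℂ q)⁻¹ : ℂ) : OnePoint ℂ)

theorem realMult_lam (hτ : 0 < τ) (hM : 1 ≤ M) : RealMult τ M lam :=
  fun _ hq h0 k => lam_conj hτ hM hq h0 k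

theorem realMult_lamPlus (hτ : 0 < τ) (hM : 1 ≤ M) : RealMult τ M lamPlus := fun q hq h0 k => by
  by_cases hk : k = 0
  · simp [lamPlus, hk]
  · simp [lamPlus, hk, lam_conj hτ hM hq h0 k]

theorem RealMult.deriv {m : ℤ → OnePoint ℂ → ℂ} (h : RealMult τ M m) :
    RealMult τ M fun k q => 2 * Real.pi * I * k * m k q := fun q hq h0 k => by
  simp [h q hq h0 k, map_ofNat]

variable {m : ℤ → OnePoint ℂ → ℂ} {D : ℤ → ℝ}

theorem RealOn.fmul (hr : 0 < r) (hr' : 0 < r') (hR : RealOn τ M ρ u) (h : Sph τ M r ρ u N)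
    (hm : ∀ k, MultBd τ M (m k) (D k))
    (hD : Summable fun k : ℤ => D k * Real.exp (-(2 * Real.pi * |(k : ℝ)| * (r - r'))))
    (hmR : RealMult τ M m) : RealOn τ M ρ (fmul ρ m u) :=
  realOn_of_fcoef hr' (h.fmul hr hm hD) fun q hq h0 ε hε k => by
    rw [h.fcoef_fmul hr hr' hm hD hq (conj_mem_ball.2 hε),
      h.fcoef_fmul hr hr' hm hD (conj_inv_mem_KF hq) hε, map_mul, hmR q hq h0,
      hR.conj_fcoef hq h0 hε]

end

/-- Fourier multipliers `m` with bounds `D` which are summable after losing `d` of analyticity. -/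
structure MultSum (τ M d : ℝ) (m : ℤ → OnePoint ℂ → ℂ) (D : ℤ → ℝ) (S : ℝ) : Prop where
  bd : ∀ k, MultBd τ M (m k) (D k)
  summable : Summable fun k : ℤ => D k * Real.exp (-(2 * Real.pi * |(k : ℝ)| * d))
  le : ∑' k : ℤ, D k * Real.exp (-(2 * Real.pi * |(k : ℝ)| * d)) ≤ S

section
variable {τ M r r' ρ N N' S d : ℝ} {u v up vp : OnePoint ℂ → ℂ × ℂ → ℂ}
  {m mp : ℤ → OnePoint ℂ → ℂ} {D Dp : ℤ → ℝ}

theorem multSum_lam (hτ : 0 < τ) (hM : 1 ≤ M) (hd : 0 < d) :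
    MultSum τ M d lam (divBd τ M)
      (9 * M ^ 2 * (2 * (3 + 2 * τ) ^ (3 + 2 * τ) / d ^ (4 + 2 * τ))) ∧
    MultSum τ M d lamPlus (divBd τ M)
      (9 * M ^ 2 * (2 * (3 + 2 * τ) ^ (3 + 2 * τ) / d ^ (4 + 2 * τ))) := by
  obtain ⟨h1, h2⟩ := sum_abs_rpow_mul_exp (p := 3 + 2 * τ) (by linarith) hd
  rw [show 3 + 2 * τ + 1 = 4 + 2 * τ by ring] at h2
  have he : (fun k : ℤ => divBd τ M k * Real.exp (-(2 * Real.pi * |(k : ℝ)| * d))) = fun k : ℤ =>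
      9 * M ^ 2 * (|(k : ℝ)| ^ (3 + 2 * τ) * Real.exp (-(2 * Real.pi * |(k : ℝ)| * d))) :=
    funext fun k => by rw [divBd, mul_assoc]
  have hs : Summable fun k : ℤ => divBd τ M k * Real.exp (-(2 * Real.pi * |(k : ℝ)| * d)) := by
    rw [he]; exact h1.mul_left _
  have hle : ∑' k : ℤ, divBd τ M k * Real.exp (-(2 * Real.pi * |(k : ℝ)| * d)) ≤
      9 * M ^ 2 * (2 * (3 + 2 * τ) ^ (3 + 2 * τ) / d ^ (4 + 2 * τ)) := by
    rw [he, tsum_mul_left]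
    exact mul_le_mul_of_nonneg_left h2 (by positivity)
  exact ⟨⟨multBd_lam hτ hM, hs, hle⟩, ⟨multBd_lamPlus hτ hM, hs, hle⟩⟩

theorem multSum_deriv (hτ : 0 < τ) (hd : 0 < d) (h : ∀ k, MultBd τ M (m k) (divBd τ M k)) :
    MultSum τ M d (fun k q => 2 * Real.pi * I * k * m k q)
      (fun k => ‖(2 * Real.pi * I * k : ℂ)‖ * divBd τ M k)
      (18 * Real.pi * M ^ 2 * (2 * (4 + 2 * τ) ^ (4 + 2 * τ) / d ^ (4 + 2 * τ + 1))) := by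
  obtain ⟨h1, h2⟩ := sum_abs_rpow_mul_exp (p := 4 + 2 * τ) (by linarith) hd
  have he : ∀ k : ℤ, ‖(2 * Real.pi * I * k : ℂ)‖ * divBd τ M k *
      Real.exp (-(2 * Real.pi * |(k : ℝ)| * d)) = 18 * Real.pi * M ^ 2 *
        (|(k : ℝ)| ^ (4 + 2 * τ) * Real.exp (-(2 * Real.pi * |(k : ℝ)| * d))) := fun k => by
    have : |(k : ℝ)| ^ (4 + 2 * τ) = |(k : ℝ)| ^ (3 + 2 * τ) * |(k : ℝ)| := by
      rw [← Real.rpow_add_one' (abs_nonneg _) (by linarith)]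
      congr 1; ring
    rw [divBd, this]
    have hn : ‖(2 * Real.pi * I * k : ℂ)‖ = 2 * Real.pi * |(k : ℝ)| := by
      simp [abs_of_pos Real.pi_pos, Complex.norm_intCast]
    rw [hn]
    ring
  refine ⟨fun k => (h k).const_mul _, ?_, ?_⟩
  · simpa only [he] using h1.mul_left (18 * Real.pi * M ^ 2)
  · rw [tsum_congr he, tsum_mul_left]
    exact mul_le_mul_of_nonneg_left h2 (by positivity)

theorem Sph.fmul' (hr : 0 < r) (h : Sph τ M r ρ u N) (hN : 0 ≤ N)
    (hm : MultSum τ M (r - r') m D S) : Sph τ M r' ρ (_root_.fmul ρ m u) (4 * N * S) :=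
  (h.fmul hr hm.bd hm.summable).mono le_rfl
    (mul_le_mul_of_nonneg_left hm.le (by positivity))

theorem shiftOn_fmul (hr : 0 < r) (hr' : 0 < r') (h : Sph τ M r ρ u N)
    (hm : MultSum τ M (r - r') m D S) (hmp : MultSum τ M (r - r') mp Dp S)
    (hmm : ∀ x ∈ KF τ M, x ≠ 0 → ∀ k,
      mp k (x : OnePoint ℂ) = x ^ k * m k (x : OnePoint ℂ)) :
    ShiftOn τ M ρ (fmul ρ m u) (fmul ρ mp u) := fun q hq h0 ε hε k => by
  rw [h.fcoef_fmul hr hr' hm.bd hm.summable hq hε, h.fcoef_fmul hr hr' hmp.bd hmp.summable hq hε,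
    hmm q hq h0, mul_assoc]

theorem shiftOn_fmul_fmul (hr : 0 < r) (hr' : 0 < r') (h : Sph τ M r ρ u N)
    (hp : Sph τ M r ρ up N') (hs : ShiftOn τ M ρ u up) (hm : MultSum τ M (r - r') m D S) :
    ShiftOn τ M ρ (fmul ρ m u) (fmul ρ m up) := fun q hq h0 ε hε k => by
  rw [h.fcoef_fmul hr hr' hm.bd hm.summable hq hε, hp.fcoef_fmul hr hr' hm.bd hm.summable hq hε,
    hs q hq h0 ε hε]
  ring

theorem PerHol.const (r : ℝ) (c : ℂ) : PerHol r fun _ => c :=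
  ⟨fun _ _ => rfl, differentiableOn_const c⟩

theorem isShift_const (ω : ℂ) (c : ℂ) : IsShift (Efn ω) (fun _ => c) fun _ => c := fun k => by
  have := (PerHol.const (|ω.im| + 1) c).fcoef_add (lt_add_one _) k
  rwa [← Efn_zpow] at this

theorem ShiftOn.sub (hr : 0 < r) (hu : Sph τ M r ρ u N) (hup : Sph τ M r ρ up N)
    (h : ShiftOn τ M ρ u up) {v : OnePoint ℂ → ℂ × ℂ → ℂ} {Nv Nvp : ℝ} (hv : Sph τ M r ρ v Nv)
    (hvp : Sph τ M r ρ vp Nvp) (h' : ShiftOn τ M ρ v vp) :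
    ShiftOn τ M ρ (fun q a => u q a - v q a) fun q a => up q a - vp q a :=
  fun q hq h0 ε hε k => by
    rw [fcoef_sub hr (hu.perHol hq hε) (hv.perHol hq hε),
      fcoef_sub hr (hup.perHol hq hε) (hvp.perHol hq hε), h q hq h0 ε hε, h' q hq h0 ε hε, mul_sub]

theorem shiftOn_of_const {c : OnePoint ℂ → ℂ → ℂ} :
    ShiftOn τ M ρ (fun q a => c q a.2) fun q a => c q a.2 := fun q hq h0 ε _ => by
  obtain h1 | ⟨ω, _, rfl⟩ := mem_KF.1 hq
  · exact absurd h1 h0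
  · exact isShift_const ω (c (Efn ω) _)

/-- `A ∈ C^±_r` close to `1`. -/
structure NearOne (τ M r ρ : ℝ) (A Ap Am : OnePoint ℂ → ℂ × ℂ → ℂ) : Prop where
  sph : Sph τ M r ρ A (7 / 6)
  sphp : Sph τ M r ρ Ap (7 / 6)
  sphm : Sph τ M r ρ Am (7 / 6)
  near : ∀ q ∈ KM τ M, ∀ a ∈ SD r ρ, ‖A q a - 1‖ ≤ 1 / 6
  nearp : ∀ q ∈ KM τ M, ∀ a ∈ SD r ρ, ‖Ap q a - 1‖ ≤ 1 / 6
  nearm : ∀ q ∈ KM τ M, ∀ a ∈ SD r ρ, ‖Am q a - 1‖ ≤ 1 / 6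
  shiftp : ShiftOn τ M ρ A Ap
  shiftm : ShiftOn τ M ρ Am A

theorem norm_ge_of_near {z : ℂ} (h : ‖z - 1‖ ≤ 1 / 6) : 5 / 6 ≤ ‖z‖ := by
  have h2 := norm_sub_norm_le 1 z
  rw [norm_sub_rev, norm_one] at h2
  linarith

theorem norm_inv_mul_inv_sub_one_le {x y : ℂ} (hx : ‖x - 1‖ ≤ 1 / 6) (hy : ‖y - 1‖ ≤ 1 / 6) :
    ‖x⁻¹ * y⁻¹ - 1‖ ≤ 11 / 25 := by
  have key : ∀ z : ℂ, ‖z - 1‖ ≤ 1 / 6 → ‖z⁻¹‖ ≤ 6 / 5 ∧ ‖z⁻¹ - 1‖ ≤ 1 / 5 := fun z hz => by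
    have h1 := norm_ge_of_near hz
    have h0 : z ≠ 0 := norm_pos_iff.1 (by linarith)
    have h2 : ‖z⁻¹‖ ≤ 6 / 5 := by
      rw [norm_inv]
      exact inv_le_of_inv_le₀ (by norm_num) (by norm_num; linarith)
    refine ⟨h2, ?_⟩
    have : z⁻¹ - 1 = -((z - 1) * z⁻¹) := by field_simp; ring
    rw [this, norm_neg, norm_mul]
    nlinarith [norm_nonneg (z - 1), norm_nonneg z⁻¹]
  obtain ⟨a1, a2⟩ := key x hx
  obtain ⟨b1, b2⟩ := key y hy
  have : x⁻¹ * y⁻¹ - 1 = (x⁻¹ - 1) * y⁻¹ + (y⁻¹ - 1) := by ring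
  rw [this]
  refine (norm_add_le _ _).trans ?_
  rw [norm_mul]
  nlinarith [norm_nonneg (x⁻¹ - 1), norm_nonneg y⁻¹]

theorem norm_fcoef_zero_ge {v : ℂ → ℂ} (hr : 0 < r) (hv : PerHol r v)
    (h : ∀ t : ℝ, ‖v t - 1‖ ≤ 11 / 25) : 1 / 4 ≤ ‖fcoef v 0‖ := by
  have h1 := norm_fcoef_le (v := fun z => v z - 1) h 0
  rw [fcoef_sub hr hv (PerHol.const r 1)] at h1
  have h2 : fcoef (fun _ => (1 : ℂ)) 0 = 1 := by simp [fcoef]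
  rw [h2] at h1
  have h3 := norm_sub_norm_le 1 (fcoef v 0)
  rw [norm_sub_rev, norm_one] at h3
  linarith

namespace NearOne
variable {A Ap Am : OnePoint ℂ → ℂ × ℂ → ℂ}

theorem mono (h : NearOne τ M r ρ A Ap Am) (hr : r' ≤ r) : NearOne τ M r' ρ A Ap Am :=
  ⟨h.sph.mono hr le_rfl, h.sphp.mono hr le_rfl, h.sphm.mono hr le_rfl,
    fun q hq a ha => h.near q hq a (SD_mono hr ha), fun q hq a ha => h.nearp q hq a (SD_mono hr ha),
    fun q hq a ha => h.nearm q hq a (SD_mono hr ha), h.shiftp, h.shiftm⟩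

theorem ne_zero (h : NearOne τ M r ρ A Ap Am) {q : OnePoint ℂ} (hq : q ∈ KM τ M) {a : ℂ × ℂ}
    (ha : a ∈ SD r ρ) : A q a ≠ 0 ∧ Ap q a ≠ 0 ∧ Am q a ≠ 0 := by
  refine ⟨?_, ?_, ?_⟩ <;> rw [← norm_pos_iff]
  · linarith [norm_ge_of_near (h.near q hq a ha)]
  · linarith [norm_ge_of_near (h.nearp q hq a ha)]
  · linarith [norm_ge_of_near (h.nearm q hq a ha)]

theorem sph_inv (h : NearOne τ M r ρ A Ap Am) :
    Sph τ M r ρ (fun q a => (A q a)⁻¹ * (Ap q a)⁻¹) 1058 ∧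
      Sph τ M r ρ (fun q a => (Am q a)⁻¹ * (A q a)⁻¹) 1058 := by
  have h1 := (h.sph.inv fun q hq a ha => by
    linarith [norm_ge_of_near (h.near q hq a ha)]).mono le_rfl
    (show 16 * (7 / 6) + 4 ≤ (23 : ℝ) by norm_num)
  have h2 := (h.sphp.inv fun q hq a ha => by
    linarith [norm_ge_of_near (h.nearp q hq a ha)]).mono le_rfl
    (show 16 * (7 / 6) + 4 ≤ (23 : ℝ) by norm_num)
  have h3 := (h.sphm.inv fun q hq a ha => by
    linarith [norm_ge_of_near (h.nearm q hq a ha)]).mono le_rfl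
    (show 16 * (7 / 6) + 4 ≤ (23 : ℝ) by norm_num)
  exact ⟨(h1.mul h2).mono le_rfl (by norm_num), (h3.mul h1).mono le_rfl (by norm_num)⟩

theorem hullOn_inv (hr : 0 < r) (h : NearOne τ M r ρ A Ap Am) :
    HullOn τ M ρ (fun q a => (Am q a)⁻¹ * (A q a)⁻¹) fun q a => (A q a)⁻¹ * (Ap q a)⁻¹ :=
  ((h.shiftm.hullOn hr h.sphm h.sph).inv hr h.nearm h.near).mul
    ((h.shiftp.hullOn hr h.sph h.sphp).inv hr h.near h.nearp)

theorem hullOn_mul (hr : 0 < r) (h : NearOne τ M r ρ A Ap Am) :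
    HullOn τ M ρ (fun q a => Am q a * A q a) fun q a => A q a * Ap q a :=
  (h.shiftm.hullOn hr h.sphm h.sph).mul (h.shiftp.hullOn hr h.sph h.sphp)

theorem mean_inv_ge (hr : 0 < r) (h : NearOne τ M r ρ A Ap Am) {q : OnePoint ℂ}
    (hq : q ∈ KM τ M) {ε : ℂ} (hε : ε ∈ ball (0 : ℂ) ρ) :
    1 / 4 ≤ ‖fcoef (fun z => (A q (z, ε))⁻¹ * (Ap q (z, ε))⁻¹) 0‖ :=
  norm_fcoef_zero_ge hr (h.sph_inv.1.perHol hq hε) fun t =>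
    norm_inv_mul_inv_sub_one_le (h.near q hq _ ⟨ofReal_mem_Strip hr t, hε⟩)
      (h.nearp q hq _ ⟨ofReal_mem_Strip hr t, hε⟩)

end NearOne

end

section
variable {τ M r r' ρ N N' S d : ℝ} {A Ap Am E : OnePoint ℂ → ℂ × ℂ → ℂ}

theorem hasSum_sub_zero {v : ℂ → ℂ} (θ : ℂ) (h : HasSum (fun k => fcoef v k * ek k θ) (v θ)) :
    HasSum (fun k => if k = 0 then 0 else fcoef v k * ek k θ) (v θ - fcoef v 0) := by
  have h1 := h.sub (hasSum_ite_eq (0 : ℤ) (fcoef v 0))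
  refine h1.congr_fun fun k => ?_
  by_cases hk : k = 0
  · simp [hk, ek_zero_left]
  · simp [hk]

/-- `(∇⁻)⁻¹` and `∇⁻¹` differ by the identity, up to the mean value. -/
theorem fmul_lamPlus_sub_fmul_lam (hτ : 0 < τ) (hM : 1 ≤ M) (hr : 0 < r) (hr' : r' ≤ r)
    {u : OnePoint ℂ → ℂ × ℂ → ℂ} (h : Sph τ M r ρ u N) {D Dp : ℤ → ℝ}
    (hm : MultSum τ M (r - r') lam D S)
    (hp : MultSum τ M (r - r') lamPlus Dp S) {q : ℂ} (hq : q ∈ KF τ M) (h0 : q ≠ 0) {a : ℂ × ℂ}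
    (ha : a ∈ SD r' ρ) : fmul ρ lamPlus u q a - fmul ρ lam u q a =
      u q a - fcoef (fun z => u q (z, a.2)) 0 := by
  obtain ⟨θ, ε⟩ := a
  have h1 := (h.fmul_hasSum hr hp.bd hp.summable hq ha.1 ha.2).sub
    (h.fmul_hasSum hr hm.bd hm.summable hq ha.1 ha.2)
  have h4 : HasSum (fun k => fcoef (fun z => u q (z, ε)) k * ek k θ) (u q (θ, ε)) :=
    h.hasSum (a := (θ, ε)) hq (SD_mono hr' ha)
  have h2 := hasSum_sub_zero (v := fun z => u q (z, ε)) θ h4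
  have h3 : ∀ k : ℤ, lamPlus k q * fcoef (fun z => u q (z, ε)) k * ek k θ -
      lam k q * fcoef (fun z => u q (z, ε)) k * ek k θ =
      if k = 0 then 0 else fcoef (fun z => u q (z, ε)) k * ek k θ := fun k => by
    by_cases hk : k = 0
    · simp [hk, lamPlus, lam]
    · have := lam_mul_pow_sub_one hτ hM hq h0 hk
      rw [if_neg hk, lamPlus_coe hτ hM hq h0]
      linear_combination (fcoef (fun z => u q (z, ε)) k * ek k θ) * this
  simp only [h3] at h1
  exact h1.unique h2

/-- The solution `F` of `A A⁺ F - A⁻ A F⁻ = A E - ⟨A E⟩` with `⟨F⟩ = 0`. -/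
theorem exists_first_integral (hτ : 0 < τ) (hM : 1 ≤ M) (hr' : 0 < r') (hrr : r' < r)
    (hA : NearOne τ M r ρ A Ap Am) (hE : Sph τ M r ρ E N) (hN : 0 ≤ N) (hS : 0 ≤ S)
    {D Dp : ℤ → ℝ}
    (hm : MultSum τ M (r - r') lam D S) (hp : MultSum τ M (r - r') lamPlus Dp S)
    (hAR : RealOn τ M ρ A) (hER : RealOn τ M ρ E) :
    ∃ F Fm : OnePoint ℂ → ℂ × ℂ → ℂ, Sph τ M r' ρ F (2 * 10 ^ 12 * (N * S)) ∧
      Sph τ M r' ρ Fm (2 * 10 ^ 12 * (N * S)) ∧ ShiftOn τ M ρ Fm F ∧ RealOn τ M ρ F ∧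
      (∀ q ∈ KM τ M, ∀ ε ∈ ball (0 : ℂ) ρ, fcoef (fun z => F q (z, ε)) 0 = 0) ∧
      ∀ q ∈ KF τ M, q ≠ 0 → ∀ a ∈ SD r' ρ,
        A q a * Ap q a * F q a - Am q a * A q a * Fm q a =
          A q a * E q a - fcoef (fun z => A q (z, a.2) * E q (z, a.2)) 0 := by
  have hr := hr'.trans hrr
  have hNS : 0 ≤ N * S := mul_nonneg hN hS
  have hA' := hA.mono hrr.le
  have hAE : Sph τ M r ρ (fun q a => A q a * E q a) (7 / 3 * N) :=
    (hA.sph.mul hE).mono le_rfl (by linarith)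
  obtain ⟨hB, hBm⟩ := hA'.sph_inv
  set B : OnePoint ℂ → ℂ × ℂ → ℂ := fun q a => (A q a)⁻¹ * (Ap q a)⁻¹ with hBdef
  set Bm : OnePoint ℂ → ℂ × ℂ → ℂ := fun q a => (Am q a)⁻¹ * (A q a)⁻¹ with hBmdef
  set f₀ : OnePoint ℂ → ℂ × ℂ → ℂ := fmul ρ lamPlus fun q a => A q a * E q a with hf₀
  set f₁ : OnePoint ℂ → ℂ × ℂ → ℂ := fmul ρ lam fun q a => A q a * E q a with hf₁
  have h0 : Sph τ M r' ρ f₀ (10 * (N * S)) :=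
    (hAE.fmul' hr (by positivity) hp).mono le_rfl (by linarith)
  have h1 : Sph τ M r' ρ f₁ (10 * (N * S)) :=
    (hAE.fmul' hr (by positivity) hm).mono le_rfl (by linarith)
  have h01 : ShiftOn τ M ρ f₁ f₀ := shiftOn_fmul hr hr' hAE hm hp
    fun x hx hx0 k => lamPlus_coe hτ hM hx hx0 k
  set c : OnePoint ℂ → ℂ → ℂ := fun q ε => fcoef (fun z => f₀ q (z, ε) * B q (z, ε)) 0 *
    (fcoef (fun z => B q (z, ε)) 0)⁻¹ with hcdef
  have hf₀B : Sph τ M r' ρ (fun q a => f₀ q a * B q a) (21160 * (N * S)) :=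
    (h0.mul hB).mono le_rfl (by linarith)
  have hmB : ∀ q ∈ KM τ M, ∀ ε ∈ ball (0 : ℂ) ρ, 1 / 4 ≤ ‖fcoef (fun z => B q (z, ε)) 0‖ :=
    fun q hq ε hε => hA'.mean_inv_ge hr' hq hε
  have hc : Sph τ M r' ρ (fun q a => c q a.2) (720000000 * (N * S)) :=
    ((hf₀B.mean hr' r').mul ((hB.mean hr' r').inv fun q hq a ha => hmB q hq _ ha.2)).mono le_rfl
      (by linarith)
  have hf := (h0.sub hc).mono le_rfl
    (show 10 * (N * S) + 720000000 * (N * S) ≤ 800000000 * (N * S) by linarith)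
  have hfm := (h1.sub hc).mono le_rfl
    (show 10 * (N * S) + 720000000 * (N * S) ≤ 800000000 * (N * S) by linarith)
  have hff : ShiftOn τ M ρ (fun q a => f₁ q a - c q a.2) fun q a => f₀ q a - c q a.2 :=
    h01.sub hr' h1 h0 hc hc shiftOn_of_const
  refine ⟨fun q a => (f₀ q a - c q a.2) * B q a, fun q a => (f₁ q a - c q a.2) * Bm q a,
    (hf.mul hB).mono le_rfl (by linarith), (hfm.mul hBm).mono le_rfl (by linarith),
    ((hff.hullOn hr' hfm hf).mul (hA'.hullOn_inv hr')).shiftOn, ?_, ?_, ?_⟩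
  · have hBR : RealOn τ M ρ B := hAR.inv.mul (hA.shiftp.realOn hr hA.sphp hAR).inv
    have hf₀R : RealOn τ M ρ f₀ := (hAR.mul hER).fmul hr hr' hAE hp.bd hp.summable
      (realMult_lamPlus hτ hM)
    have hcR : RealOn τ M ρ fun q a => c q a.2 := (hf₀R.mul hBR).mean.mul hBR.mean.inv
    have := (hf₀R.add hcR.neg).mul hBR
    simpa only [← sub_eq_add_neg] using this
  · intro q hq ε hε
    have hne : fcoef (fun z => B q (z, ε)) 0 ≠ 0 :=
      norm_pos_iff.1 (lt_of_lt_of_le (by norm_num) (hmB q hq ε hε))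
    have e : (fun z => (f₀ q (z, ε) - c q ε) * B q (z, ε)) = fun z =>
        f₀ q (z, ε) * B q (z, ε) - c q ε * B q (z, ε) := by
      funext z; ring
    have hcB : PerHol r' fun z => c q ε * B q (z, ε) :=
      ((hc.mul hB).perHol hq hε)
    simp only [e]
    rw [fcoef_sub hr' (hf₀B.perHol hq hε) hcB, fcoef_const_mul]
    simp only [hcdef]
    rw [inv_mul_cancel_right₀ hne, sub_self]
  · intro q hq hq0 a ha
    obtain ⟨n1, n2, n3⟩ := hA'.ne_zero hq ha
    have key := fmul_lamPlus_sub_fmul_lam hτ hM hr hrr.le hAE hm hp hq hq0 ha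
    rw [← key]
    simp only [hBdef, hBmdef]
    field_simp
    ring

end

theorem fcoef_zero (v : ℂ → ℂ) : fcoef v 0 = ∫ t in (0:ℝ)..1, v t := by
  simp [fcoef]

section
variable {τ M r r' ρ N N' S d : ℝ} {u v up vp vm : OnePoint ℂ → ℂ × ℂ → ℂ}
  {A Ap Am E F Fm : OnePoint ℂ → ℂ × ℂ → ℂ} {D Dp : ℤ → ℝ} {m mp : ℤ → OnePoint ℂ → ℂ}

theorem zpow_sub_one_ne_zero (hτ : 0 < τ) (hM : 1 ≤ M) {q : ℂ} (hq : q ∈ KF τ M) (h0 : q ≠ 0)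
    {k : ℤ} (hk : k ≠ 0) : q ^ k - 1 ≠ 0 := (lam_coe hτ hM hq h0 hk).1

theorem ShiftOn.eq_zero_of_homogeneous (hτ : 0 < τ) (hM : 1 ≤ M) (hr : 0 < r)
    (hA : NearOne τ M r ρ A Ap Am) (hv : Sph τ M r ρ v N) (hvp : Sph τ M r ρ vp N)
    (hvm : Sph τ M r ρ vm N) (hp : ShiftOn τ M ρ v vp) (hm : ShiftOn τ M ρ vm v)
    {q : ℂ} (hq : q ∈ KF τ M) (h0 : q ≠ 0) {ε : ℂ} (hε : ε ∈ ball (0 : ℂ) ρ)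
    (heq : ∀ θ ∈ Strip r, A q (θ, ε) * Ap q (θ, ε) * (vp q (θ, ε) - v q (θ, ε)) =
      Am q (θ, ε) * A q (θ, ε) * (v q (θ, ε) - vm q (θ, ε)))
    (hmean : fcoef (fun z => v q (z, ε)) 0 = 0) {θ : ℂ} (hθ : θ ∈ Strip r) :
    v q (θ, ε) = 0 := by
  have hdp := hvp.sub hv
  have hsub : ShiftOn τ M ρ (fun q a => v q a - vm q a) fun q a => vp q a - v q a :=
    hp.sub hr hv hvp hvm hv hm
  have hG : IsShift q (fun z => Am q (z, ε) * A q (z, ε) * (v q (z, ε) - vm q (z, ε)))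
      fun z => A q (z, ε) * Ap q (z, ε) * (vp q (z, ε) - v q (z, ε)) :=
    ((hA.hullOn_mul hr).mul (hsub.hullOn hr (hv.sub hvm) hdp)).shiftOn q hq h0 ε hε
  set G : ℂ → ℂ := fun z => A q (z, ε) * Ap q (z, ε) * (vp q (z, ε) - v q (z, ε)) with hGdef
  have hGs := (hA.sph.mul hA.sphp).mul hdp
  have hGk : ∀ k : ℤ, k ≠ 0 → fcoef G k = 0 := fun k hk => by
    have h1 := hG k
    have h3 := fcoef_congr (v := G)
      (w := fun z => Am q (z, ε) * A q (z, ε) * (v q (z, ε) - vm q (z, ε)))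
      (fun t => heq t (ofReal_mem_Strip hr t)) k
    rw [← h3] at h1
    have h2 : (q ^ k - 1) * fcoef G k = 0 := by rw [sub_mul, one_mul, ← h1, sub_self]
    exact (mul_eq_zero.1 h2).resolve_left (zpow_sub_one_ne_zero hτ hM hq h0 hk)
  have hGc : ∀ θ ∈ Strip r, G θ = fcoef G 0 := fun θ hθ => by
    have h1 : HasSum (fun k => fcoef G k * ek k θ) (G θ) := hGs.hasSum (a := (θ, ε)) hq ⟨hθ, hε⟩
    have h2 := hasSum_single (f := fun k => fcoef G k * ek k θ) 0
      fun k hk => by rw [hGk k hk, zero_mul]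
    rw [ek_zero_left, mul_one] at h2
    exact h1.unique h2
  have hw : ∀ θ ∈ Strip r, vp q (θ, ε) - v q (θ, ε) =
      fcoef G 0 * ((A q (θ, ε))⁻¹ * (Ap q (θ, ε))⁻¹) := fun θ hθ => by
    obtain ⟨n1, n2, -⟩ := hA.ne_zero hq (a := (θ, ε)) ⟨hθ, hε⟩
    rw [← hGc θ hθ]
    simp only [hGdef]
    field_simp
  have hvk : ∀ k : ℤ, fcoef (fun z => vp q (z, ε) - v q (z, ε)) k =
      (q ^ k - 1) * fcoef (fun z => v q (z, ε)) k := fun k => by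
    rw [fcoef_sub hr (hvp.perHol hq hε) (hv.perHol hq hε), hp q hq h0 ε hε]
    ring
  have hG0 : fcoef G 0 = 0 := by
    have h1 := hvk 0
    rw [fcoef_congr (w := fun z => fcoef G 0 * ((A q (z, ε))⁻¹ * (Ap q (z, ε))⁻¹))
      (fun t => hw t (ofReal_mem_Strip hr t)), fcoef_const_mul, zpow_zero, sub_self,
      zero_mul] at h1
    refine (mul_eq_zero.1 h1).resolve_right (norm_pos_iff.1 ?_)
    exact lt_of_lt_of_le (by norm_num) (hA.mean_inv_ge hr hq hε)
  refine (hv.perHol hq hε).eq_zero (fun θ hθ => hv.norm_le hq ⟨hθ, hε⟩) (fun k => ?_) hθ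
  by_cases hk : k = 0
  · rw [hk, hmean]
  · have h1 := hvk k
    have h2 : ∀ t : ℝ, vp q (t, ε) - v q (t, ε) = 0 := fun t => by
      rw [hw t (ofReal_mem_Strip hr t), hG0, zero_mul]
    rw [fcoef_congr (w := fun _ => (0 : ℂ)) h2] at h1
    have h3 : fcoef (fun _ => (0 : ℂ)) k = 0 := by simp [fcoef]
    rw [h3] at h1
    exact (mul_eq_zero.1 h1.symm).resolve_left (zpow_sub_one_ne_zero hτ hM hq h0 hk)

theorem fmul_lam_eq_fmul_lamPlus (hτ : 0 < τ) (hM : 1 ≤ M) (h : ShiftOn τ M ρ Fm F) {q : ℂ}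
    (hq : q ∈ KF τ M) (h0 : q ≠ 0) (a : ℂ × ℂ) : fmul ρ lam F q a = fmul ρ lamPlus Fm q a := by
  by_cases ha : a.2 ∈ ball (0 : ℂ) ρ
  · rw [fmul, fmul, if_pos ha, if_pos ha]
    refine tsum_congr fun k => ?_
    rw [h q hq h0 a.2 ha k, lamPlus_coe hτ hM hq h0]
    ring
  · rw [fmul, fmul, if_neg ha, if_neg ha]

/-- The equation holds everywhere on `K_M` as soon as it holds away from `0` and `∞`. -/
theorem solvesLin_of_ne_zero (hne : (AMR τ M).Nonempty) (hrr : r' < r) (hr' : 0 < r')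
    (hA : NearOne τ M r ρ A Ap Am) (hE : Sph τ M r ρ E N) {w wp wm : OnePoint ℂ → ℂ × ℂ → ℂ}
    (hw : Sph τ M r' ρ w N') (hwp : Sph τ M r' ρ wp N') (hwm : Sph τ M r' ρ wm N')
    (h : ∀ q ∈ KF τ M, q ≠ 0 → ∀ a ∈ SD r' ρ,
      A q a * Ap q a * (wp q a - w q a) - Am q a * A q a * (w q a - wm q a) =
        A q a * E q a - fcoef (fun z => A q (z, a.2) * E q (z, a.2)) 0) :
    SolvesLin τ M ρ r' A Ap Am E w wp wm := fun q hq a ha => by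
  have hA' := hA.mono hrr.le
  have h1 := (((hA'.sph.mul hA'.sphp).mul (hwp.sub hw)).sub
    ((hA'.sphm.mul hA'.sph).mul (hw.sub hwm))).sub
    (((hA.sph.mul hE).mono hrr.le le_rfl).sub ((hA.sph.mul hE).mean (hr'.trans hrr) r'))
  have h2 := h1.eq_zero hne ha (fun q hq h0 => by rw [h q hq h0 a ha, sub_self]) hq
  rw [← fcoef_zero fun z => A q (z, a.2) * E q (z, a.2)]
  linear_combination h2

theorem SolvesLin.homogeneous {w wp wm w₂ wp₂ wm₂ : OnePoint ℂ → ℂ × ℂ → ℂ}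
    (h : SolvesLin τ M ρ r' A Ap Am E w wp wm) (h₂ : SolvesLin τ M ρ r' A Ap Am E w₂ wp₂ wm₂)
    {q : OnePoint ℂ} (hq : q ∈ KM τ M) {a : ℂ × ℂ} (ha : a ∈ SD r' ρ) :
    A q a * Ap q a * (wp₂ q a - wp q a - (w₂ q a - w q a)) =
      Am q a * A q a * (w₂ q a - w q a - (wm₂ q a - wm q a)) := by
  linear_combination h₂ q hq a ha - h q hq a ha

theorem InC.sph (hne : (AMR τ M).Nonempty) (h : InC τ M r ρ u) : ∃ N, Sph τ M r ρ u N := by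
  obtain ⟨g, g', h⟩ := h
  exact ⟨_, by simpa only [sub_zero] using sph_of_memC hne h 0⟩

/-- Uniqueness of the solution of the linearized equation. -/
theorem SolvesLin.unique (hτ : 0 < τ) (hM : 1 ≤ M) (hne : (AMR τ M).Nonempty) (hr' : 0 < r')
    (hA : NearOne τ M r' ρ A Ap Am) {w wp wm w₂ wp₂ wm₂ : OnePoint ℂ → ℂ × ℂ → ℂ}
    (h : SolvesLin τ M ρ r' A Ap Am E w wp wm) (h₂ : SolvesLin τ M ρ r' A Ap Am E w₂ wp₂ wm₂)
    (hw : InC τ M r' ρ w) (hwp : InC τ M r' ρ wp) (hwm : InC τ M r' ρ wm)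
    (hw₂ : InC τ M r' ρ w₂) (hwp₂ : InC τ M r' ρ wp₂) (hwm₂ : InC τ M r' ρ wm₂)
    (hp : IsPlus τ M r' ρ w wp) (hm : IsMinus τ M r' ρ w wm)
    (hp₂ : IsPlus τ M r' ρ w₂ wp₂) (hm₂ : IsMinus τ M r' ρ w₂ wm₂)
    (hz : ZeroMean τ M ρ w) (hz₂ : ZeroMean τ M ρ w₂) {q : OnePoint ℂ} (hq : q ∈ KM τ M)
    {a : ℂ × ℂ} (ha : a ∈ SD r' ρ) : w₂ q a = w q a := by
  obtain ⟨n1, s1⟩ := hw.sph hne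
  obtain ⟨n2, s2⟩ := hwp.sph hne
  obtain ⟨n3, s3⟩ := hwm.sph hne
  obtain ⟨n4, s4⟩ := hw₂.sph hne
  obtain ⟨n5, s5⟩ := hwp₂.sph hne
  obtain ⟨n6, s6⟩ := hwm₂.sph hne
  set n := max n1 (max n2 n3)
  set n' := max n4 (max n5 n6)
  replace s1 := s1.mono (N' := n) le_rfl (le_max_left _ _)
  replace s2 := s2.mono (N' := n) le_rfl ((le_max_left _ _).trans (le_max_right _ _))
  replace s3 := s3.mono (N' := n) le_rfl ((le_max_right _ _).trans (le_max_right _ _))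
  replace s4 := s4.mono (N' := n') le_rfl (le_max_left _ _)
  replace s5 := s5.mono (N' := n') le_rfl ((le_max_left _ _).trans (le_max_right _ _))
  replace s6 := s6.mono (N' := n') le_rfl ((le_max_right _ _).trans (le_max_right _ _))
  rw [← sub_eq_zero]
  refine (s4.sub s1).eq_zero hne ha (fun q hq h0 => ?_) hq
  refine ShiftOn.eq_zero_of_homogeneous hτ hM hr' hA (v := fun q a => w₂ q a - w q a)
    (vp := fun q a => wp₂ q a - wp q a) (vm := fun q a => wm₂ q a - wm q a) (s4.sub s1)
    (s5.sub s2) (s6.sub s3) ((hp₂.shiftOn hr').sub hr' s4 s5 s1 s2 (hp.shiftOn hr'))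
    ((hm₂.shiftOn hr').sub hr' s6 s4 s3 s1 (hm.shiftOn hr')) hq h0 ha.2
    (fun θ hθ => h.homogeneous h₂ hq ⟨hθ, ha.2⟩) ?_ ha.1
  rw [fcoef_sub hr' (s4.perHol hq ha.2) (s1.perHol hq ha.2), fcoef_zero, fcoef_zero,
    hz₂ q hq _ ha.2, hz q hq _ ha.2, sub_zero]

end

section
variable {τ M r r' ρ N S S' d : ℝ} {u v up vp : OnePoint ℂ → ℂ × ℂ → ℂ}
  {A Ap Am E F Fm : OnePoint ℂ → ℂ × ℂ → ℂ} {D Dp D' : ℤ → ℝ} {m mp : ℤ → OnePoint ℂ → ℂ}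

theorem ShiftOn.congr (hr : 0 < r) (h : ShiftOn τ M ρ u up)
    (hu : ∀ q ∈ KM τ M, ∀ a ∈ SD r ρ, v q a = u q a)
    (hup : ∀ q ∈ KM τ M, ∀ a ∈ SD r ρ, vp q a = up q a) : ShiftOn τ M ρ v vp :=
  fun q hq h0 ε hε k => by
    rw [fcoef_congr (w := fun z => up q (z, ε)) fun t => hup q hq _ ⟨ofReal_mem_Strip hr t, hε⟩,
      h q hq h0 ε hε k]
    rw [fcoef_congr (v := fun z => v q (z, ε)) (w := fun z => u q (z, ε))
      fun t => hu q hq _ ⟨ofReal_mem_Strip hr t, hε⟩]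

theorem RealOn.congr (hr : 0 < r) (h : RealOn τ M ρ u)
    (hu : ∀ q ∈ KM τ M, ∀ a ∈ SD r ρ, v q a = u q a) : RealOn τ M ρ v :=
  fun q hq h0 ε hε t => by
    rw [hu q hq _ ⟨ofReal_mem_Strip hr t, conj_mem_ball.2 hε⟩,
      hu _ (conj_inv_mem_KF hq) _ ⟨ofReal_mem_Strip hr t, hε⟩, h q hq h0 ε hε t]

/-- The multipliers of `∂_θ` composed with `m`. -/
def derivMult (m : ℤ → OnePoint ℂ → ℂ) (k : ℤ) (q : OnePoint ℂ) : ℂ :=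
  2 * Real.pi * I * k * m k q

theorem exists_memC_fmul (hr : 0 < r) (h : Sph τ M r ρ u N) (hN : 0 ≤ N) (hS : 0 ≤ S)
    (hm : MultSum τ M (r - r') m D S) :
    ∃ g g', MemC τ M r' ρ (fmul ρ m u) g g' ∧ CNorm τ M r' ρ (fmul ρ m u) g g' ≤ 20 * N * S := by
  obtain ⟨g, g', h1, h2⟩ := (h.fmul' hr hN hm).exists_memC (by positivity) (fmul_add_one m)
  exact ⟨g, g', h1, h2.trans (le_of_eq (by ring))⟩

theorem dth_fmul_eq (hr : 0 < r) (h : Sph τ M r ρ u N) (hm : MultSum τ M (r - r') m D S) :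
    ∀ q ∈ KM τ M, ∀ a ∈ SD r' ρ, dth (fmul ρ m u) q a = fmul ρ (derivMult m) u q a :=
  fun _ hq _ ha => h.dth_fmul hr hm.bd hm.summable hq ha

theorem exists_memC_dth_fmul (hr : 0 < r) (h : Sph τ M r ρ u N) (hN : 0 ≤ N) (hS : 0 ≤ S')
    (hm : MultSum τ M (r - r') m D S) (hm' : MultSum τ M (r - r') (derivMult m) D' S') :
    ∃ g g', MemC τ M r' ρ (dth (fmul ρ m u)) g g' ∧
      CNorm τ M r' ρ (dth (fmul ρ m u)) g g' ≤ 20 * N * S' := by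
  obtain ⟨g, g', h1, h2⟩ := ((h.fmul' hr hN hm').congr (dth_fmul_eq hr h hm)).exists_memC
    (by positivity) (dth_add_one (fmul_add_one m))
  exact ⟨g, g', h1, h2.trans (le_of_eq (by ring))⟩

theorem CNorm_nonneg (u : OnePoint ℂ → ℂ × ℂ → ℂ) (g g' : ℂ → ℂ × ℂ → ℂ) :
    0 ≤ CNorm τ M r ρ u g g' := by
  obtain ⟨h1, h2, _, h4⟩ := fNorm_nonneg (finPart (KM τ M)) (SD r ρ)
    (fun q : ℂ => u (q : OnePoint ℂ)) g
  exact le_max_of_le_left (add_nonneg (add_nonneg h1 (le_max_of_le_left h2)) h4)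

theorem nearOne_of_memC (hne : (AMR τ M).Nonempty) (hr : 0 < r)
    {gA hA gAp hAp gAm hAm : ℂ → ℂ × ℂ → ℂ} (h : MemC τ M r ρ A gA hA)
    (hp : MemC τ M r ρ Ap gAp hAp) (hm : MemC τ M r ρ Am gAm hAm) (hsp : IsPlus τ M r ρ A Ap)
    (hsm : IsMinus τ M r ρ A Am)
    (hn : max (CNorm τ M r ρ (fun q pt => A q pt - 1) gA hA)
      (max (CNorm τ M r ρ (fun q pt => Ap q pt - 1) gAp hAp)
        (CNorm τ M r ρ (fun q pt => Am q pt - 1) gAm hAm)) ≤ 1 / 6) :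
    NearOne τ M r ρ A Ap Am := by
  obtain ⟨n1, n2⟩ := max_le_iff.1 hn
  obtain ⟨n2, n3⟩ := max_le_iff.1 n2
  have s1 := (sph_of_memC hne h 1).mono le_rfl n1
  have s2 := (sph_of_memC hne hp 1).mono le_rfl n2
  have s3 := (sph_of_memC hne hm 1).mono le_rfl n3
  have key : ∀ {u : OnePoint ℂ → ℂ × ℂ → ℂ}, Sph τ M r ρ (fun q a => u q a - 1) (1 / 6) →
      Sph τ M r ρ u (7 / 6) := fun {u} h => by
    have := (h.add (Sph.const 1)).mono le_rfl (N' := 7 / 6) (by norm_num)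
    simpa only [sub_add_cancel] using this
  exact ⟨key s1, key s2, key s3, fun q hq a ha => s1.norm_le hq ha,
    fun q hq a ha => s2.norm_le hq ha, fun q hq a ha => s3.norm_le hq ha, hsp.shiftOn hr,
    hsm.shiftOn hr⟩

/-- The constant of the norm estimates. -/
def solConst (τ : ℝ) : ℝ :=
  40 * 10 ^ 12 * (9 * (2 * (3 + 2 * τ) ^ (3 + 2 * τ))) * 2 ^ (2 * (4 + 2 * τ) + 1) *
    (9 * (2 * (3 + 2 * τ) ^ (3 + 2 * τ)) + 18 * Real.pi * (2 * (4 + 2 * τ) ^ (4 + 2 * τ)))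

theorem solConst_pos (hτ : 0 < τ) : 0 < solConst τ := by
  unfold solConst; positivity

theorem solConst_bounds (hτ : 0 < τ) (hd : 0 < d) (hN : 0 ≤ N) {S S' : ℝ}
    (hS : S = 9 * M ^ 2 * (2 * (3 + 2 * τ) ^ (3 + 2 * τ) / (d / 2) ^ (4 + 2 * τ)))
    (hS' : S' = 18 * Real.pi * M ^ 2 *
      (2 * (4 + 2 * τ) ^ (4 + 2 * τ) / (d / 2) ^ (4 + 2 * τ + 1))) :
    20 * (2 * 10 ^ 12 * (N * S)) * S ≤
        solConst τ * M ^ 4 / d ^ (2 * (4 + 2 * τ)) * N ∧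
      20 * (2 * 10 ^ 12 * (N * S)) * S' ≤
        solConst τ * M ^ 4 / d ^ (2 * (4 + 2 * τ) + 1) * N := by
  set p := 4 + 2 * τ with hp
  have hp0 : 0 < p := by rw [hp]; linarith
  have hx : 0 < d ^ p := Real.rpow_pos_of_pos hd _
  have hy : (0:ℝ) < 2 ^ p := Real.rpow_pos_of_pos two_pos _
  have e1 : (d / 2) ^ p = d ^ p / 2 ^ p := Real.div_rpow hd.le two_pos.le _
  have e2 : (d / 2) ^ (p + 1) = d ^ p * d / (2 ^ p * 2) := by
    rw [Real.rpow_add_one (by positivity), e1]; field_simp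
  have e3 : d ^ (2 * p) = d ^ p * d ^ p := by rw [two_mul, Real.rpow_add hd]
  have e4 : (2:ℝ) ^ (2 * p + 1) = 2 ^ p * 2 ^ p * 2 := by
    rw [Real.rpow_add_one two_ne_zero, two_mul, Real.rpow_add two_pos]
  have e5 : d ^ (2 * p + 1) = d ^ p * d ^ p * d := by
    rw [Real.rpow_add_one hd.ne', e3]
  set P : ℝ := 9 * (2 * (3 + 2 * τ) ^ (3 + 2 * τ)) with hP
  set P' : ℝ := 18 * Real.pi * (2 * p ^ p) with hP'
  have hP0 : 0 < P := by rw [hP]; positivity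
  have hP0' : 0 < P' := by rw [hP']; positivity
  have f1 : S = P * M ^ 2 * 2 ^ p / d ^ p := by
    rw [hS, e1, hP]; field_simp
  have f2 : S' = P' * M ^ 2 * (2 ^ p * 2) / (d ^ p * d) := by
    rw [hS', e2, hP']; field_simp
  have f3 : solConst τ = 40 * 10 ^ 12 * P * (2 ^ p * 2 ^ p * 2) * (P + P') := by
    rw [solConst, ← hp, e4]
  rw [f1, f2, f3, e3, e5]
  constructor
  · have : 20 * (2 * 10 ^ 12 * (N * (P * M ^ 2 * 2 ^ p / d ^ p))) * (P * M ^ 2 * 2 ^ p / d ^ p) =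
        (40 * 10 ^ 12 * P * (2 ^ p * 2 ^ p) * M ^ 4 * N / (d ^ p * d ^ p)) * P := by
      field_simp; ring
    rw [this, show 40 * 10 ^ 12 * P * (2 ^ p * 2 ^ p * 2) * (P + P') * M ^ 4 / (d ^ p * d ^ p) * N =
      (40 * 10 ^ 12 * P * (2 ^ p * 2 ^ p) * M ^ 4 * N / (d ^ p * d ^ p)) * (2 * (P + P')) by
        field_simp]
    exact mul_le_mul_of_nonneg_left (by linarith) (by positivity)
  · have : 20 * (2 * 10 ^ 12 * (N * (P * M ^ 2 * 2 ^ p / d ^ p))) *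
        (P' * M ^ 2 * (2 ^ p * 2) / (d ^ p * d)) =
        (40 * 10 ^ 12 * P * (2 ^ p * 2 ^ p * 2) * M ^ 4 * N / (d ^ p * d ^ p * d)) * P' := by
      field_simp; ring
    rw [this, show 40 * 10 ^ 12 * P * (2 ^ p * 2 ^ p * 2) * (P + P') * M ^ 4 /
        (d ^ p * d ^ p * d) * N =
      (40 * 10 ^ 12 * P * (2 ^ p * 2 ^ p * 2) * M ^ 4 * N / (d ^ p * d ^ p * d)) * (P + P') by
        field_simp]
    exact mul_le_mul_of_nonneg_left (by linarith) (by positivity)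

end

/-- Solution of the linearized equation: for `0 < r' < r`,
`E ∈ C_{r,ℝ}`, `A ∈ C^±_{r,ℝ}` with `‖A−1‖^±_r ≤ 1/6`, there is a unique
`w = F(A,E) ∈ C^±_{r',ℝ}` with `⟨w⟩ = 0` and
`A·Δ(Aw) − (Aw)·ΔA = A·E − ⟨A·E⟩`; moreover `∂_θw ∈ C^±_{r',ℝ}` and, for a
constant `C₂ > 0` depending only on `τ`,
`‖w‖^±_{r'} ≤ C₂M⁴(r−r')^{−2σ}‖E‖_r` and
`‖∂_θw‖^±_{r'} ≤ C₂M⁴(r−r')^{−2σ−1}‖E‖_r` with `σ = 4+2τ`. -/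
theorem linearized_equation_solution (τ : ℝ) (hτ : 0 < τ) :
    ∃ C₂ : ℝ, 0 < C₂ ∧
      ∀ M ρ r r' : ℝ, 2 * zetaR (1 + τ) < M → 0 < ρ → 0 < r' → r' < r →
        ∀ E A Ap Am : OnePoint ℂ → ℂ × ℂ → ℂ,
          ∀ gE hE gA hA gAp hAp gAm hAm : ℂ → ℂ × ℂ → ℂ,
            -- `E ∈ C_{r,ℝ}` :
            MemC τ M r ρ E gE hE → RealSym τ M E →
            -- `A ∈ C^±_{r,ℝ}` :
            MemC τ M r ρ A gA hA → MemC τ M r ρ Ap gAp hAp → MemC τ M r ρ Am gAm hAm →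
            IsPlus τ M r ρ A Ap → IsMinus τ M r ρ A Am → RealSym τ M A →
            -- `‖A − 1‖^±_r ≤ 1/6` :
            max (CNorm τ M r ρ (fun q pt => A q pt - 1) gA hA)
                (max (CNorm τ M r ρ (fun q pt => Ap q pt - 1) gAp hAp)
                  (CNorm τ M r ρ (fun q pt => Am q pt - 1) gAm hAm)) ≤ 1 / 6 →
            ∃ w wp wm : OnePoint ℂ → ℂ × ℂ → ℂ,
              ∃ gw hw gwp hwp gwm hwm : ℂ → ℂ × ℂ → ℂ,
                -- `w ∈ C^±_{r',ℝ}` with zero mean, solving the equation: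
                MemC τ M r' ρ w gw hw ∧ MemC τ M r' ρ wp gwp hwp ∧
                MemC τ M r' ρ wm gwm hwm ∧
                IsPlus τ M r' ρ w wp ∧ IsMinus τ M r' ρ w wm ∧ RealSym τ M w ∧
                ZeroMean τ M ρ w ∧ SolvesLin τ M ρ r' A Ap Am E w wp wm ∧
                -- uniqueness:
                (∀ w₂ wp₂ wm₂ : OnePoint ℂ → ℂ × ℂ → ℂ,
                  InC τ M r' ρ w₂ → InC τ M r' ρ wp₂ → InC τ M r' ρ wm₂ →
                  IsPlus τ M r' ρ w₂ wp₂ → IsMinus τ M r' ρ w₂ wm₂ → RealSym τ M w₂ →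
                  ZeroMean τ M ρ w₂ → SolvesLin τ M ρ r' A Ap Am E w₂ wp₂ wm₂ →
                  ∀ q ∈ KM τ M, ∀ pt ∈ SD r' ρ, w₂ q pt = w q pt) ∧
                -- `∂_θw ∈ C^±_{r',ℝ}` :
                InC τ M r' ρ (dth w) ∧ InC τ M r' ρ (dth wp) ∧ InC τ M r' ρ (dth wm) ∧
                IsPlus τ M r' ρ (dth w) (dth wp) ∧ IsMinus τ M r' ρ (dth w) (dth wm) ∧
                RealSym τ M (dth w) ∧
                -- norm estimates:
                max (CNorm τ M r' ρ w gw hw)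
                    (max (CNorm τ M r' ρ wp gwp hwp) (CNorm τ M r' ρ wm gwm hwm)) ≤
                  C₂ * M ^ 4 / (r - r') ^ (2 * (4 + 2 * τ)) * CNorm τ M r ρ E gE hE ∧
                ∃ gdw hdw gdwp hdwp gdwm hdwm : ℂ → ℂ × ℂ → ℂ,
                  MemC τ M r' ρ (dth w) gdw hdw ∧ MemC τ M r' ρ (dth wp) gdwp hdwp ∧
                  MemC τ M r' ρ (dth wm) gdwm hdwm ∧
                  max (CNorm τ M r' ρ (dth w) gdw hdw)
                      (max (CNorm τ M r' ρ (dth wp) gdwp hdwp)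
                        (CNorm τ M r' ρ (dth wm) gdwm hdwm)) ≤
                    C₂ * M ^ 4 / (r - r') ^ (2 * (4 + 2 * τ) + 1) *
                      CNorm τ M r ρ E gE hE := by
  refine ⟨solConst τ, solConst_pos hτ, ?_⟩
  intro M ρ r r' hM _ hr' hrr E A Ap Am gE hE gA hA gAp hAp gAm hAm memE realE memA memAp memAm
    plusA minusA realA small
  have hM1 : 1 ≤ M := by linarith [one_le_zetaR (s := 1 + τ) (by linarith)]
  have hne := AMR_nonempty hτ hM
  have hr := hr'.trans hrr
  have hd : 0 < r - r' := sub_pos.2 hrr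
  obtain ⟨s, hs⟩ : ∃ s, s = (r + r') / 2 := ⟨_, rfl⟩
  have hs0 : 0 < s := by linarith
  have hsr : s < r := by linarith
  have hd2 : 0 < (r - r') / 2 := by linarith
  have e1 : r - s = (r - r') / 2 := by rw [hs]; ring
  have e2 : s - r' = (r - r') / 2 := by rw [hs]; ring
  have near := nearOne_of_memC hne hr memA memAp memAm plusA minusA small
  have sphE : Sph τ M r ρ E (CNorm τ M r ρ E gE hE) := by
    simpa only [sub_zero] using sph_of_memC hne memE 0
  have hN := CNorm_nonneg (τ := τ) (M := M) (r := r) (ρ := ρ) E gE hE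
  obtain ⟨S, hS⟩ : ∃ S, S = 9 * M ^ 2 *
    (2 * (3 + 2 * τ) ^ (3 + 2 * τ) / ((r - r') / 2) ^ (4 + 2 * τ)) := ⟨_, rfl⟩
  obtain ⟨S', hS'⟩ : ∃ S', S' = 18 * Real.pi * M ^ 2 *
    (2 * (4 + 2 * τ) ^ (4 + 2 * τ) / ((r - r') / 2) ^ (4 + 2 * τ + 1)) := ⟨_, rfl⟩
  have hS0 : 0 ≤ S := by rw [hS]; positivity
  have hS0' : 0 ≤ S' := by rw [hS']; positivity
  obtain ⟨m1, m2⟩ := multSum_lam hτ hM1 hd2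
  have m3 := multSum_deriv hτ hd2 (multBd_lam hτ hM1)
  have m4 := multSum_deriv hτ hd2 (multBd_lamPlus hτ hM1)
  rw [← hS] at m1 m2
  rw [← hS'] at m3 m4
  obtain ⟨b1, b2⟩ := solConst_bounds (M := M) hτ hd hN hS hS'
  have realOnA := realA.realOn hr near.sph
  have realOnE := realE.realOn hr sphE
  obtain ⟨F, Fm, sF, sFm, shF, rF, zF, eqF⟩ := exists_first_integral hτ hM1 hs0 hsr near sphE hN hS0
    (e1 ▸ m1) (e1 ▸ m2) realOnA realOnE
  rw [← e2] at m1 m2 m3 m4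
  have hNF : 0 ≤ 2 * 10 ^ 12 * (CNorm τ M r ρ E gE hE * S) := by positivity
  have zFm : ∀ q ∈ KF τ M, q ≠ 0 → ∀ ε ∈ ball (0 : ℂ) ρ, fcoef (fun z => Fm q (z, ε)) 0 = 0 :=
    fun q hq h0 ε hε => by
      have := shF q hq h0 ε hε 0
      rw [zF q hq ε hε, zpow_zero, one_mul] at this
      exact this.symm
  have hlam : ∀ x ∈ KF τ M, x ≠ 0 → ∀ k, lamPlus k (x : OnePoint ℂ) =
    x ^ k * lam k (x : OnePoint ℂ) := fun x hx hx0 k => lamPlus_coe hτ hM1 hx hx0 k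
  have sw := sF.fmul' hs0 hNF m1
  have swp := sF.fmul' hs0 hNF m2
  have swm := sFm.fmul' hs0 hNF m1
  have shp : ShiftOn τ M ρ (fmul ρ lam F) (fmul ρ lamPlus F) :=
    shiftOn_fmul hs0 hr' sF m1 m2 hlam
  have shm : ShiftOn τ M ρ (fmul ρ lam Fm) (fmul ρ lam F) :=
    shiftOn_fmul_fmul hs0 hr' sFm sF shF m1
  have sdw := (sF.fmul' hs0 hNF m3).congr (dth_fmul_eq hs0 sF m1)
  have sdwp := (sF.fmul' hs0 hNF m4).congr (dth_fmul_eq hs0 sF m2)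
  have sdwm := (sFm.fmul' hs0 hNF m3).congr (dth_fmul_eq hs0 sFm m1)
  have shdp : ShiftOn τ M ρ (dth (fmul ρ lam F)) (dth (fmul ρ lamPlus F)) :=
    (shiftOn_fmul hs0 hr' sF m3 m4 fun x hx hx0 k => by
      rw [hlam x hx hx0]; ring).congr hr' (dth_fmul_eq hs0 sF m1) (dth_fmul_eq hs0 sF m2)
  have shdm : ShiftOn τ M ρ (dth (fmul ρ lam Fm)) (dth (fmul ρ lam F)) :=
    (shiftOn_fmul_fmul hs0 hr' sFm sF shF m3).congr hr' (dth_fmul_eq hs0 sFm m1)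
      (dth_fmul_eq hs0 sF m1)
  have rw' : RealSym τ M (fmul ρ lam F) := (rF.fmul hs0 hr' sF m1.bd m1.summable
    (realMult_lam hτ hM1)).realSym fun q θ ε hε => fmul_of_notMem _ q θ hε
  have rdw : RealSym τ M (dth (fmul ρ lam F)) := ((rF.fmul hs0 hr' sF m3.bd m3.summable
    (realMult_lam hτ hM1).deriv).congr hr' (dth_fmul_eq hs0 sF m1)).realSym
      fun q θ ε hε => dth_fmul_of_notMem q θ hε
  have zw : ZeroMean τ M ρ (fmul ρ lam F) := fun q hq ε hε => by
    have := sF.fcoef_fmul hs0 hr' m1.bd m1.summable hq hε 0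
    rw [zF q hq ε hε, mul_zero, fcoef_zero] at this
    exact this
  have solw : SolvesLin τ M ρ r' A Ap Am E (fmul ρ lam F) (fmul ρ lamPlus F) (fmul ρ lam Fm) :=
    solvesLin_of_ne_zero hne hrr hr' near sphE sw swp swm fun q hq h0 a ha => by
      have h1 := fmul_lamPlus_sub_fmul_lam hτ hM1 hs0 (by linarith) sF m1 m2 hq h0 ha
      have h2 := fmul_lamPlus_sub_fmul_lam hτ hM1 hs0 (by linarith) sFm m1 m2 hq h0 ha
      rw [← fmul_lam_eq_fmul_lamPlus hτ hM1 shF hq h0, zFm q hq h0 _ ha.2] at h2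
      rw [zF q hq _ ha.2] at h1
      rw [h1, h2, sub_zero, sub_zero]
      exact eqF q hq h0 a (SD_mono (by linarith) ha)
  obtain ⟨gw, hw, c1, n1⟩ := exists_memC_fmul hs0 sF hNF hS0 m1
  obtain ⟨gwp, hwp, c2, n2⟩ := exists_memC_fmul hs0 sF hNF hS0 m2
  obtain ⟨gwm, hwm, c3, n3⟩ := exists_memC_fmul hs0 sFm hNF hS0 m1
  obtain ⟨gdw, hdw, c4, n4⟩ := exists_memC_dth_fmul hs0 sF hNF hS0' m1 m3
  obtain ⟨gdwp, hdwp, c5, n5⟩ := exists_memC_dth_fmul hs0 sF hNF hS0' m2 m4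
  obtain ⟨gdwm, hdwm, c6, n6⟩ := exists_memC_dth_fmul hs0 sFm hNF hS0' m1 m3
  refine ⟨fmul ρ lam F, fmul ρ lamPlus F, fmul ρ lam Fm, gw, hw, gwp, hwp, gwm, hwm, c1, c2, c3,
    shp.isPlus swp, shm.isMinus swm, rw', zw, solw, ?_, ⟨_, _, c4⟩, ⟨_, _, c5⟩, ⟨_, _, c6⟩,
    shdp.isPlus sdwp, shdm.isMinus sdwm, rdw,
    max_le (n1.trans b1) (max_le (n2.trans b1) (n3.trans b1)),
    gdw, hdw, gdwp, hdwp, gdwm, hdwm, c4, c5, c6,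
    max_le (n4.trans b2) (max_le (n5.trans b2) (n6.trans b2))⟩
  intro w₂ wp₂ wm₂ i1 i2 i3 p₂ q₂ _ z₂ sol₂ q hq a ha
  exact solw.unique hτ hM1 hne hr' (near.mono hrr.le) sol₂ ⟨_, _, c1⟩ ⟨_, _, c2⟩ ⟨_, _, c3⟩ i1 i2 i3
    (shp.isPlus swp) (shm.isMinus swm) p₂ q₂ zw z₂ hq ha
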